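/- arXiv:1211.3531 — 3 statements merged into one kernel-verified Lean document; each statement's English description precedes it below -/
import Mathlib

section
/- Let U ⊆ ℝⁿ be a connected open set and let X₁,…,X_k : U → ℝⁿ be smooth vector fields that are bracket generating on U. Then any two points of U can be joined by a horizontal curve lying in U. -/
noncomputable section
open MeasureTheory

/-- The Lie bracket of two vector fields on `ℝⁿ`:
`[X,Y](x) = DY(x)·X(x) − DX(x)·Y(x)`. -/
def lieB {n : ℕ} (X Y : (Fin n → ℝ) → (Fin n → ℝ)) : (Fin n → ℝ) → (Fin n → ℝ) :=
  fun x => fderiv ℝ Y x (X x) - fderiv ℝ X x (Y x)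

/-- The smallest set of vector fields containing `V` and closed under Lie brackets. -/
inductive LieHull {n : ℕ} (V : Set ((Fin n → ℝ) → (Fin n → ℝ))) :
    ((Fin n → ℝ) → (Fin n → ℝ)) → Prop
  | base {X} : X ∈ V → LieHull V X
  | br {X Y} : LieHull V X → LieHull V Y → LieHull V (lieB X Y)

/-- The family `V` is bracket generating on `U`: the iterated Lie brackets of members of `V`
span `ℝⁿ` at every point of `U`. -/
def BracketGenerating {n : ℕ} (U : Set (Fin n → ℝ))
    (V : Set ((Fin n → ℝ) → (Fin n → ℝ))) : Prop :=
  ∀ x ∈ U, Submodule.span ℝ {v | ∃ Z, LieHull V Z ∧ v = Z x} = ⊤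

/-- `γ` is an (absolutely continuous) curve in `U` on `[a,b]` controlled by the vector
fields `X` with integrable controls `u`, i.e. `γ'(t) = ∑ᵢ uᵢ(t) • Xᵢ(γ(t))` a.e.,
expressed in integral form. -/
def IsControlledOn {n k : ℕ} (U : Set (Fin n → ℝ)) (X : Fin k → (Fin n → ℝ) → (Fin n → ℝ))
    (γ : ℝ → Fin n → ℝ) (a b : ℝ) (u : Fin k → ℝ → ℝ) : Prop :=
  a ≤ b ∧ (∀ t ∈ Set.Icc a b, γ t ∈ U) ∧ ContinuousOn γ (Set.Icc a b) ∧
    (∀ i, IntegrableOn (u i) (Set.Icc a b)) ∧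
    IntegrableOn (fun s => ∑ i, u i s • X i (γ s)) (Set.Icc a b) ∧
    ∀ t ∈ Set.Icc a b, γ t = γ a + ∫ s in a..t, ∑ i, u i s • X i (γ s)

/-- `γ` is horizontal on `[a,b]`: a finite concatenation of controlled curves. -/
def IsHorizontalOn {n k : ℕ} (U : Set (Fin n → ℝ)) (X : Fin k → (Fin n → ℝ) → (Fin n → ℝ))
    (γ : ℝ → Fin n → ℝ) (a b : ℝ) : Prop :=
  ∃ (N : ℕ) (t : Fin (N + 1) → ℝ) (u : Fin N → Fin k → ℝ → ℝ),
    t 0 = a ∧ t (Fin.last N) = b ∧ Monotone t ∧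
    ∀ j : Fin N, IsControlledOn U X γ (t j.castSucc) (t j.succ) (u j)


namespace Chow
open Set Filter Topology Metric Asymptotics
open scoped ContDiff

/-- Local flow of a `C¹` vector field, confined to a given neighbourhood. -/
lemma exists_flow {E : Type*} [NormedAddCommGroup E] [NormedSpace ℝ E] [CompleteSpace E]
    (V : E → E) (x0 : E) (hV : ContDiffAt ℝ 1 V x0) (W : Set E) (hW : W ∈ 𝓝 x0) :
    ∃ ε > (0 : ℝ), ∃ r > (0 : ℝ), ∃ α : E → ℝ → E, ∀ y ∈ closedBall x0 r, α y 0 = y ∧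
      (∀ t ∈ Icc (0 : ℝ) ε, α y t ∈ W) ∧
      ∀ t ∈ Icc (0 : ℝ) ε, HasDerivAt (α y) (V (α y t)) t := by
  obtain ⟨ε, hε, a, r, L, K, hr, hpl⟩ := IsPicardLindelof.of_contDiffAt_one hV
  have hpl0 := hpl 0
  have ha : 0 < a := by
    have h1 := hpl0.mul_max_le
    have h2 : (0 : ℝ) ≤ L * max (0 + ε - 0) (0 - (0 - ε)) :=
      mul_nonneg L.2 (le_max_of_le_left (by linarith))
    have h3 : (r : ℝ) ≤ a := by
      have := h2.trans h1
      linarith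
    exact lt_of_lt_of_le hr (by exact_mod_cast h3)
  obtain ⟨ρ, hρ, hρW⟩ := Metric.nhds_basis_closedBall.mem_iff.mp hW
  let a' : NNReal := min a ⟨ρ, hρ.le⟩
  have ha' : 0 < a' := lt_min ha (by exact_mod_cast hρ)
  obtain ⟨ε', hε', hpl'⟩ := IsPicardLindelof.exists_shrink_radius hε hpl0
    (a' := a') (r' := a' / 2) (min_le_left _ _) (NNReal.half_lt_self ha'.ne')
  have key : ∀ x ∈ closedBall x0 ((a' / 2 : NNReal) : ℝ), ∃ β : ℝ → E, β 0 = x ∧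
      (∀ t, β t ∈ W) ∧
      ∀ t ∈ Icc (0 - ε') (0 + ε'), HasDerivWithinAt β (V (β t)) (Icc (0 - ε') (0 + ε')) t := by
    intro x hx
    obtain ⟨β, hβ⟩ := ODE.FunSpace.exists_isFixedPt_next hpl' hx
    refine ⟨β.compProj, ?_, ?_, ?_⟩
    · have := ODE.FunSpace.compProj_val (α := β) (t := ⟨0, by simp [hε'.le]⟩)
      change β.compProj 0 = _ at this
      rw [this, ← hβ, ODE.FunSpace.next_apply₀]
    · intro t
      apply hρW
      have := ODE.FunSpace.compProj_mem_closedBall (α := β) hpl'.mul_max_le (t := t)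
      refine closedBall_subset_closedBall ?_ this
      exact_mod_cast min_le_right a ⟨ρ, hρ.le⟩
    · intro t ht
      apply ODE.hasDerivWithinAt_picard_Icc (x₀ := x) (t₀ := 0) (by simp [hε'.le])
        hpl'.continuousOn_uncurry
        β.continuous_compProj.continuousOn
        (fun _ ht' ↦ β.compProj_mem_closedBall hpl'.mul_max_le)
        ht |>.congr_of_mem _ ht
      intro t' ht'
      nth_rw 1 [← hβ]
      rw [ODE.FunSpace.compProj_of_mem ht', ODE.FunSpace.next_apply]
  choose! β hβ using key
  refine ⟨ε' / 2, by positivity, ((a' / 2 : NNReal) : ℝ), by positivity, β, ?_⟩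
  intro y hy
  obtain ⟨h1, h2, h3⟩ := hβ y hy
  refine ⟨h1, fun t _ => h2 t, fun t ht => ?_⟩
  refine (h3 t ⟨by linarith [ht.1], by linarith [ht.2]⟩).hasDerivAt ?_
  exact Icc_mem_nhds (by linarith [ht.1]) (by linarith [ht.2])


/-- Normalised bounded-control trajectory. -/
structure Traj {E : Type*} [NormedAddCommGroup E] [NormedSpace ℝ E] {k : ℕ}
    (X : Fin k → E → E) (W : Set E) (y z : E) (τ : ℝ) (γ : ℝ → E) (u : Fin k → ℝ → ℝ) :
    Prop where
  nonneg : 0 ≤ τ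
  meas : ∀ i, Measurable (u i)
  bdd : ∀ i t, |u i t| ≤ 1
  uend : ∀ i t, τ ≤ t → u i t = 0
  gend : ∀ t, τ ≤ t → γ t = z
  mem : ∀ t, 0 ≤ t → γ t ∈ W
  int : ∀ t, 0 ≤ t → IntervalIntegrable (fun s => ∑ i, u i s • X i (γ s)) volume 0 t
  eq : ∀ t, 0 ≤ t → γ t = y + ∫ s in (0 : ℝ)..t, ∑ i, u i s • X i (γ s)

/-- Reachability in time `τ` with controls bounded by one, inside `W`. -/
def Reach {E : Type*} [NormedAddCommGroup E] [NormedSpace ℝ E] {k : ℕ}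
    (X : Fin k → E → E) (W : Set E) (y z : E) (τ : ℝ) : Prop :=
  ∃ γ u, Traj X W y z τ γ u

section traj
variable {E : Type*} [NormedAddCommGroup E] [NormedSpace ℝ E] {k : ℕ}
    {X : Fin k → E → E} {W : Set E}

lemma Traj.start {y z : E} {τ : ℝ} {γ u} (h : Traj X W y z τ γ u) : γ 0 = y := by
  simpa using h.eq 0 le_rfl

lemma Reach.refl {y : E} (hy : y ∈ W) : Reach X W y y 0 :=
  ⟨fun _ => y, fun _ _ => 0, le_rfl, fun _ => measurable_const, by simp, by simp, by simp,
    fun _ _ => hy, by simp, by simp⟩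

lemma Reach.nonneg {y z : E} {τ : ℝ} (h : Reach X W y z τ) : 0 ≤ τ := by
  obtain ⟨γ, u, h⟩ := h
  exact h.nonneg

lemma Reach.left_mem {y z : E} {τ : ℝ} (h : Reach X W y z τ) : y ∈ W := by
  obtain ⟨γ, u, h⟩ := h
  rw [← h.start]; exact h.mem 0 le_rfl

lemma Reach.right_mem {y z : E} {τ : ℝ} (h : Reach X W y z τ) : z ∈ W := by
  obtain ⟨γ, u, h⟩ := h
  rw [← h.gend τ le_rfl]; exact h.mem τ h.nonneg

lemma Reach.mono {W' : Set E} {y z : E} {τ : ℝ} (h : Reach X W y z τ) (hW : W ⊆ W') :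
    Reach X W' y z τ := by
  obtain ⟨γ, u, h⟩ := h
  exact ⟨γ, u, h.nonneg, h.meas, h.bdd, h.uend, h.gend, fun t ht => hW (h.mem t ht), h.int, h.eq⟩

lemma Traj.concat {x y z : E} {τ σ : ℝ} {γ β : ℝ → E} {u v : Fin k → ℝ → ℝ}
    (h : Traj X W x y τ γ u) (h' : Traj X W y z σ β v) :
    Traj X W x z (τ + σ) (fun t => if t < τ then γ t else β (t - τ))
      (fun i t => if t < τ then u i t else v i (t - τ)) := by
  have h0 := h.nonneg
  have h0' := h'.nonneg
  set F : ℝ → E := fun s => ∑ i, u i s • X i (γ s) with hF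
  set G : ℝ → E := fun s => ∑ i, v i s • X i (β s) with hG
  have hf : (fun s => ∑ i, (if s < τ then u i s else v i (s - τ)) •
      X i (if s < τ then γ s else β (s - τ))) = fun s => if s < τ then F s else G (s - τ) := by
    funext s
    split_ifs <;> rfl
  have e1 : ∀ t, t ≤ τ → 0 ≤ t → EqOn F (fun s => if s < τ then F s else G (s - τ)) (uIoo 0 t) := by
    intro t ht h0t s hs
    rw [uIoo_of_le h0t] at hs
    simp only
    rw [if_pos (lt_of_lt_of_le hs.2 ht)]
  have e2 : ∀ t, τ ≤ t → EqOn (fun s => G (s - τ))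
      (fun s => if s < τ then F s else G (s - τ)) (uIoo τ t) := by
    intro t ht s hs
    rw [uIoo_of_le ht] at hs
    simp only
    rw [if_neg (not_lt.2 hs.1.le)]
  have i1 : ∀ t, t ≤ τ → 0 ≤ t →
      IntervalIntegrable (fun s => if s < τ then F s else G (s - τ)) volume 0 t :=
    fun t ht h0t => (h.int t h0t).congr_uIoo (e1 t ht h0t)
  have i2 : ∀ t, τ ≤ t →
      IntervalIntegrable (fun s => if s < τ then F s else G (s - τ)) volume τ t := by
    intro t ht
    refine IntervalIntegrable.congr_uIoo ?_ (e2 t ht)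
    have := (h'.int (t - τ) (by linarith)).comp_sub_right τ
    simpa using this
  have j1 : ∀ t, t ≤ τ → 0 ≤ t →
      ∫ s in (0 : ℝ)..t, (if s < τ then F s else G (s - τ)) = γ t - x := by
    intro t ht h0t
    rw [h.eq t h0t, ← intervalIntegral.integral_congr_uIoo (e1 t ht h0t)]
    simp [hF]
  have j2 : ∀ t, τ ≤ t →
      ∫ s in τ..t, (if s < τ then F s else G (s - τ)) = β (t - τ) - y := by
    intro t ht
    rw [← intervalIntegral.integral_congr_uIoo (e2 t ht), h'.eq (t - τ) (by linarith),
      intervalIntegral.integral_comp_sub_right (fun s => G s) τ]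
    simp [hG]
  refine ⟨by linarith, ?_, ?_, ?_, ?_, ?_, ?_, ?_⟩
  · intro i
    exact Measurable.ite measurableSet_Iio (h.meas i)
      ((h'.meas i).comp (measurable_id.sub_const τ))
  · intro i t
    split_ifs
    exacts [h.bdd i t, h'.bdd i _]
  · intro i t ht
    rw [if_neg (by linarith)]
    exact h'.uend i _ (by linarith)
  · intro t ht
    rw [if_neg (by linarith)]
    exact h'.gend _ (by linarith)
  · intro t ht
    split_ifs with hlt
    exacts [h.mem t ht, h'.mem _ (by linarith)]
  · intro t ht
    rw [hf]
    rcases le_total t τ with hle | hle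
    · exact i1 t hle ht
    · exact (i1 τ le_rfl h0).trans (i2 t hle)
  · intro t ht
    rw [hf]
    rcases le_total τ t with hle | hle
    · rw [← intervalIntegral.integral_add_adjacent_intervals (i1 τ le_rfl h0) (i2 t hle),
        j1 τ le_rfl h0, j2 t hle, h.gend τ le_rfl, if_neg (by linarith)]
      abel
    · rw [j1 t hle ht]
      split_ifs with hlt
      · abel
      · have : t = τ := le_antisymm hle (not_lt.1 hlt)
        subst this
        rw [h.gend t le_rfl, sub_self, h'.start]
        abel

lemma Reach.trans {x y z : E} {τ σ : ℝ} (h : Reach X W x y τ) (h' : Reach X W y z σ) :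
    Reach X W x z (τ + σ) := by
  obtain ⟨γ, u, h⟩ := h
  obtain ⟨β, v, h'⟩ := h'
  exact ⟨_, _, h.concat h'⟩

/-- Infinite concatenation. -/
lemma reach_limit (hW : IsCompact W) (hX : ∀ i, ContinuousOn (X i) W) (y : ℕ → E) (z : E)
    (hy : Tendsto y atTop (𝓝 z)) (τ : ℕ → ℝ) (hs : Summable τ)
    (h : ∀ m, Reach X W (y m) (y (m + 1)) (τ m)) : ∃ T, Reach X W (y 0) z T := by
  classical
  choose g v hg using h
  have hτ0 : ∀ m, 0 ≤ τ m := fun m => (hg m).nonneg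
  let T : ℕ → ℝ := fun m => ∑ j ∈ Finset.range m, τ j
  let G : ℕ → (ℝ → E) × (Fin k → ℝ → ℝ) := fun m => Nat.rec (motive := fun _ =>
    (ℝ → E) × (Fin k → ℝ → ℝ)) (fun _ => y 0, fun _ _ => 0)
    (fun m p => (fun t => if t < T m then p.1 t else g m (t - T m),
      fun i t => if t < T m then p.2 i t else v m i (t - T m))) m
  have hG : ∀ m, Traj X W (y 0) (y m) (T m) (G m).1 (G m).2 := by
    intro m
    induction m with
    | zero =>
      have hy0 : y 0 ∈ W := by
        rw [← (hg 0).start]; exact (hg 0).mem 0 le_rfl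
      simp only [T, G, Finset.range_zero, Finset.sum_empty]
      exact ⟨le_rfl, fun _ => measurable_const, by simp, by simp, by simp,
        fun _ _ => hy0, by simp, by simp⟩
    | succ m ih =>
      have : T (m + 1) = T m + τ m := Finset.sum_range_succ _ _
      rw [this]
      exact ih.concat (hg m)
  have hTmono : Monotone T := monotone_nat_of_le_succ fun m => by
    simp only [T, Finset.sum_range_succ]; linarith [hτ0 m]
  have hTlim : Tendsto T atTop (𝓝 (∑' j, τ j)) := hs.hasSum.tendsto_sum_nat
  have hTle : ∀ m, T m ≤ ∑' j, τ j := fun m => hTmono.ge_of_tendsto hTlim m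
  set Tt := ∑' j, τ j
  have hstab : ∀ t M, t < T M → ∀ m, M ≤ m → (G m).1 t = (G M).1 t ∧
      ∀ i, (G m).2 i t = (G M).2 i t := by
    intro t M hM m hm
    induction m, hm using Nat.le_induction with
    | base => simp
    | succ m hm ih =>
      have : t < T m := lt_of_lt_of_le hM (hTmono hm)
      rw [← ih.1]
      refine ⟨?_, fun i => ?_⟩
      · simp [G, this]
      · rw [← ih.2 i]; simp [G, this]
  have hconv : ∀ t, ∃ l : E × (Fin k → ℝ), (Tendsto (fun m => (G m).1 t) atTop (𝓝 l.1) ∧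
      ∀ i, Tendsto (fun m => (G m).2 i t) atTop (𝓝 (l.2 i))) ∧
      (Tt ≤ t → l.1 = z ∧ ∀ i, l.2 i = 0) := by
    intro t
    rcases lt_or_ge t Tt with hlt | hge
    · obtain ⟨M, hM⟩ := (hTlim.eventually (lt_mem_nhds hlt)).exists
      refine ⟨((G M).1 t, fun i => (G M).2 i t), ⟨?_, fun i => ?_⟩, fun h => absurd h (not_le.2 hlt)⟩
      · refine tendsto_const_nhds.congr' ?_
        filter_upwards [eventually_ge_atTop M] with m hm
        exact ((hstab t M hM m hm).1).symm
      · refine tendsto_const_nhds.congr' ?_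
        filter_upwards [eventually_ge_atTop M] with m hm
        exact ((hstab t M hM m hm).2 i).symm
    · refine ⟨(z, fun _ => 0), ⟨?_, fun i => ?_⟩, fun _ => ⟨rfl, fun _ => rfl⟩⟩
      · refine hy.congr fun m => ?_
        exact ((hG m).gend t ((hTle m).trans hge)).symm
      · refine tendsto_const_nhds.congr fun m => ?_
        exact ((hG m).uend i t ((hTle m).trans hge)).symm
  choose l hl hlend using hconv
  have hmem : ∀ t, 0 ≤ t → (l t).1 ∈ W := fun t ht =>
    hW.isClosed.mem_of_tendsto (hl t).1 (Eventually.of_forall fun m => (hG m).mem t ht)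
  have hbd : ∀ i, ∃ C, ∀ x ∈ W, ‖X i x‖ ≤ C := fun i => hW.exists_bound_of_continuousOn (hX i)
  choose C hC using hbd
  have hptw : ∀ t, 0 ≤ t → Tendsto (fun m => ∑ i, (G m).2 i t • X i ((G m).1 t)) atTop
      (𝓝 (∑ i, (l t).2 i • X i ((l t).1))) := by
    intro t ht
    refine tendsto_finsetSum _ fun i _ => ((hl t).2 i).smul ?_
    refine (hX i _ (hmem t ht)).tendsto.comp ?_
    exact tendsto_nhdsWithin_iff.2 ⟨(hl t).1, Eventually.of_forall fun m => (hG m).mem t ht⟩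
  have hbound : ∀ m t, 0 ≤ t → ‖∑ i, (G m).2 i t • X i ((G m).1 t)‖ ≤ ∑ i, C i := by
    intro m t ht
    refine norm_sum_le_of_le _ fun i _ => ?_
    rw [norm_smul]
    have h1 := (hG m).bdd i t
    have h2 := hC i _ ((hG m).mem t ht)
    calc _ ≤ 1 * ‖X i ((G m).1 t)‖ := by gcongr; exact h1
      _ ≤ C i := by linarith
  refine ⟨Tt, fun t => (l t).1, fun i t => (l t).2 i, ?_, ?_, ?_, ?_, ?_, hmem, ?_, ?_⟩
  · exact le_trans (by simp [T]) (hTle 0)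
  · intro i
    exact measurable_of_tendsto_metrizable (fun m => (hG m).meas i)
      (tendsto_pi_nhds.2 fun t => (hl t).2 i)
  · intro i t
    exact le_of_tendsto ((hl t).2 i).abs (Eventually.of_forall fun m => (hG m).bdd i t)
  · intro i t ht
    exact (hlend t ht).2 i
  · intro t ht
    exact (hlend t ht).1
  · intro t ht
    have hmeas : AEStronglyMeasurable (fun s => ∑ i, (l s).2 i • X i ((l s).1))
        (volume.restrict (Ioc 0 t)) := by
      refine aestronglyMeasurable_of_tendsto_ae atTop
        (fun m => ((intervalIntegrable_iff_integrableOn_Ioc_of_le ht).1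
          ((hG m).int t ht)).aestronglyMeasurable) ?_
      filter_upwards [ae_restrict_mem measurableSet_Ioc] with s hs
      exact hptw s hs.1.le
    rw [intervalIntegrable_iff_integrableOn_Ioc_of_le ht]
    refine Integrable.of_bound hmeas (∑ i, C i) ?_
    filter_upwards [ae_restrict_mem measurableSet_Ioc] with s hs
    exact le_of_tendsto (hptw s hs.1.le).norm (Eventually.of_forall fun m => hbound m s hs.1.le)
  · intro t ht
    have hlim : Tendsto (fun m => y 0 + ∫ s in (0 : ℝ)..t, ∑ i, (G m).2 i s • X i ((G m).1 s)) atTop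
        (𝓝 (y 0 + ∫ s in (0 : ℝ)..t, ∑ i, (l s).2 i • X i ((l s).1))) := by
      refine Tendsto.const_add _ ?_
      refine intervalIntegral.tendsto_integral_filter_of_dominated_convergence
        (fun _ => ∑ i, C i) ?_ ?_ ?_ ?_
      · refine Eventually.of_forall fun m => ?_
        rw [uIoc_of_le ht]
        exact ((intervalIntegrable_iff_integrableOn_Ioc_of_le ht).1
          ((hG m).int t ht)).aestronglyMeasurable
      · refine Eventually.of_forall fun m => Eventually.of_forall fun s hs => ?_
        rw [uIoc_of_le ht] at hs
        exact hbound m s hs.1.le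
      · exact intervalIntegrable_const
      · refine Eventually.of_forall fun s hs => ?_
        rw [uIoc_of_le ht] at hs
        exact hptw s hs.1.le
    refine tendsto_nhds_unique (hl t).1 (hlim.congr fun m => ?_)
    exact ((hG m).eq t ht).symm

/-- Constant control trajectory. -/
lemma reach_const (c : Fin k → ℝ) (hc : ∀ i, |c i| ≤ 1) (hX : ∀ i, ContinuousOn (X i) W)
    (α : ℝ → E) (τ : ℝ) (hτ : 0 ≤ τ) (hα : ∀ t ∈ Icc (0 : ℝ) τ, α t ∈ W)
    (hd : ∀ t ∈ Icc (0 : ℝ) τ, HasDerivAt α (∑ i, c i • X i (α t)) t) [CompleteSpace E] :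
    Reach X W (α 0) (α τ) τ := by
  have hαc : ContinuousOn α (Icc 0 τ) := fun t ht => (hd t ht).continuousAt.continuousWithinAt
  have hcont : ContinuousOn (fun t => ∑ i, c i • X i (α t)) (Icc 0 τ) :=
    continuousOn_finsetSum _ fun i _ => ((hX i).comp hαc hα).const_smul (c i)
  set f : ℝ → E := fun t => ∑ i, c i • X i (α t) with hf
  set F : ℝ → E := fun s => ∑ i, (if s < τ then c i else 0) • X i (α (min s τ)) with hF
  have e1 : ∀ t, t ≤ τ → 0 ≤ t → EqOn f F (uIoo 0 t) := by
    intro t ht h0t s hs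
    rw [uIoo_of_le h0t] at hs
    have : s < τ := lt_of_lt_of_le hs.2 ht
    simp [hf, hF, this, this.le]
  have e2 : ∀ t, τ ≤ t → EqOn (fun _ => (0 : E)) F (uIoo τ t) := by
    intro t ht s hs
    rw [uIoo_of_le ht] at hs
    simp [hF, not_lt.2 hs.1.le]
  have i0 : ∀ t, t ≤ τ → 0 ≤ t → IntervalIntegrable f volume 0 t := by
    intro t ht h0t
    refine ContinuousOn.intervalIntegrable (hcont.mono ?_)
    rw [uIcc_of_le h0t]
    exact Icc_subset_Icc_right ht
  have i1 : ∀ t, t ≤ τ → 0 ≤ t → IntervalIntegrable F volume 0 t := fun t ht h0t =>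
    (i0 t ht h0t).congr_uIoo (e1 t ht h0t)
  have i2 : ∀ t, τ ≤ t → IntervalIntegrable F volume τ t := fun t ht =>
    IntervalIntegrable.congr_uIoo intervalIntegrable_const (e2 t ht)
  have j1 : ∀ t, t ≤ τ → 0 ≤ t → ∫ s in (0 : ℝ)..t, F s = α t - α 0 := by
    intro t ht h0t
    rw [← intervalIntegral.integral_congr_uIoo (e1 t ht h0t)]
    refine intervalIntegral.integral_eq_sub_of_hasDerivAt (fun s hs => ?_) (i0 t ht h0t)
    rw [uIcc_of_le h0t] at hs
    exact hd s ⟨hs.1, hs.2.trans ht⟩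
  refine ⟨fun t => α (min t τ), fun i t => if t < τ then c i else 0, hτ, ?_, ?_, ?_, ?_, ?_, ?_, ?_⟩
  · intro i
    exact Measurable.ite measurableSet_Iio measurable_const measurable_const
  · intro i t
    split_ifs
    · exact hc i
    · simp
  · intro i t ht
    simp [not_lt.2 ht]
  · intro t ht
    simp [ht]
  · intro t ht
    exact hα _ ⟨le_min ht hτ, min_le_right _ _⟩
  · intro t ht
    rcases le_total t τ with hle | hle
    · exact i1 t hle ht
    · exact (i1 τ le_rfl hτ).trans (i2 t hle)
  · intro t ht
    change _ = _ + ∫ s in (0 : ℝ)..t, F s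
    rcases le_total t τ with hle | hle
    · rw [j1 t hle ht, min_eq_left hle]; abel
    · rw [← intervalIntegral.integral_add_adjacent_intervals (i1 τ le_rfl hτ) (i2 t hle),
        j1 τ le_rfl hτ, ← intervalIntegral.integral_congr_uIoo (e2 t hle), min_eq_right hle]
      simp

end traj


section ops
variable {n : ℕ}

/-- Functions smooth on `U`. -/
def Sm (U : Set (Fin n → ℝ)) : Submodule ℝ ((Fin n → ℝ) → (Fin n → ℝ)) where
  carrier := {f | ContDiffOn ℝ ∞ f U}
  add_mem' := fun ha hb => ContDiffOn.add ha hb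
  zero_mem' := contDiffOn_const
  smul_mem' := fun c _ hf => ContDiffOn.const_smul c hf

lemma Sm.diffAt {U : Set (Fin n → ℝ)} (hU : IsOpen U) {f : (Fin n → ℝ) → (Fin n → ℝ)}
    (hf : ContDiffOn ℝ ∞ f U) {x} (hx : x ∈ U) : DifferentiableAt ℝ f x :=
  (hf.contDiffAt (hU.mem_nhds hx)).differentiableAt (by simp)

lemma contDiffOn_fderiv_apply {U : Set (Fin n → ℝ)} (hU : IsOpen U)
    {f V : (Fin n → ℝ) → (Fin n → ℝ)}
    (hf : ContDiffOn ℝ ∞ f U) (hV : ContDiffOn ℝ ∞ V U) :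
    ContDiffOn ℝ ∞ (fun x => fderiv ℝ f x (V x)) U :=
  (hf.fderiv_of_isOpen hU (by simp)).clm_apply hV

lemma contDiffOn_lieB {U : Set (Fin n → ℝ)} (hU : IsOpen U)
    {V Z : (Fin n → ℝ) → (Fin n → ℝ)}
    (hV : ContDiffOn ℝ ∞ V U) (hZ : ContDiffOn ℝ ∞ Z U) :
    ContDiffOn ℝ ∞ (lieB V Z) U :=
  (contDiffOn_fderiv_apply hU hZ hV).sub (contDiffOn_fderiv_apply hU hV hZ)

open Classical in
/-- Derivation along `V`. -/
def Dop (U : Set (Fin n → ℝ)) (hU : IsOpen U) (V : Sm U) : Module.End ℝ (Sm U) where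
  toFun f := ⟨fun x => if x ∈ U then fderiv ℝ f.1 x (V.1 x) else 0,
    (contDiffOn_fderiv_apply hU f.2 V.2).congr fun x hx => by simp [hx]⟩
  map_add' f g := by
    ext1; funext x
    by_cases hx : x ∈ U
    · have := fderiv_add (Sm.diffAt hU f.2 hx) (Sm.diffAt hU g.2 hx)
      simp [hx, this]
    · simp [hx]
  map_smul' c f := by
    ext1; funext x
    by_cases hx : x ∈ U
    · have := fderiv_const_smul (Sm.diffAt hU f.2 hx) c
      simp [hx, this]
    · simp [hx]

lemma Dop_apply {U : Set (Fin n → ℝ)} {hU : IsOpen U} {V f : Sm U} {x} (hx : x ∈ U) :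
    (Dop U hU V f).1 x = fderiv ℝ f.1 x (V.1 x) := by
  simp [Dop, hx]

lemma Dop_apply_not {U : Set (Fin n → ℝ)} {hU : IsOpen U} {V f : Sm U} {x} (hx : x ∉ U) :
    (Dop U hU V f).1 x = 0 := by
  simp [Dop, hx]

lemma Dop_neg {U : Set (Fin n → ℝ)} {hU : IsOpen U} {V : Sm U} :
    Dop U hU (-V) = - Dop U hU V := by
  ext1 f; ext1; funext x
  by_cases hx : x ∈ U
  · simp [Dop, hx]
  · simp [Dop, hx]

lemma Dop_lie {U : Set (Fin n → ℝ)} {hU : IsOpen U} (V Z : Sm U) :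
    Dop U hU V * Dop U hU Z - Dop U hU Z * Dop U hU V =
      Dop U hU ⟨lieB V.1 Z.1, contDiffOn_lieB hU V.2 Z.2⟩ := by
  have key : ∀ (V Z f : Sm U) x, x ∈ U → (Dop U hU V (Dop U hU Z f)).1 x =
      fderiv ℝ (fderiv ℝ f.1) x (V.1 x) (Z.1 x) + fderiv ℝ f.1 x (fderiv ℝ Z.1 x (V.1 x)) := by
    intro V Z f x hx
    rw [Dop_apply hx]
    have he : (Dop U hU Z f).1 =ᶠ[𝓝 x] fun y => fderiv ℝ f.1 y (Z.1 y) := by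
      filter_upwards [hU.mem_nhds hx] with y hy
      exact Dop_apply hy
    rw [he.fderiv_eq]
    have h1 : DifferentiableAt ℝ (fderiv ℝ f.1) x :=
      ((f.2.fderiv_of_isOpen hU (m := ∞) (by simp)).contDiffAt
        (hU.mem_nhds hx)).differentiableAt (by simp)
    rw [fderiv_clm_apply h1 (Sm.diffAt hU Z.2 hx)]
    simp [add_comm]
  ext1 f; ext1; funext x
  by_cases hx : x ∈ U
  · have hsymm : fderiv ℝ (fderiv ℝ f.1) x (V.1 x) (Z.1 x) =
        fderiv ℝ (fderiv ℝ f.1) x (Z.1 x) (V.1 x) := by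
      have : IsSymmSndFDerivAt ℝ f.1 x :=
        (f.2.contDiffAt (hU.mem_nhds hx)).isSymmSndFDerivAt
          (by simp only [minSmoothness_of_isRCLikeNormedField]; exact ENat.LEInfty.out)
      exact this _ _
    rw [Dop_apply hx]
    change (Dop U hU V (Dop U hU Z f)).1 x - (Dop U hU Z (Dop U hU V f)).1 x = _
    rw [key V Z f x hx, key Z V f x hx, hsymm]
    simp [lieB]
  · rw [Dop_apply_not hx]
    change (Dop U hU V (Dop U hU Z f)).1 x - (Dop U hU Z (Dop U hU V f)).1 x = _
    rw [Dop_apply_not hx, Dop_apply_not hx, sub_zero]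

end ops

section ps
open PowerSeries

/-- formal exponential of `t D` -/
def expS {A : Type*} [Ring A] [Algebra ℝ A] (D : A) : PowerSeries A :=
  PowerSeries.mk fun j => ((j.factorial : ℝ)⁻¹) • D ^ j

lemma expS_mul_neg {A : Type*} [Ring A] [Algebra ℝ A] (D : A) : expS D * expS (-D) = 1 := by
  ext l
  rw [PowerSeries.coeff_mul, PowerSeries.coeff_one]
  have h := (Commute.neg_right (Commute.refl D)).add_pow' l
  rw [add_neg_cancel] at h
  have h2 : ∑ p ∈ Finset.HasAntidiagonal.antidiagonal l, coeff p.1 (expS D) * coeff p.2 (expS (-D)) =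
      ((l.factorial : ℝ)⁻¹) • ((0 : A) ^ l) := by
    rw [h, Finset.smul_sum]
    refine Finset.sum_congr rfl fun p hp => ?_
    rw [Finset.HasAntidiagonal.mem_antidiagonal] at hp
    simp only [expS, coeff_mk, smul_mul_smul_comm]
    rw [← Nat.cast_smul_eq_nsmul ℝ, smul_smul]
    congr 1
    subst hp
    rw [Nat.cast_add_choose ℝ]
    field_simp
  rw [h2]
  split_ifs with h0
  · subst h0; simp
  · rw [zero_pow h0, smul_zero]

lemma expS_neg_mul {A : Type*} [Ring A] [Algebra ℝ A] (D : A) : expS (-D) * expS D = 1 := by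
  have := expS_mul_neg (-D)
  rwa [neg_neg] at this

lemma expS_form {A : Type*} [Ring A] [Algebra ℝ A] (D : A) :
    ∃ a : PowerSeries A, expS D = 1 + X ^ 1 * a ∧ constantCoeff a = D := by
  refine ⟨PowerSeries.mk fun j => coeff (j + 1) (expS D), ?_, ?_⟩
  · ext l
    cases l with
    | zero => simp [expS]
    | succ l => simp [coeff_succ_X_mul, coeff_one]
  · rw [← coeff_zero_eq_constantCoeff_apply]
    simp [expS]

lemma comm_form {A : Type*} [Ring A] {P Q a b : PowerSeries A} {d e : ℕ}
    (hP : P = 1 + X ^ d * a) (hQ : Q = 1 + X ^ e * b) :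
    P * Q = Q * P + X ^ (d + e) * (a * b - b * a) := by
  have h1 : a * X ^ e = X ^ e * a := (commute_X_pow a e).eq
  have h2 : b * X ^ d = X ^ d * b := (commute_X_pow b d).eq
  have h3 : X ^ d * a * (X ^ e * b) = X ^ (d + e) * (a * b) := by
    rw [mul_assoc, ← mul_assoc a, h1, pow_add]; simp only [mul_assoc]
  have h4 : X ^ e * b * (X ^ d * a) = X ^ (d + e) * (b * a) := by
    rw [mul_assoc, ← mul_assoc b, h2, add_comm d e, pow_add]; simp only [mul_assoc]
  rw [hP, hQ, mul_sub, ← h3, ← h4]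
  noncomm_ring

lemma group_comm {A : Type*} [Ring A] {P P' Q Q' a a' b b' : PowerSeries A} {d e : ℕ}
    (hd : 0 < d) (he : 0 < e)
    (hPP' : P * P' = 1) (hP'P : P' * P = 1) (hQQ' : Q * Q' = 1) (hQ'Q : Q' * Q = 1)
    (hP : P = 1 + X ^ d * a) (hP' : P' = 1 + X ^ d * a')
    (hQ : Q = 1 + X ^ e * b) (hQ' : Q' = 1 + X ^ e * b') :
    ∃ c c' : PowerSeries A, (P * Q * (P' * Q')) * (Q * P * (Q' * P')) = 1 ∧
      (Q * P * (Q' * P')) * (P * Q * (P' * Q')) = 1 ∧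
      P * Q * (P' * Q') = 1 + X ^ (d + e) * c ∧ Q * P * (Q' * P') = 1 + X ^ (d + e) * c' ∧
      constantCoeff c = constantCoeff a * constantCoeff b - constantCoeff b * constantCoeff a ∧
      constantCoeff c' = -
        (constantCoeff a * constantCoeff b - constantCoeff b * constantCoeff a) := by
  have cP' : constantCoeff P' = 1 := by rw [hP']; simp [hd.ne']
  have cQ' : constantCoeff Q' = 1 := by rw [hQ']; simp [he.ne']
  have e1 : P * Q * (P' * Q') = 1 + X ^ (d + e) * ((a * b - b * a) * (P' * Q')) := by
    rw [comm_form hP hQ, add_mul]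
    congr 1
    · calc Q * P * (P' * Q') = Q * (P * P') * Q' := by simp only [mul_assoc]
        _ = 1 := by rw [hPP', mul_one, hQQ']
    · rw [mul_assoc]
  have e2 : Q * P * (Q' * P') = 1 + X ^ (d + e) * ((b * a - a * b) * (Q' * P')) := by
    rw [comm_form hQ hP, add_mul]
    congr 1
    · calc P * Q * (Q' * P') = P * (Q * Q') * P' := by simp only [mul_assoc]
        _ = 1 := by rw [hQQ', mul_one, hPP']
    · rw [mul_assoc, add_comm e d]
  refine ⟨_, _, ?_, ?_, e1, e2, ?_, ?_⟩
  · calc P * Q * (P' * Q') * (Q * P * (Q' * P'))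
        = P * (Q * (P' * (Q' * Q) * P) * Q') * P' := by simp only [mul_assoc]
      _ = 1 := by rw [hQ'Q, mul_one, hP'P, mul_one, hQQ', mul_one, hPP']
  · calc Q * P * (Q' * P') * (P * Q * (P' * Q'))
        = Q * (P * (Q' * (P' * P) * Q) * P') * Q' := by simp only [mul_assoc]
      _ = 1 := by rw [hP'P, mul_one, hQ'Q, mul_one, hPP', mul_one, hQQ']
  · simp [cP', cQ']
  · simp [cP', cQ']

/-- Both `D` and `-D` are leading terms of series whose coefficients are in the class `Ad`. -/
def LeadG {A : Type*} [Ring A] (Ad : (ℕ → A) → Prop) (D : A) : Prop :=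
  ∃ d : ℕ, 0 < d ∧ ∃ P P' a a' : PowerSeries A,
    Ad (fun j => coeff j P) ∧ Ad (fun j => coeff j P') ∧ P * P' = 1 ∧ P' * P = 1 ∧
    P = 1 + X ^ d * a ∧ P' = 1 + X ^ d * a' ∧
    constantCoeff a = D ∧ constantCoeff a' = -D

/-- Closure under the Cauchy product. -/
def MC {A : Type*} [Ring A] (Ad : (ℕ → A) → Prop) : Prop := ∀ c c', Ad c → Ad c' → Ad (fun l =>
      ∑ q ∈ Finset.HasAntidiagonal.antidiagonal l, c q.1 * c' q.2)

lemma LeadG.comm {A : Type*} [Ring A] {Ad : (ℕ → A) → Prop}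
    (hm0 : MC Ad)
    {D D' : A} (h : LeadG Ad D) (h' : LeadG Ad D') :
    LeadG Ad (D * D' - D' * D) := by
  have hm : ∀ P Q : PowerSeries A, Ad (fun j => coeff j P) → Ad (fun j => coeff j Q) →
      Ad (fun j => coeff j (P * Q)) := by
    intro P Q h1 h2
    simp only [coeff_mul]
    exact hm0 _ _ h1 h2
  obtain ⟨d, hd, P, P', a, a', aP, aP', hPP', hP'P, hP, hP', ha, ha'⟩ := h
  obtain ⟨e, he, Q, Q', b, b', aQ, aQ', hQQ', hQ'Q, hQ, hQ', hb, hb'⟩ := h'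
  obtain ⟨c, c', h1, h2, h3, h4, h5, h6⟩ :=
    group_comm hd he hPP' hP'P hQQ' hQ'Q hP hP' hQ hQ'
  rw [ha, hb] at h5 h6
  exact ⟨d + e, by omega, P * Q * (P' * Q'), Q * P * (Q' * P'), c, c',
    hm _ _ (hm _ _ aP aQ) (hm _ _ aP' aQ'), hm _ _ (hm _ _ aQ aP) (hm _ _ aQ' aP'),
    h1, h2, h3, h4, h5, h6⟩

lemma leadG_exp {A : Type*} [Ring A] [Algebra ℝ A] {Ad : (ℕ → A) → Prop} {D : A}
    (h : Ad (fun j => ((j.factorial : ℝ)⁻¹) • D ^ j))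
    (h' : Ad (fun j => ((j.factorial : ℝ)⁻¹) • (-D) ^ j)) : LeadG Ad D := by
  obtain ⟨a, h1, h2⟩ := expS_form D
  obtain ⟨b, h3, h4⟩ := expS_form (-D)
  refine ⟨1, one_pos, _, _, a, b, ?_, ?_, expS_mul_neg D, expS_neg_mul D, h1, h3, h2, h4⟩
  · simpa [expS] using h
  · simpa [expS] using h'

/-- What is needed from a leading term: a series with known low order coefficients. -/
lemma LeadG.coeffs {A : Type*} [Ring A] {Ad : (ℕ → A) → Prop} {D : A} (h : LeadG Ad D) :
    ∃ d : ℕ, 0 < d ∧ ∃ c c' : ℕ → A, Ad c ∧ Ad c' ∧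
      (c 0 = 1 ∧ (∀ j, 0 < j → j < d → c j = 0) ∧ c d = D) ∧
      (c' 0 = 1 ∧ (∀ j, 0 < j → j < d → c' j = 0) ∧ c' d = -D) := by
  obtain ⟨d, hd, P, P', a, a', aP, aP', hPP', hP'P, hP, hP', ha, ha'⟩ := h
  have key : ∀ b : PowerSeries A, (coeff 0 (1 + X ^ d * b) = 1 ∧
      (∀ j, 0 < j → j < d → coeff j (1 + X ^ d * b) = 0) ∧
      coeff d (1 + X ^ d * b) = constantCoeff b) := by
    intro b
    refine ⟨?_, fun j h0 hj => ?_, ?_⟩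
    · simp [hd.ne']
    · simp [coeff_one, h0.ne', coeff_X_pow_mul', hj.not_ge]
    · simp [coeff_one, hd.ne', coeff_X_pow_mul']
  refine ⟨d, hd, _, _, aP, aP', ?_, ?_⟩
  · rw [hP, ← ha]; exact key a
  · rw [hP', ← ha']; exact key a'

end ps


section adm
variable {n k : ℕ}

/-- The filter of small positive times and points near `x0`. -/
def Lf (x0 : Fin n → ℝ) : Filter (ℝ × (Fin n → ℝ)) := 𝓝[>] (0 : ℝ) ×ˢ 𝓝 x0

lemma tendsto_fst_Lf (x0 : Fin n → ℝ) : Tendsto Prod.fst (Lf x0) (𝓝 (0 : ℝ)) :=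
  (tendsto_nhdsWithin_iff.1 tendsto_fst).1

/-- `P` is the asymptotic expansion of a family of reachable endpoints. -/
def Adm (X : Fin k → (Fin n → ℝ) → (Fin n → ℝ)) (U W : Set (Fin n → ℝ)) (x0 : Fin n → ℝ)
    (P : ℕ → Module.End ℝ (Sm U)) : Prop :=
  ∃ (Φ : ℝ × (Fin n → ℝ) → (Fin n → ℝ)) (C : ℝ), Tendsto Φ (Lf x0) (𝓝 x0) ∧
    (∀ᶠ p in Lf x0, Reach X W p.2 (Φ p) (C * p.1)) ∧
    ∀ (f : Sm U) (m : ℕ), (fun p : ℝ × (Fin n → ℝ) => f.1 (Φ p) -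
      ∑ j ∈ Finset.range m, p.1 ^ j • (P j f).1 p.2) =O[Lf x0] fun p => p.1 ^ m

variable {X : Fin k → (Fin n → ℝ) → (Fin n → ℝ)} {U W : Set (Fin n → ℝ)} {x0 : Fin n → ℝ}

lemma Adm.mul {P Q : ℕ → Module.End ℝ (Sm U)} (hP : Adm X U W x0 P)
    (hQ : Adm X U W x0 Q) : Adm X U W x0 (fun l =>
      ∑ q ∈ Finset.HasAntidiagonal.antidiagonal l, P q.1 * Q q.2) := by
  obtain ⟨Φ, C, hΦ, hR, hO⟩ := hP
  obtain ⟨Ψ, C', hΨ, hR', hO'⟩ := hQ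
  have ht : Tendsto (fun p : ℝ × (Fin n → ℝ) => (p.1, Φ p)) (Lf x0) (Lf x0) :=
    Tendsto.prodMk tendsto_fst hΦ
  refine ⟨fun p => Ψ (p.1, Φ p), C + C', hΨ.comp ht, ?_, ?_⟩
  · filter_upwards [hR, ht.eventually hR'] with p h1 h2
    rw [add_mul]
    exact h1.trans h2
  · intro f m
    have h1 := (hO' f m).comp_tendsto ht
    have h2 : ∀ j ∈ Finset.range m, (fun p : ℝ × (Fin n → ℝ) =>
        p.1 ^ j • ((Q j f).1 (Φ p) - ∑ i ∈ Finset.range (m - j),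
          p.1 ^ i • (P i (Q j f)).1 p.2)) =O[Lf x0] fun p => p.1 ^ m := by
      intro j hj
      have := (isBigO_refl (fun p : ℝ × (Fin n → ℝ) => p.1 ^ j) (Lf x0)).smul
        (hO (Q j f) (m - j))
      refine this.congr_right fun p => ?_
      rw [smul_eq_mul, ← pow_add, Nat.add_sub_cancel' (Finset.mem_range.1 hj).le]
    refine (h1.add (IsBigO.sum h2)).congr_left fun p => ?_
    have h3 : ∑ l ∈ Finset.range m, p.1 ^ l • ((∑ q ∈ Finset.HasAntidiagonal.antidiagonal l, P q.1 * Q q.2) f).1 p.2 =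
        ∑ j ∈ Finset.range m, ∑ i ∈ Finset.range (m - j),
          (p.1 ^ j * p.1 ^ i) • (P i (Q j f)).1 p.2 := by
      rw [← Finset.sum_range_diag_flip m
        (fun j i => (p.1 ^ j * p.1 ^ i) • (P i (Q j f)).1 p.2)]
      refine Finset.sum_congr rfl fun l _ => ?_
      rw [← Finset.Nat.sum_antidiagonal_eq_sum_range_succ
        (fun j i => (p.1 ^ j * p.1 ^ i) • (P i (Q j f)).1 p.2) l,
        ← Finset.Nat.sum_antidiagonal_swap]
      simp only [LinearMap.sum_apply, AddSubmonoidClass.coe_finsetSum, Finset.sum_apply,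
        Finset.smul_sum]
      refine Finset.sum_congr rfl fun q hq => ?_
      rw [Finset.HasAntidiagonal.mem_antidiagonal] at hq
      simp only [Prod.fst_swap, Prod.snd_swap]
      rw [← pow_add, hq]
      rfl
    simp only [Function.comp]
    rw [h3]
    simp only [Finset.sum_apply, smul_sub, Finset.sum_sub_distrib, Finset.smul_sum, smul_smul]
    abel

lemma adm_exp (hU : IsOpen U) (hx0 : x0 ∈ U) (hWU : W ⊆ U) (hW : W ∈ 𝓝 x0) (hWc : IsCompact W)
    (hX : ∀ i, ContDiffOn ℝ ∞ (X i) U) (c : Fin k → ℝ) (hc : ∀ i, |c i| ≤ 1) (V : Sm U)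
    (hV : ∀ x, V.1 x = ∑ i, c i • X i x) :
    Adm X U W x0 (fun j => ((j.factorial : ℝ)⁻¹) • (Dop U hU V) ^ j) := by
  obtain ⟨ε, hε, r, hr, α, hα⟩ := exists_flow V.1 x0
    ((V.2.contDiffAt (hU.mem_nhds hx0)).of_le (by exact_mod_cast le_top)) W hW
  have hmem : ∀ᶠ p in Lf x0, 0 < p.1 ∧ p.1 < ε ∧ p.2 ∈ closedBall x0 r := by
    have h1 : ∀ᶠ t in 𝓝[>] (0 : ℝ), 0 < t ∧ t < ε := Ioo_mem_nhdsGT hε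
    have h2 : ∀ᶠ y in 𝓝 x0, y ∈ closedBall x0 r := closedBall_mem_nhds x0 hr
    filter_upwards [h1.prod_mk h2] with p hp
    exact ⟨hp.1.1, hp.1.2, hp.2⟩
  have est : ∀ (m : ℕ) (f : Sm U), ∃ K, 0 ≤ K ∧ ∀ y ∈ closedBall x0 r, ∀ t ∈ Icc (0 : ℝ) ε,
      ‖f.1 (α y t) - ∑ j ∈ Finset.range m, t ^ j •
        (((j.factorial : ℝ)⁻¹) • ((Dop U hU V) ^ j) f).1 y‖ ≤ K * t ^ m := by
    intro m
    induction m with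
    | zero =>
      intro f
      obtain ⟨K, hK⟩ := hWc.exists_bound_of_continuousOn (f.2.continuousOn.mono hWU)
      refine ⟨max K 0, le_max_right _ _, fun y hy t ht => ?_⟩
      simpa using Or.inl (hK _ ((hα y hy).2.1 t ht))
    | succ m ih =>
      intro f
      obtain ⟨K, hK0, hK⟩ := ih (Dop U hU V f)
      refine ⟨K, hK0, fun y hy t ht => ?_⟩
      obtain ⟨h0, hin, hder⟩ := hα y hy
      set h : ℝ → (Fin n → ℝ) := fun s => f.1 (α y s) - ∑ j ∈ Finset.range (m + 1), s ^ j •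
        (((j.factorial : ℝ)⁻¹) • ((Dop U hU V) ^ j) f).1 y with hh
      have hd : ∀ s ∈ Icc (0 : ℝ) t, HasDerivWithinAt h ((Dop U hU V f).1 (α y s) -
          ∑ j ∈ Finset.range m, s ^ j •
          (((j.factorial : ℝ)⁻¹) • ((Dop U hU V) ^ j) (Dop U hU V f)).1 y) (Icc 0 t) s := by
        intro s hs
        have hs' : s ∈ Icc (0 : ℝ) ε := ⟨hs.1, hs.2.trans ht.2⟩
        have hsU : α y s ∈ U := hWU (hin s hs')
        refine HasDerivAt.hasDerivWithinAt ?_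
        refine HasDerivAt.sub ?_ ?_
        · rw [Dop_apply hsU]
          exact (Sm.diffAt hU f.2 hsU).hasFDerivAt.comp_hasDerivAt s (hder s hs')
        · simp only [Finset.sum_range_succ']
          have : ∀ j ∈ Finset.range m, HasDerivAt (fun s : ℝ => s ^ (j + 1) •
              ((((j + 1).factorial : ℝ)⁻¹) • ((Dop U hU V) ^ (j + 1)) f).1 y)
              (s ^ j •
              (((j.factorial : ℝ)⁻¹) • ((Dop U hU V) ^ j) (Dop U hU V f)).1 y) s := by
            intro j _
            have := (hasDerivAt_pow (j + 1) s).smul_const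
              (((((j + 1).factorial : ℝ)⁻¹) • ((Dop U hU V) ^ (j + 1)) f).1 y)
            refine this.congr_deriv (Eq.symm ?_)
            rw [pow_succ (Dop U hU V), Nat.factorial_succ]
            change s ^ j • ((j.factorial : ℝ)⁻¹ • (((Dop U hU V) ^ j) (Dop U hU V f)).1 y) =
              (((j + 1 : ℕ) : ℝ) * s ^ (j + 1 - 1)) • ((((((j + 1) * j.factorial : ℕ)) : ℝ)⁻¹) •
                (((Dop U hU V) ^ j) (Dop U hU V f)).1 y)
            rw [smul_smul, smul_smul]
            congr 1
            push_cast
            field_simp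
          have h5 := (HasDerivAt.fun_sum this).add_const
            ((s ^ 0) • ((((Nat.factorial 0 : ℕ) : ℝ)⁻¹) • ((Dop U hU V) ^ 0) f).1 y)
          simpa using h5
      have hb : ∀ s ∈ Icc (0 : ℝ) t, ‖(Dop U hU V f).1 (α y s) -
          ∑ j ∈ Finset.range m, s ^ j •
          (((j.factorial : ℝ)⁻¹) • ((Dop U hU V) ^ j) (Dop U hU V f)).1 y‖ ≤ K * t ^ m := by
        intro s hs
        refine (hK y hy s ⟨hs.1, hs.2.trans ht.2⟩).trans ?_
        have := pow_le_pow_left₀ hs.1 hs.2 m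
        gcongr
      have hfin := (convex_Icc (0 : ℝ) t).norm_image_sub_le_of_norm_hasDerivWithin_le hd hb
        (left_mem_Icc.2 ht.1) (right_mem_Icc.2 ht.1)
      have hz : h 0 = 0 := by
        simp [hh, Finset.sum_range_succ', h0]
      rw [hz, sub_zero, sub_zero, Real.norm_of_nonneg ht.1] at hfin
      calc _ ≤ _ := hfin
        _ = K * t ^ (m + 1) := by ring
  have hO : ∀ (f : Sm U) (m : ℕ), (fun p : ℝ × (Fin n → ℝ) => f.1 (α p.2 p.1) -
      ∑ j ∈ Finset.range m, p.1 ^ j • ((((j.factorial : ℝ)⁻¹) • (Dop U hU V) ^ j) f).1 p.2) =O[Lf x0]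
        fun p => p.1 ^ m := by
    intro f m
    obtain ⟨K, hK0, hK⟩ := est m f
    refine IsBigO.of_bound K ?_
    filter_upwards [hmem] with p hp
    rw [Real.norm_of_nonneg (pow_nonneg hp.1.le m)]
    have := hK p.2 hp.2.2 p.1 ⟨hp.1.le, hp.2.1.le⟩
    simpa using this
  refine ⟨fun p => α p.2 p.1, 1, ?_, ?_, hO⟩
  · have h1 := hO ⟨id, contDiffOn_id⟩ 1
    have h2 : Tendsto (fun p : ℝ × (Fin n → ℝ) => α p.2 p.1 - p.2) (Lf x0) (𝓝 0) := by
      refine IsBigO.trans_tendsto (g'' := fun p : ℝ × (Fin n → ℝ) => p.1) ?_ (tendsto_fst_Lf x0)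
      simpa using h1
    have h3 : Tendsto (fun p : ℝ × (Fin n → ℝ) => p.2) (Lf x0) (𝓝 x0) := tendsto_snd
    simpa using h2.add h3
  · filter_upwards [hmem] with p hp
    obtain ⟨h0, hin, hder⟩ := hα p.2 hp.2.2
    have := reach_const (X := X) (W := W) c hc (fun i => (hX i).continuousOn.mono hWU) (α p.2) p.1
      hp.1.le
      (fun t ht => hin t ⟨ht.1, ht.2.trans hp.2.1.le⟩)
      (fun t ht => by
        rw [← hV]
        exact hder t ⟨ht.1, ht.2.trans hp.2.1.le⟩)
    rw [h0] at this
    simpa using this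

lemma mc_adm : MC (Adm X U W x0) := by
  intro c c' h h'
  convert Adm.mul h h'

lemma lead_comm (hU : IsOpen U) (V Z : Sm U) (h : LeadG (Adm X U W x0) (Dop U hU V))
    (h' : LeadG (Adm X U W x0) (Dop U hU Z)) : LeadG (Adm X U W x0)
      (Dop U hU ⟨lieB V.1 Z.1, contDiffOn_lieB hU V.2 Z.2⟩) := by
  rw [← Dop_lie V Z]
  exact LeadG.comm mc_adm h h'

lemma lead_hull (hU : IsOpen U) (hx0 : x0 ∈ U) (hWU : W ⊆ U) (hW : W ∈ 𝓝 x0) (hWc : IsCompact W)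
    (hX : ∀ i, ContDiffOn ℝ ∞ (X i) U) {Z : (Fin n → ℝ) → (Fin n → ℝ)}
    (hZ : LieHull (Set.range X) Z) :
    ∃ hs : ContDiffOn ℝ ∞ Z U, LeadG (Adm X U W x0) (Dop U hU ⟨Z, hs⟩) := by
  induction hZ with
  | base h =>
    obtain ⟨i, rfl⟩ := h
    refine ⟨hX i, ?_⟩
    set V : Sm U := ⟨X i, hX i⟩ with hVdef
    have a1 : Adm X U W x0 (fun j => ((j.factorial : ℝ)⁻¹) • (Dop U hU V) ^ j) := by
      refine adm_exp hU hx0 hWU hW hWc hX (Pi.single i 1) (fun j => ?_) V (fun x => ?_)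
      · by_cases h : j = i
        · subst h; simp
        · simp [h]
      · simp [hVdef, Pi.single_apply]
    have a2 : Adm X U W x0 (fun j => ((j.factorial : ℝ)⁻¹) • (-Dop U hU V) ^ j) := by
      rw [← Dop_neg]
      refine adm_exp hU hx0 hWU hW hWc hX (Pi.single i (-1)) (fun j => ?_) (-V) (fun x => ?_)
      · by_cases h : j = i
        · subst h; simp
        · simp [h]
      · simp [hVdef, Pi.single_apply]
    exact leadG_exp a1 a2
  | br _ _ ih1 ih2 =>
    obtain ⟨s1, l1⟩ := ih1
    obtain ⟨s2, l2⟩ := ih2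
    refine ⟨contDiffOn_lieB hU s1 s2, ?_⟩
    exact lead_comm hU ⟨_, s1⟩ ⟨_, s2⟩ l1 l2

end adm

section good
variable {n k : ℕ}

lemma eventually_Lf_iff {x0 : Fin n → ℝ} {Q : ℝ × (Fin n → ℝ) → Prop} :
    (∀ᶠ p in Lf x0, Q p) ↔ ∃ δ > 0, ∀ s y, 0 < s → s < δ → ‖y - x0‖ < δ → Q (s, y) := by
  have hb : (Lf x0).HasBasis (fun i : ℝ × ℝ => 0 < i.1 ∧ 0 < i.2)
      (fun i => Ioo (0 : ℝ) i.1 ×ˢ ball x0 i.2) :=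
    (nhdsGT_basis (0 : ℝ)).prod nhds_basis_ball
  rw [hb.eventually_iff]
  constructor
  · rintro ⟨⟨a, b⟩, ⟨ha, hb⟩, h⟩
    refine ⟨min a b, lt_min ha hb, fun s y h0 hs hy => h ⟨⟨h0, hs.trans_le (min_le_left _ _)⟩, ?_⟩⟩
    rw [mem_ball_iff_norm]
    exact hy.trans_le (min_le_right _ _)
  · rintro ⟨δ, hδ, h⟩
    refine ⟨(δ, δ), ⟨hδ, hδ⟩, ?_⟩
    rintro ⟨s, y⟩ ⟨⟨h0, hs⟩, hy⟩
    exact h s y h0 hs (mem_ball_iff_norm.1 hy)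

/-- One can move approximately in the direction `v`. -/
def Good (X : Fin k → (Fin n → ℝ) → (Fin n → ℝ)) (W : Set (Fin n → ℝ)) (x0 v : Fin n → ℝ) : Prop :=
  ∃ κ > (0 : ℝ), ∃ C ≥ (0 : ℝ), ∀ ε > (0 : ℝ), ∀ᶠ p in Lf x0, ∃ y' τ, Reach X W p.2 y' τ ∧
    τ ≤ C * p.1 ^ κ ∧ ‖y' - p.2 - p.1 • v‖ ≤ ε * p.1

variable {X : Fin k → (Fin n → ℝ) → (Fin n → ℝ)} {U W : Set (Fin n → ℝ)} {x0 : Fin n → ℝ}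

lemma eventually_pos_Lf : ∀ᶠ p in Lf x0, 0 < p.1 :=
  eventually_Lf_iff.2 ⟨1, one_pos, fun _ _ h _ _ => h⟩

lemma good_of_adm {d : ℕ} (hd : 0 < d) {c : ℕ → Module.End ℝ (Sm U)} (hU : IsOpen U)
    (hx0 : x0 ∈ U) (hc : Adm X U W x0 c) (h0 : c 0 = 1) (hj : ∀ j, 0 < j → j < d → c j = 0)
    (Z : (Fin n → ℝ) → (Fin n → ℝ)) (hZ : ContinuousAt Z x0)
    (hcd : ∀ x ∈ U, (c d ⟨id, contDiffOn_id⟩).1 x = Z x) : Good X W x0 (Z x0) := by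
  obtain ⟨Φ, C, hΦ, hR, hO⟩ := hc
  obtain ⟨K, hK0, hK⟩ := (hO ⟨id, contDiffOn_id⟩ (d + 1)).exists_pos
  rw [isBigOWith_iff] at hK
  have hd' : (0 : ℝ) < d := by exact_mod_cast hd
  have ht : Tendsto (fun p : ℝ × (Fin n → ℝ) => (p.1 ^ (1 / (d : ℝ)), p.2)) (Lf x0) (Lf x0) := by
    refine Tendsto.prodMk ?_ tendsto_snd
    refine tendsto_nhdsWithin_iff.2 ⟨?_, ?_⟩
    · have := (tendsto_fst_Lf x0).rpow_const (p := 1 / (d : ℝ)) (Or.inr (by positivity))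
      rwa [Real.zero_rpow (by positivity)] at this
    · filter_upwards [eventually_pos_Lf] with p hp
      exact Real.rpow_pos_of_pos hp _
  refine ⟨1 / d, by positivity, max C 0, le_max_right _ _, fun ε hε => ?_⟩
  have e1 : ∀ᶠ p in Lf x0, p.2 ∈ U :=
    (tendsto_snd (f := 𝓝[>] (0 : ℝ)) (g := 𝓝 x0)).eventually (hU.mem_nhds hx0)
  have e2 : ∀ᶠ p in Lf x0, ‖Z p.2 - Z x0‖ < ε / 2 := by
    have := (tendsto_snd (f := 𝓝[>] (0 : ℝ)) (g := 𝓝 x0)).eventually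
      (hZ.eventually (ball_mem_nhds _ (half_pos hε)))
    filter_upwards [this] with p hp
    exact mem_ball_iff_norm.1 hp
  have e3 : ∀ᶠ p in Lf x0, K * p.1 < ε / 2 := by
    have := (tendsto_fst_Lf x0).const_mul K
    rw [mul_zero] at this
    exact this.eventually (gt_mem_nhds (half_pos hε))
  have e4 := (hK.and (hR.and (e1.and (e2.and e3))))
  filter_upwards [ht.eventually e4, eventually_pos_Lf] with p ⟨q1, q2, q3, q4, q5⟩ hp
  obtain ⟨s, y⟩ := p
  simp only at q1 q2 q3 q4 q5 hp ⊢
  set t := s ^ (1 / (d : ℝ)) with htdef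
  have htp : 0 < t := Real.rpow_pos_of_pos hp _
  have hts : t ^ d = s := by
    rw [htdef, ← Real.rpow_natCast, ← Real.rpow_mul hp.le]
    rw [one_div_mul_cancel hd'.ne', Real.rpow_one]
  refine ⟨Φ (t, y), C * t, q2, ?_, ?_⟩
  · gcongr
    exact le_max_left _ _
  · rw [Finset.sum_range_succ, Finset.sum_eq_single 0 (fun j hj' hj0 => by
      rw [hj j (Nat.pos_of_ne_zero hj0) (Finset.mem_range.1 hj')]; simp) (by simp [hd.ne']),
      hcd y q3, h0, hts, pow_succ, hts, Real.norm_of_nonneg (by positivity)] at q1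
    simp only [id, pow_zero, one_smul, Module.End.one_apply] at q1
    calc ‖Φ (t, y) - y - s • Z x0‖ = ‖(Φ (t, y) - (y + s • Z y)) + s • (Z y - Z x0)‖ := by
          congr 1; rw [smul_sub]; abel
      _ ≤ K * (s * t) + s * (ε / 2) := by
          refine (norm_add_le _ _).trans (add_le_add q1 ?_)
          rw [norm_smul, Real.norm_of_nonneg hp.le]
          gcongr
      _ = (K * t) * s + (ε / 2) * s := by ring
      _ ≤ (ε / 2) * s + (ε / 2) * s := by gcongr
      _ = ε * s := by ring

lemma good_zero (hW : W ∈ 𝓝 x0) : Good X W x0 0 := by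
  refine ⟨1, one_pos, 0, le_rfl, fun ε hε => ?_⟩
  have e1 : ∀ᶠ p in Lf x0, p.2 ∈ W :=
    (tendsto_snd (f := 𝓝[>] (0 : ℝ)) (g := 𝓝 x0)).eventually hW
  filter_upwards [e1, eventually_pos_Lf] with p hp h0
  refine ⟨p.2, 0, Reach.refl hp, by simp, ?_⟩
  simp only [sub_self, smul_zero, norm_zero]
  positivity

lemma Good.add {v w : Fin n → ℝ} (hv : Good X W x0 v) (hw : Good X W x0 w) :
    Good X W x0 (v + w) := by
  obtain ⟨κ, hκ, C, hC, hv⟩ := hv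
  obtain ⟨κ', hκ', C', hC', hw⟩ := hw
  refine ⟨min κ κ', lt_min hκ hκ', C + C', add_nonneg hC hC', fun ε hε => ?_⟩
  obtain ⟨δ, hδ, h1⟩ := eventually_Lf_iff.1 (hv (ε / 2) (half_pos hε))
  obtain ⟨δ', hδ', h2⟩ := eventually_Lf_iff.1 (hw (ε / 2) (half_pos hε))
  set M := ‖v‖ + ε / 2 + 1 with hM
  have hMp : 0 < M := by positivity
  refine eventually_Lf_iff.2 ⟨min (min δ 1) (min (δ' / 2) (δ' / (2 * M))), by positivity, ?_⟩
  intro s y h0 hs hy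
  simp only [lt_min_iff] at hs hy
  obtain ⟨⟨hs1, hs2⟩, hs3, hs4⟩ := hs
  obtain ⟨⟨hy1, -⟩, hy3, -⟩ := hy
  obtain ⟨y', τ, r1, r2, r3⟩ := h1 s y h0 hs1 hy1
  have hy' : ‖y' - x0‖ < δ' := by
    have : ‖y' - x0‖ ≤ ‖y' - y - s • v‖ + ‖s • v‖ + ‖y - x0‖ := by
      calc ‖y' - x0‖ = ‖(y' - y - s • v) + s • v + (y - x0)‖ := by congr 1; abel
        _ ≤ _ := norm_add₃_le
    rw [norm_smul, Real.norm_of_nonneg h0.le] at this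
    rw [lt_div_iff₀ (by positivity)] at hs4
    simp only at r3
    nlinarith
  obtain ⟨z, σ, q1, q2, q3⟩ := h2 s y' h0 (by linarith) hy'
  simp only at r1 r2 r3 q1 q2 q3 ⊢
  refine ⟨z, τ + σ, r1.trans q1, ?_, ?_⟩
  · have a1 : s ^ κ ≤ s ^ (min κ κ') :=
      Real.rpow_le_rpow_of_exponent_ge h0 hs2.le (min_le_left _ _)
    have a2 : s ^ κ' ≤ s ^ (min κ κ') :=
      Real.rpow_le_rpow_of_exponent_ge h0 hs2.le (min_le_right _ _)
    have := mul_le_mul_of_nonneg_left a1 hC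
    have := mul_le_mul_of_nonneg_left a2 hC'
    linarith
  · calc ‖z - y - s • (v + w)‖ = ‖(z - y' - s • w) + (y' - y - s • v)‖ := by
          congr 1; rw [smul_add]; abel
      _ ≤ _ := norm_add_le _ _
      _ ≤ ε / 2 * s + ε / 2 * s := add_le_add q3 r3
      _ = ε * s := by ring

lemma Good.smul {v : Fin n → ℝ} (hv : Good X W x0 v) {c : ℝ} (hc : 0 < c) :
    Good X W x0 (c • v) := by
  obtain ⟨κ, hκ, C, hC, hv⟩ := hv
  refine ⟨κ, hκ, C * c ^ κ, by positivity, fun ε hε => ?_⟩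
  obtain ⟨δ, hδ, h1⟩ := eventually_Lf_iff.1 (hv (ε / c) (by positivity))
  refine eventually_Lf_iff.2 ⟨min δ (δ / c), by positivity, ?_⟩
  intro s y h0 hs hy
  simp only [lt_min_iff] at hs hy
  obtain ⟨y', τ, r1, r2, r3⟩ := h1 (c * s) y (by positivity)
    (by rw [mul_comm]; exact (lt_div_iff₀ hc).1 hs.2) hy.1
  refine ⟨y', τ, r1, ?_, ?_⟩
  · simp only at r2 ⊢
    rwa [Real.mul_rpow hc.le h0.le, ← mul_assoc] at r2
  · simp only at r3 ⊢
    rw [smul_smul, mul_comm s c]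
    refine r3.trans (le_of_eq ?_)
    field_simp

lemma good_all (hU : IsOpen U) (hx0 : x0 ∈ U) (hWU : W ⊆ U) (hW : W ∈ 𝓝 x0) (hWc : IsCompact W)
    (hX : ∀ i, ContDiffOn ℝ ∞ (X i) U) (hbg : BracketGenerating U (Set.range X))
    (v : Fin n → ℝ) : Good X W x0 v := by
  have hv : v ∈ Submodule.span ℝ {v | ∃ Z, LieHull (Set.range X) Z ∧ v = Z x0} := by
    rw [hbg x0 hx0]; trivial
  have key : Good X W x0 v ∧ Good X W x0 (-v) := by
    induction hv using Submodule.span_induction with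
    | mem v h =>
      obtain ⟨Z, hZ, rfl⟩ := h
      obtain ⟨hs, hL⟩ := lead_hull hU hx0 hWU hW hWc hX hZ
      obtain ⟨d, hd, c, c', ac, ac', ⟨c0, c1, c2⟩, c0', c1', c2'⟩ := hL.coeffs
      have hZc : ContinuousAt Z x0 := hs.continuousOn.continuousAt (hU.mem_nhds hx0)
      refine ⟨good_of_adm hd hU hx0 ac c0 c1 Z hZc ?_,
        good_of_adm hd hU hx0 ac' c0' c1' (-Z) hZc.neg ?_⟩
      · intro x hx
        rw [c2, Dop_apply hx]
        simp
      · intro x hx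
        rw [c2', ← Dop_neg, Dop_apply hx]
        simp
    | zero => rw [neg_zero]; exact ⟨good_zero hW, good_zero hW⟩
    | add a b _ _ ha hb => rw [neg_add]; exact ⟨ha.1.add hb.1, ha.2.add hb.2⟩
    | smul c a _ ha =>
      rcases lt_trichotomy c 0 with hc | hc | hc
      · refine ⟨?_, ?_⟩
        · have := ha.2.smul (neg_pos.2 hc)
          simpa using this
        · have := ha.1.smul (neg_pos.2 hc)
          simpa using this
      · subst hc
        simp [good_zero hW]
      · refine ⟨ha.1.smul hc, ?_⟩
        have := ha.2.smul hc
        simpa using this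
  exact key.1

lemma uniform_step (hgood : ∀ v, Good X W x0 v) (hW : W ∈ 𝓝 x0) :
    ∃ κ > (0 : ℝ), ∃ C ≥ (0 : ℝ), ∃ δ > (0 : ℝ), ∀ y z, ‖y - x0‖ < δ → ‖z - y‖ < δ →
      ∃ y' τ, Reach X W y y' τ ∧ τ ≤ C * ‖z - y‖ ^ κ ∧ ‖z - y'‖ ≤ 1 / 2 * ‖z - y‖ := by
  have key : ∃ κ > (0 : ℝ), ∃ C ≥ (0 : ℝ), ∃ δ > (0 : ℝ), ∀ v ∈ sphere (0 : Fin n → ℝ) 1,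
      ∀ s y, 0 < s → s < δ → ‖y - x0‖ < δ → ∃ y' τ, Reach X W y y' τ ∧ τ ≤ C * s ^ κ ∧
        ‖y' - y - s • v‖ ≤ 1 / 2 * s := by
    refine (isCompact_sphere (0 : Fin n → ℝ) 1).induction_on (p := fun S =>
      ∃ κ > (0 : ℝ), ∃ C ≥ (0 : ℝ), ∃ δ > (0 : ℝ), ∀ v ∈ S,
      ∀ s y, 0 < s → s < δ → ‖y - x0‖ < δ → ∃ y' τ, Reach X W y y' τ ∧ τ ≤ C * s ^ κ ∧
        ‖y' - y - s • v‖ ≤ 1 / 2 * s) ?_ ?_ ?_ ?_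
    · exact ⟨1, one_pos, 0, le_rfl, 1, one_pos, fun v hv => absurd hv (by simp)⟩
    · rintro S T hST ⟨κ, hκ, C, hC, δ, hδ, h⟩
      exact ⟨κ, hκ, C, hC, δ, hδ, fun v hv => h v (hST hv)⟩
    · rintro S T ⟨κ, hκ, C, hC, δ, hδ, h⟩ ⟨κ', hκ', C', hC', δ', hδ', h'⟩
      refine ⟨min κ κ', lt_min hκ hκ', max C C', le_max_of_le_left hC,
        min 1 (min δ δ'), by positivity, ?_⟩
      intro v hv s y h0 hs hy
      simp only [lt_min_iff] at hs hy
      have hsp : 0 ≤ s ^ (min κ κ') := Real.rpow_nonneg h0.le _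
      rcases hv with hv | hv
      · obtain ⟨y', τ, r1, r2, r3⟩ := h v hv s y h0 hs.2.1 hy.2.1
        refine ⟨y', τ, r1, r2.trans ?_, r3⟩
        exact mul_le_mul (le_max_left _ _)
          (Real.rpow_le_rpow_of_exponent_ge h0 hs.1.le (min_le_left _ _))
          (Real.rpow_nonneg h0.le _) (le_max_of_le_left hC)
      · obtain ⟨y', τ, r1, r2, r3⟩ := h' v hv s y h0 hs.2.2 hy.2.2
        refine ⟨y', τ, r1, r2.trans ?_, r3⟩
        exact mul_le_mul (le_max_right _ _)
          (Real.rpow_le_rpow_of_exponent_ge h0 hs.1.le (min_le_right _ _))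
          (Real.rpow_nonneg h0.le _) (le_max_of_le_left hC)
    · intro v _
      obtain ⟨κ, hκ, C, hC, h⟩ := hgood v
      obtain ⟨δ, hδ, h1⟩ := eventually_Lf_iff.1 (h (1 / 4) (by norm_num))
      refine ⟨ball v (1 / 4), mem_nhdsWithin_of_mem_nhds (ball_mem_nhds _ (by norm_num)),
        κ, hκ, C, hC, δ, hδ, ?_⟩
      intro w hw s y h0 hs hy
      obtain ⟨y', τ, r1, r2, r3⟩ := h1 s y h0 hs hy
      refine ⟨y', τ, r1, r2, ?_⟩
      rw [mem_ball', dist_eq_norm] at hw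
      calc ‖y' - y - s • w‖ = ‖(y' - y - s • v) + s • (v - w)‖ := by
            congr 1; rw [smul_sub]; abel
        _ ≤ 1 / 4 * s + s * (1 / 4) := by
            refine (norm_add_le _ _).trans (add_le_add r3 ?_)
            rw [norm_smul, Real.norm_of_nonneg h0.le]
            gcongr
        _ = 1 / 2 * s := by ring
  obtain ⟨κ, hκ, C, hC, δ, hδ, h⟩ := key
  obtain ⟨ρ, hρ, hball⟩ := Metric.mem_nhds_iff.1 hW
  refine ⟨κ, hκ, C, hC, min δ ρ, lt_min hδ hρ, fun y z hy hz => ?_⟩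
  by_cases hzy : z = y
  · subst hzy
    refine ⟨z, 0, Reach.refl (hball (mem_ball_iff_norm.2 (hy.trans_le (min_le_right _ _)))), ?_, ?_⟩
    · rw [sub_self, norm_zero, Real.zero_rpow hκ.ne', mul_zero]
    · simp
  · have hpos : 0 < ‖z - y‖ := norm_pos_iff.2 (sub_ne_zero.2 hzy)
    obtain ⟨y', τ, r1, r2, r3⟩ := h (‖z - y‖⁻¹ • (z - y))
      (by rw [mem_sphere_zero_iff_norm, norm_smul, norm_inv, norm_norm,
            inv_mul_cancel₀ hpos.ne']) ‖z - y‖ y hpos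
      (hz.trans_le (min_le_left _ _)) (hy.trans_le (min_le_left _ _))
    refine ⟨y', τ, r1, r2, ?_⟩
    rw [smul_smul, mul_inv_cancel₀ hpos.ne', one_smul, sub_sub_sub_cancel_right] at r3
    rwa [norm_sub_rev] 

lemma local_reach (hgood : ∀ v, Good X W x0 v) (hW : W ∈ 𝓝 x0) (hWc : IsCompact W)
    (hX : ∀ i, ContinuousOn (X i) W) :
    ∃ δ > (0 : ℝ), ∀ y z, ‖y - x0‖ < δ → ‖z - x0‖ < δ → ∃ T, Reach X W y z T := by
  obtain ⟨κ, hκ, C, hC, δ, hδ, h⟩ := uniform_step hgood hW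
  refine ⟨δ / 4, by positivity, fun y z hy hz => ?_⟩
  have h' : ∀ y, ∃ y' τ, ‖y - x0‖ < δ → ‖z - y‖ < δ →
      (Reach X W y y' τ ∧ τ ≤ C * ‖z - y‖ ^ κ ∧ ‖z - y'‖ ≤ 1 / 2 * ‖z - y‖) := by
    intro y
    by_cases hc : ‖y - x0‖ < δ ∧ ‖z - y‖ < δ
    · obtain ⟨y', τ, hh⟩ := h y z hc.1 hc.2
      exact ⟨y', τ, fun _ _ => hh⟩
    · exact ⟨0, 0, fun a b => absurd ⟨a, b⟩ hc⟩
  choose F τ hF using h'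
  set Y : ℕ → (Fin n → ℝ) := fun m => F^[m] y with hY
  have hYs : ∀ m, Y (m + 1) = F (Y m) := fun m => Function.iterate_succ_apply' F m y
  set D := ‖z - y‖ with hD
  have hDδ : D < δ / 2 := by
    have : D ≤ ‖z - x0‖ + ‖y - x0‖ := by
      rw [hD, ← sub_sub_sub_cancel_right z y x0]; exact norm_sub_le _ _
    linarith
  have near : ∀ m, ‖z - Y m‖ ≤ (1 / 2) ^ m * D → ‖Y m - x0‖ < δ ∧ ‖z - Y m‖ < δ := by
    intro m hm
    have h1 : ((1 : ℝ) / 2) ^ m * D ≤ D :=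
      mul_le_of_le_one_left (norm_nonneg _) (pow_le_one₀ (by norm_num) (by norm_num))
    have h2 : ‖Y m - x0‖ ≤ ‖z - x0‖ + ‖z - Y m‖ := by
      calc ‖Y m - x0‖ = ‖(z - x0) - (z - Y m)‖ := by congr 1; abel
        _ ≤ _ := norm_sub_le _ _
    constructor <;> linarith
  have hYb : ∀ m, ‖z - Y m‖ ≤ (1 / 2) ^ m * D := by
    intro m
    induction m with
    | zero => simp [hY, hD]
    | succ m ih =>
      obtain ⟨a, b⟩ := near m ih
      have := (hF (Y m) a b).2.2
      rw [← hYs] at this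
      rw [pow_succ]
      linarith
  have hR : ∀ m, Reach X W (Y m) (Y (m + 1)) (τ (Y m)) := fun m => by
    rw [hYs]; exact (hF (Y m) (near m (hYb m)).1 (near m (hYb m)).2).1
  have hs : Summable fun m => τ (Y m) := by
    have hg : Summable fun m : ℕ => (C * D ^ κ) * (((1 : ℝ) / 2) ^ κ) ^ m :=
      (summable_geometric_of_lt_one (by positivity)
        (Real.rpow_lt_one (by norm_num) (by norm_num) hκ)).mul_left _
    refine Summable.of_nonneg_of_le (fun m => (hR m).nonneg) (fun m => ?_) hg
    refine (hF (Y m) (near m (hYb m)).1 (near m (hYb m)).2).2.1.trans ?_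
    calc C * ‖z - Y m‖ ^ κ ≤ C * ((1 / 2) ^ m * D) ^ κ := by
          have := Real.rpow_le_rpow (norm_nonneg _) (hYb m) hκ.le
          gcongr
      _ = _ := by
          rw [Real.mul_rpow (by positivity) (norm_nonneg _), ← Real.rpow_natCast,
            ← Real.rpow_mul (by norm_num), ← Real.rpow_natCast, ← Real.rpow_mul (by norm_num),
            mul_comm (m : ℝ) κ]
          ring
  have hlim : Tendsto Y atTop (𝓝 z) := by
    rw [tendsto_iff_norm_sub_tendsto_zero]
    have h0 : Tendsto (fun m : ℕ => ((1 : ℝ) / 2) ^ m * D) atTop (𝓝 0) := by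
      have := (tendsto_pow_atTop_nhds_zero_of_lt_one (r := (1 : ℝ) / 2) (by norm_num)
        (by norm_num)).mul_const D
      rwa [zero_mul] at this
    refine squeeze_zero (fun m => norm_nonneg _) (fun m => ?_) h0
    rw [norm_sub_rev]
    exact hYb m
  exact reach_limit hWc hX Y z hlim _ hs hR

lemma reach_all (hU : IsOpen U) (hUc : IsConnected U) (hX : ∀ i, ContDiffOn ℝ ∞ (X i) U)
    (hbg : BracketGenerating U (Set.range X)) {x y : Fin n → ℝ} (hx : x ∈ U) (hy : y ∈ U) :
    ∃ T, Reach X U x y T := by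
  refine hUc.isPreconnected.induction₂' (P := fun x y => ∃ T, Reach X U x y T) ?_ ?_ hx hy
  · intro x0 hx0
    obtain ⟨r, hr, hrU⟩ := Metric.nhds_basis_closedBall.mem_iff.1 (hU.mem_nhds hx0)
    have hW : closedBall x0 r ∈ 𝓝 x0 := closedBall_mem_nhds x0 hr
    have hWc : IsCompact (closedBall x0 r) := isCompact_closedBall x0 r
    obtain ⟨δ, hδ, h⟩ := local_reach (good_all hU hx0 hrU hW hWc hX hbg) hW hWc
      (fun i => (hX i).continuousOn.mono hrU)
    refine Filter.Eventually.filter_mono nhdsWithin_le_nhds ?_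
    filter_upwards [ball_mem_nhds x0 hδ] with y hy
    rw [mem_ball_iff_norm] at hy
    obtain ⟨T, hT⟩ := h x0 y (by simpa using hδ) hy
    obtain ⟨T', hT'⟩ := h y x0 hy (by simpa using hδ)
    exact ⟨⟨T, hT.mono hrU⟩, T', hT'.mono hrU⟩
  · rintro a b c _ _ _ ⟨T, hT⟩ ⟨T', hT'⟩
    exact ⟨_, hT.trans hT'⟩

lemma Traj.horizontal {y z : Fin n → ℝ} {τ : ℝ} {γ u} (h : Traj X U y z τ γ u) :
    IsHorizontalOn U X γ 0 τ := by
  have hint : IntegrableOn (fun s => ∑ i, u i s • X i (γ s)) (Icc 0 τ) := by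
    rw [← intervalIntegrable_iff_integrableOn_Icc_of_le h.nonneg]
    exact h.int τ h.nonneg
  refine ⟨1, ![0, τ], fun _ => u, rfl, rfl, ?_, ?_⟩
  · intro i j hij
    fin_cases i <;> fin_cases j <;> simp_all [h.nonneg]
  · intro j
    have : j = 0 := Subsingleton.elim _ _
    subst this
    change IsControlledOn U X γ 0 τ u
    refine ⟨h.nonneg, fun t ht => h.mem t ht.1, ?_, fun i => ?_, hint, fun t ht => ?_⟩
    · have hc : ContinuousOn (fun t => y + ∫ s in (0 : ℝ)..t, ∑ i, u i s • X i (γ s)) (Icc 0 τ) := by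
        refine continuousOn_const.add ?_
        have := intervalIntegral.continuousOn_primitive_interval
          (f := fun s => ∑ i, u i s • X i (γ s)) (a := 0) (b := τ) (μ := volume)
          (by rwa [uIcc_of_le h.nonneg])
        rwa [uIcc_of_le h.nonneg] at this
      exact hc.congr fun t ht => h.eq t ht.1
    · refine Measure.integrableOn_of_bounded (M := 1) (by simp)
        (h.meas i).aestronglyMeasurable ?_
      exact Eventually.of_forall fun t => h.bdd i t
    · rw [h.start]
      exact h.eq t ht.1

end good

end Chow

/-- **Chow's Theorem** (local, finitely generated form): if the smooth vector fields
`X₁, …, X_k` are bracket generating on the connected open set `U ⊆ ℝⁿ`, then any two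
points of `U` can be joined by a horizontal curve lying in `U`. -/
theorem chow_theorem {n k : ℕ} (U : Set (Fin n → ℝ)) (hUopen : IsOpen U)
    (hUconn : IsConnected U) (X : Fin k → (Fin n → ℝ) → (Fin n → ℝ))
    (hXsmooth : ∀ i, ContDiffOn ℝ (⊤ : ℕ∞) (X i) U)
    (hbg : BracketGenerating U (Set.range X))
    (x : Fin n → ℝ) (hx : x ∈ U) (y : Fin n → ℝ) (hy : y ∈ U) :
    ∃ (a b : ℝ) (γ : ℝ → Fin n → ℝ),
      IsHorizontalOn U X γ a b ∧ γ a = x ∧ γ b = y := by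
  obtain ⟨T, γ, u, h⟩ := Chow.reach_all hUopen hUconn hXsmooth hbg hx hy
  exact ⟨0, T, γ, h.horizontal, h.start, h.gend T le_rfl⟩
end
end

section
/- Let U ⊆ ℝⁿ be open and let X₁,…,X_k : U → ℝⁿ be smooth vector fields that are bracket generating and pointwise linearly independent on U. Then for every x₀ ∈ U and every ε > 0, the subriemannian ball B(ε, x₀) = { y ∈ U : d(x₀, y) < ε } is a neighbourhood of x₀ (i.e. contains an open set containing x₀). -/
noncomputable section
open MeasureTheory

/-- The subriemannian length of a controlled piece, for the metric making
`X₁, …, X_k` orthonormal: `∫ₐᵇ (∑ᵢ uᵢ(s)²)^{1/2} ds`. -/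
def srLength {k : ℕ} (u : Fin k → ℝ → ℝ) (a b : ℝ) : ℝ :=
  ∫ s in a..b, Real.sqrt (∑ i, (u i s) ^ 2)

/-- The set of lengths of horizontal curves in `U` joining `x` to `y`. -/
def HorizontalLengths {n k : ℕ} (U : Set (Fin n → ℝ))
    (X : Fin k → (Fin n → ℝ) → (Fin n → ℝ)) (x y : Fin n → ℝ) : Set ℝ :=
  { ℓ | ∃ (N : ℕ) (t : Fin (N + 1) → ℝ) (γ : ℝ → Fin n → ℝ) (u : Fin N → Fin k → ℝ → ℝ),
      Monotone t ∧ γ (t 0) = x ∧ γ (t (Fin.last N)) = y ∧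
      (∀ j : Fin N, IsControlledOn U X γ (t j.castSucc) (t j.succ) (u j)) ∧
      ℓ = ∑ j : Fin N, srLength (u j) (t j.castSucc) (t j.succ) }

/-- The subriemannian (Carnot–Carathéodory) distance on `U`: the infimum of lengths of
horizontal curves from `x` to `y` (`∞` if there is none). -/
def srDist {n k : ℕ} (U : Set (Fin n → ℝ)) (X : Fin k → (Fin n → ℝ) → (Fin n → ℝ))
    (x y : Fin n → ℝ) : ENNReal :=
  sInf (ENNReal.ofReal '' HorizontalLengths U X x y)


open PowerSeries in
theorem ps_comm {R : Type*} [Ring R] (r s : ℕ) (S S' T T' G H : PowerSeries R)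
    (hS : S * S' = 1) (hT : T * T' = 1)
    (hG : S = 1 + PowerSeries.X ^ (r + 1) * G) (hH : T = 1 + PowerSeries.X ^ (s + 1) * H) :
    ∃ F, S * T * S' * T' = 1 + PowerSeries.X ^ (r + 1 + s + 1) * F ∧
      constantCoeff F = constantCoeff G * constantCoeff H
        - constantCoeff H * constantCoeff G := by
  have cS : constantCoeff S = 1 := by rw [hG]; simp
  have cT : constantCoeff T = 1 := by rw [hH]; simp
  have cS' : constantCoeff S' = 1 := by
    have := congrArg constantCoeff hS
    simpa [cS] using this
  have cT' : constantCoeff T' = 1 := by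
    have := congrArg constantCoeff hT
    simpa [cT] using this
  refine ⟨(G * H - H * G) * S' * T', ?_, ?_⟩
  · have h1 : S * T * S' * T' = 1 + (S * T - T * S) * S' * T' := by
      have : T * S * S' * T' = 1 := by rw [mul_assoc T, hS, mul_one, hT]
      rw [sub_mul, sub_mul, this]; abel
    have h2 : S * T - T * S = PowerSeries.X ^ (r + 1 + s + 1) * (G * H - H * G) := by
      have e1 : PowerSeries.X ^ (r + 1) * G * (PowerSeries.X ^ (s + 1) * H)
          = PowerSeries.X ^ (r + 1 + s + 1) * (G * H) := by
        rw [mul_assoc, ← mul_assoc G, ← (PowerSeries.X_pow_mul (φ := G) (n := s + 1)),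
          mul_assoc, ← mul_assoc (PowerSeries.X ^ (r + 1)), ← pow_add, ← add_assoc]
      have e2 : PowerSeries.X ^ (s + 1) * H * (PowerSeries.X ^ (r + 1) * G)
          = PowerSeries.X ^ (r + 1 + s + 1) * (H * G) := by
        rw [mul_assoc, ← mul_assoc H, ← (PowerSeries.X_pow_mul (φ := H) (n := r + 1)),
          mul_assoc, ← mul_assoc (PowerSeries.X ^ (s + 1)), ← pow_add]
        congr 2; ring
      rw [mul_sub, ← e1, ← e2, hG, hH]
      noncomm_ring
    rw [h1, h2]; simp only [mul_assoc]
  · simp [cS', cT']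

/-- The formal exponential series. -/
def expS {R : Type*} [Ring R] [Algebra ℝ R] (D : R) : PowerSeries R :=
  PowerSeries.mk fun j => ((j.factorial : ℝ)⁻¹) • D ^ j

theorem expS_mul_neg {R : Type*} [Ring R] [Algebra ℝ R] (D : R) :
    expS D * expS (-D) = 1 := by
  ext m
  rw [PowerSeries.coeff_mul, PowerSeries.coeff_one]
  have h := (Commute.neg_right (Commute.refl D)).add_pow' m
  rw [add_neg_cancel] at h
  have : (∑ p ∈ Finset.HasAntidiagonal.antidiagonal m, PowerSeries.coeff p.1 (expS D) *
      PowerSeries.coeff p.2 (expS (-D))) = ((m.factorial : ℝ)⁻¹) • (0 : R) ^ m := by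
    rw [h, Finset.smul_sum]
    refine Finset.sum_congr rfl fun p hp => ?_
    have hp' := Finset.HasAntidiagonal.mem_antidiagonal.1 hp
    subst hp'
    simp only [expS, PowerSeries.coeff_mk, smul_mul_smul_comm]
    rw [← Nat.cast_smul_eq_nsmul ℝ, smul_smul]
    congr 1
    have := Nat.choose_mul_factorial_mul_factorial (Nat.le_add_right p.1 p.2)
    rw [Nat.add_sub_cancel_left] at this
    have h3 : ((p.1 + p.2).choose p.1 : ℝ) * p.1.factorial * p.2.factorial
      = (p.1 + p.2).factorial := by exact_mod_cast this
    rw [← h3]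
    have := Nat.factorial_ne_zero p.1
    have := Nat.factorial_ne_zero p.2
    have : ((p.1 + p.2).choose p.1 : ℝ) ≠ 0 := by
      have := Nat.choose_pos (Nat.le_add_right p.1 p.2)
      positivity
    field_simp
  rw [this]
  split_ifs with h0
  · simp [h0]
  · simp [h0]

theorem expS_shift {R : Type*} [Ring R] [Algebra ℝ R] (D : R) :
    ∃ G, expS D = 1 + PowerSeries.X ^ (0 + 1) * G ∧ PowerSeries.constantCoeff G = D := by
  refine ⟨PowerSeries.mk fun p => PowerSeries.coeff (p + 1) (expS D), ?_, ?_⟩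
  · have := PowerSeries.eq_X_mul_shift_add_const (expS D)
    rw [zero_add, pow_one, add_comm]
    convert this using 2
    simp [expS]
  · rw [← PowerSeries.coeff_zero_eq_constantCoeff_apply]
    simp [expS]

/-- Smooth maps. -/
def SmA (n : ℕ) : Submodule ℝ ((Fin n → ℝ) → (Fin n → ℝ)) where
  carrier := {f | ContDiff ℝ (⊤ : ℕ∞) f}
  add_mem' := by
    intro f g hf hg
    exact ContDiff.add (Set.mem_ofPred.1 hf) (Set.mem_ofPred.1 hg)
  zero_mem' := Set.mem_ofPred.2 contDiff_const
  smul_mem' := by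
    intro c f hf
    exact Set.mem_ofPred.2 (ContDiff.const_smul c (Set.mem_ofPred.1 hf))

theorem SmA_mem {n : ℕ} {f : (Fin n → ℝ) → (Fin n → ℝ)} :
    f ∈ SmA n ↔ ContDiff ℝ (⊤ : ℕ∞) f := Iff.rfl

/-- The type of smooth maps. -/
def SmT (n : ℕ) : Type := SmA n

instance instSmTGroup (n : ℕ) : AddCommGroup (SmT n) := inferInstanceAs (AddCommGroup (SmA n))

instance instSmTModule (n : ℕ) : Module ℝ (SmT n) := inferInstanceAs (Module ℝ (SmA n))

theorem SmT_ext {n : ℕ} {f g : SmT n} (h : ∀ x, f.1 x = g.1 x) : f = g :=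
  Subtype.ext (funext h)

theorem SmT_add {n : ℕ} (f g : SmT n) (x : Fin n → ℝ) : (f + g).1 x = f.1 x + g.1 x := rfl

theorem SmT_sub {n : ℕ} (f g : SmT n) (x : Fin n → ℝ) : (f - g).1 x = f.1 x - g.1 x := rfl

theorem SmT_neg {n : ℕ} (f : SmT n) (x : Fin n → ℝ) : (-f).1 x = -f.1 x := rfl

theorem SmT_zero {n : ℕ} (x : Fin n → ℝ) : (0 : SmT n).1 x = 0 := rfl

theorem SmT_smul {n : ℕ} (c : ℝ) (f : SmT n) (x : Fin n → ℝ) : (c • f).1 x = c • f.1 x := rfl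

/-- Evaluation. -/
def SmT_ev {n : ℕ} (x : Fin n → ℝ) : SmT n →+ (Fin n → ℝ) where
  toFun f := f.1 x
  map_zero' := rfl
  map_add' _ _ := rfl

theorem SmT_sum {n : ℕ} {ι : Type*} (s : Finset ι) (f : ι → SmT n) (x : Fin n → ℝ) :
    (∑ i ∈ s, f i).1 x = ∑ i ∈ s, (f i).1 x := map_sum (SmT_ev x) f s

theorem SmA_smooth {n : ℕ} (f : SmT n) : ContDiff ℝ (⊤ : ℕ∞) f.1 := SmA_mem.1 f.2

theorem SmA_diff {n : ℕ} (f : SmT n) : Differentiable ℝ f.1 :=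
  (SmA_smooth f).differentiable (by simp)

theorem smooth_deriv {n : ℕ} {f X : (Fin n → ℝ) → (Fin n → ℝ)}
    (hf : ContDiff ℝ (⊤ : ℕ∞) f) (hX : ContDiff ℝ (⊤ : ℕ∞) X) :
    ContDiff ℝ (⊤ : ℕ∞) (fun x => fderiv ℝ f x (X x)) :=
  (hf.fderiv_right (m := ((⊤ : ℕ∞) : WithTop ℕ∞)) (by simp)).clm_apply hX

/-- Derivation along a vector field. -/
def Dop {n : ℕ} (X : SmT n) : Module.End ℝ (SmT n) where
  toFun f := ⟨fun x => fderiv ℝ f.1 x (X.1 x), SmA_mem.2 (smooth_deriv (SmA_smooth f) (SmA_smooth X))⟩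
  map_add' f g := by
    refine SmT_ext fun x => ?_
    have := fderiv_add (SmA_diff f x) (SmA_diff g x)
    exact congrArg (fun L => L (X.1 x)) this
  map_smul' c f := by
    refine SmT_ext fun x => ?_
    have := fderiv_const_smul (SmA_diff f x) c
    exact congrArg (fun L => L (X.1 x)) this

theorem Dop_neg {n : ℕ} (X : SmT n) : Dop (-X) = - Dop X := by
  refine LinearMap.ext fun f => SmT_ext fun x => ?_
  exact map_neg (fderiv ℝ f.1 x) (X.1 x)

/-- Identity map. -/
def idA (n : ℕ) : SmT n := ⟨fun x => x, SmA_mem.2 contDiff_id⟩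

theorem Dop_id {n : ℕ} (X : SmT n) (x) : (Dop X (idA n)).1 x = X.1 x := by
  change fderiv ℝ (fun x => x) x (X.1 x) = X.1 x
  simp

theorem Dop_bracket {n : ℕ} (X Y : SmT n) :
    ∃ h : ContDiff ℝ (⊤ : ℕ∞) (lieB X.1 Y.1), Dop ⟨lieB X.1 Y.1, SmA_mem.2 h⟩ =
      Dop X * Dop Y - Dop Y * Dop X := by
  refine ⟨(smooth_deriv (SmA_smooth Y) (SmA_smooth X)).sub
    (smooth_deriv (SmA_smooth X) (SmA_smooth Y)), ?_⟩
  refine LinearMap.ext fun f => SmT_ext fun x => ?_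
  have := VectorField.fderiv_apply_lieBracket (𝕜 := ℝ) (f := f.1) (x := x) (V := X.1) (W := Y.1)
    (n := ((⊤ : ℕ∞) : WithTop ℕ∞)) (SmA_smooth f).contDiffAt
    (by rw [minSmoothness_of_isRCLikeNormedField]; exact WithTop.coe_le_coe.2 le_top) (SmA_diff Y x) (SmA_diff X x)
  exact this

/-- Controlled path of total time `l` with controls bounded by one. -/
def CPath {n k : ℕ} (X : Fin k → (Fin n → ℝ) → (Fin n → ℝ)) (x y : Fin n → ℝ) (l : ℝ) : Prop :=
  0 ≤ l ∧ ∀ a : ℝ, ∃ (γ : ℝ → Fin n → ℝ) (u : Fin k → ℝ → ℝ), γ a = x ∧ γ (a + l) = y ∧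
    (∀ i, AEStronglyMeasurable (u i) (volume.restrict (Set.Icc a (a + l)))) ∧
    (∀ i s, |u i s| ≤ 1) ∧ ContinuousOn γ (Set.Icc a (a + l)) ∧
    ∀ t ∈ Set.Icc a (a + l), γ t = x + ∫ s in a..t, ∑ i, u i s • X i (γ s)

/-- `S` is the asymptotic expansion of a family of endpoint maps of controlled paths. -/
def HasExp {n k : ℕ} (X : Fin k → (Fin n → ℝ) → (Fin n → ℝ))
    (S : PowerSeries (Module.End ℝ (SmT n))) : Prop :=
  ∃ (P : ℝ → (Fin n → ℝ) → (Fin n → ℝ)) (K : ℝ),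
    (∀ τ ∈ Set.Icc (0 : ℝ) 1, ∀ x, ∃ l ≤ K * τ, CPath X x (P τ x) l) ∧
    ∀ (f : SmT n) (m : ℕ), ∃ C : ℝ, ∀ τ ∈ Set.Icc (0 : ℝ) 1, ∀ x,
      ‖f.1 (P τ x) - ∑ j ∈ Finset.range (m + 1), τ ^ j • (PowerSeries.coeff j S f).1 x‖
        ≤ C * τ ^ (m + 1)

theorem exists_flow {n : ℕ} (V : SmT n) (hc : HasCompactSupport V.1) :
    ∃ α : (Fin n → ℝ) → ℝ → (Fin n → ℝ), ∀ x, α x 0 = x ∧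
      ∀ t ∈ Set.Icc (0 : ℝ) 1, HasDerivWithinAt (α x) (V.1 (α x t)) (Set.Icc 0 1) t := by
  obtain ⟨K, hK⟩ := ContDiff.lipschitzWith_of_hasCompactSupport hc (SmA_smooth V) (by simp)
  obtain ⟨C, hC⟩ := hc.exists_bound_of_continuous (SmA_smooth V).continuous
  have : ∀ x, ∃ β : ℝ → (Fin n → ℝ), β 0 = x ∧
      ∀ t ∈ Set.Icc (0 : ℝ) 1, HasDerivWithinAt β (V.1 (β t)) (Set.Icc 0 1) t := by
    intro x
    have hp : IsPicardLindelof (fun _ : ℝ => V.1) (tmin := 0) (tmax := 1) ⟨0, by simp⟩ x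
        C.toNNReal 0 C.toNNReal K :=
      { lipschitzOnWith := fun _ _ => hK.lipschitzOnWith
        continuousOn := fun _ _ => continuousOn_const
        norm_le := fun _ _ y _ => (hC y).trans (Real.le_coe_toNNReal C)
        mul_max_le := by simp }
    exact hp.exists_eq_forall_mem_Icc_hasDerivWithinAt₀
  choose α hα using this
  exact ⟨α, hα⟩

theorem Dop_bounded {n : ℕ} (V f : SmT n) (hc : HasCompactSupport V.1) :
    ∃ C, ∀ x, ‖(Dop V f).1 x‖ ≤ C := by
  refine HasCompactSupport.exists_bound_of_continuous ?_ (SmA_smooth (Dop V f)).continuous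
  refine hc.mono ?_
  intro x hx hx0
  apply hx
  change fderiv ℝ f.1 x (V.1 x) = 0
  rw [hx0, map_zero]

theorem coeff_expS_apply {n : ℕ} (D : Module.End ℝ (SmT n)) (j : ℕ) (f : SmT n)
    (x : Fin n → ℝ) : (PowerSeries.coeff j (expS D) f).1 x
      = ((j.factorial : ℝ)⁻¹) • ((D ^ j) f).1 x := by
  simp [expS, SmT_smul]

theorem letter_exp {n : ℕ} (V : SmT n) (hc : HasCompactSupport V.1)
    (α : (Fin n → ℝ) → ℝ → (Fin n → ℝ))
    (hα : ∀ x, α x 0 = x ∧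
      ∀ t ∈ Set.Icc (0 : ℝ) 1, HasDerivWithinAt (α x) (V.1 (α x t)) (Set.Icc 0 1) t)
    (m : ℕ) : ∀ (f : SmT n), ∃ C : ℝ, ∀ τ ∈ Set.Icc (0 : ℝ) 1, ∀ x,
      ‖f.1 (α x τ) - ∑ j ∈ Finset.range (m + 1),
        τ ^ j • (PowerSeries.coeff j (expS (Dop V)) f).1 x‖ ≤ C * τ ^ (m + 1) := by
  have hder : ∀ (f : SmT n) x, ∀ t ∈ Set.Icc (0 : ℝ) 1,
      HasDerivWithinAt (fun s => f.1 (α x s)) ((Dop V f).1 (α x t)) (Set.Icc 0 1) t := by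
    intro f x t ht
    exact ((SmA_diff f (α x t)).hasFDerivAt).comp_hasDerivWithinAt t ((hα x).2 t ht)
  induction m with
  | zero =>
    intro f
    obtain ⟨C, hC⟩ := Dop_bounded V f hc
    refine ⟨C, fun τ hτ x => ?_⟩
    have := norm_image_sub_le_of_norm_deriv_le_segment' (hder f x) (fun s _ => hC _) τ hτ
    simpa [coeff_expS_apply, (hα x).1] using this
  | succ m ih =>
    intro f
    obtain ⟨C, hC⟩ := ih (Dop V f)
    refine ⟨C, fun τ hτ x => ?_⟩
    have hC0 : ∀ s ∈ Set.Icc (0:ℝ) 1, 0 ≤ C * s ^ (m + 1) := fun s hs =>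
      (norm_nonneg _).trans (hC s hs x)
    have hC1 : 0 ≤ C := by simpa using hC0 1 (by simp)
    let h : ℝ → (Fin n → ℝ) := fun s => f.1 (α x s) - ∑ j ∈ Finset.range (m + 1 + 1),
        s ^ j • (PowerSeries.coeff j (expS (Dop V)) f).1 x
    have h0 : h 0 = 0 := by
      simp only [h]
      rw [Finset.sum_range_succ']
      rw [coeff_expS_apply]
      simp [(hα x).1]
    have hd : ∀ s ∈ Set.Icc (0:ℝ) 1, HasDerivWithinAt h ((Dop V f).1 (α x s) -
        ∑ j ∈ Finset.range (m + 1),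
          s ^ j • (PowerSeries.coeff j (expS (Dop V)) (Dop V f)).1 x) (Set.Icc 0 1) s := by
      intro s hs
      refine (hder f x s hs).sub ?_
      have e : (fun s : ℝ => ∑ j ∈ Finset.range (m + 1 + 1),
          s ^ j • (PowerSeries.coeff j (expS (Dop V)) f).1 x) = fun s : ℝ =>
          ∑ j ∈ Finset.range (m + 1), s ^ (j + 1) •
            (PowerSeries.coeff (j + 1) (expS (Dop V)) f).1 x
          + (PowerSeries.coeff 0 (expS (Dop V)) f).1 x := by
        funext s
        rw [Finset.sum_range_succ']; simp
      rw [e]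
      refine HasDerivWithinAt.add_const _ ?_
      refine HasDerivWithinAt.fun_sum fun j _ => ?_
      have := ((hasDerivAt_pow (j + 1) s).smul_const
        ((PowerSeries.coeff (j + 1) (expS (Dop V)) f).1 x)).hasDerivWithinAt (s := Set.Icc 0 1)
      convert this using 1
      rw [coeff_expS_apply, coeff_expS_apply, pow_succ (Dop V), Module.End.mul_apply,
        smul_smul, smul_smul]
      congr 1
      rw [Nat.factorial_succ]
      push_cast
      have := Nat.factorial_ne_zero j
      field_simp
    have := norm_image_sub_le_of_norm_deriv_le_segment' (a := 0) (b := τ) (f := h)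
      (C := C * τ ^ (m + 1))
      (fun s hs => (hd s ⟨hs.1, hs.2.trans hτ.2⟩).mono (Set.Icc_subset_Icc_right hτ.2))
      (fun s hs => (hC s ⟨hs.1, hs.2.le.trans hτ.2⟩ x).trans (by
        have := hs.1
        have := hs.2.le
        gcongr)) τ ⟨hτ.1, le_rfl⟩
    rw [h0, sub_zero, sub_zero, mul_assoc, ← pow_succ] at this
    exact this

theorem letter_path {n k : ℕ} (X : Fin k → (Fin n → ℝ) → (Fin n → ℝ)) (i : Fin k) (c : ℝ)
    (hcc : |c| ≤ 1) (V : SmT n) (hV : ∀ x, V.1 x = c • X i x) (x : Fin n → ℝ) (β : ℝ → Fin n → ℝ)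
    (h0 : β 0 = x)
    (hβ : ∀ t ∈ Set.Icc (0 : ℝ) 1, HasDerivWithinAt β (V.1 (β t)) (Set.Icc 0 1) t)
    (τ : ℝ) (hτ : τ ∈ Set.Icc (0 : ℝ) 1) : CPath X x (β τ) τ := by
  refine ⟨hτ.1, fun a => ⟨fun s => β (s - a), fun j _ => if j = i then c else 0, by simp [h0],
    by simp, fun _ => aestronglyMeasurable_const, fun j s => ?_, ?_, ?_⟩⟩
  · dsimp only
    split_ifs
    · exact hcc
    · simp
  · have hb : ContinuousOn β (Set.Icc 0 1) := fun t ht => (hβ t ht).continuousWithinAt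
    refine hb.comp (by fun_prop) fun s hs => ⟨by linarith [hs.1], by linarith [hs.2, hτ.2]⟩
  · intro t ht
    have hb : ContinuousOn β (Set.Icc 0 1) := fun t ht => (hβ t ht).continuousWithinAt
    have ht1 : t - a ≤ 1 := by linarith [ht.2, hτ.2]
    have e : ∀ s : ℝ, (∑ j, (if j = i then c else 0) • X j (β (s - a))) = V.1 (β (s - a)) := by
      intro s
      rw [hV]; simp [ite_smul]
    simp_rw [e]
    rw [intervalIntegral.integral_comp_sub_right (fun s => V.1 (β s)) a, sub_self,
      intervalIntegral.integral_eq_sub_of_hasDeriv_right_of_le (by linarith [ht.1])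
        (hb.mono (Set.Icc_subset_Icc_right ht1)) (f := β)]
    · rw [h0]; abel
    · intro s hs
      exact (hβ s ⟨hs.1.le, hs.2.le.trans ht1⟩).mono_of_mem_nhdsWithin
        (mem_nhdsWithin_of_mem_nhds (Icc_mem_nhds hs.1 (hs.2.trans_le ht1)))
    · refine ContinuousOn.intervalIntegrable ?_
      rw [Set.uIcc_of_le (by linarith [ht.1])]
      exact (SmA_smooth V).continuous.comp_continuousOn (hb.mono (Set.Icc_subset_Icc_right ht1))

theorem letter_hasExp {n k : ℕ} (X : Fin k → (Fin n → ℝ) → (Fin n → ℝ)) (i : Fin k) (c : ℝ)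
    (hcc : |c| ≤ 1) (V : SmT n) (hV : ∀ x, V.1 x = c • X i x) (hc : HasCompactSupport V.1) :
    HasExp X (expS (Dop V)) := by
  obtain ⟨α, hα⟩ := exists_flow V hc
  exact ⟨fun τ x => α x τ, 1, fun τ hτ x => ⟨τ, by simp,
    letter_path X i c hcc V hV x (α x) (hα x).1 (hα x).2 τ hτ⟩,
    fun f m => letter_exp V hc α hα m f⟩

theorem CPath.glue {n k : ℕ} (X : Fin k → (Fin n → ℝ) → (Fin n → ℝ))
    (hX : ∀ i, Continuous (X i)) (M : ℝ) (hM : ∀ i x, ‖X i x‖ ≤ M)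
    (x : ℕ → Fin n → ℝ) (l : ℕ → ℝ) (hp : ∀ j, CPath X (x j) (x (j + 1)) (l j))
    (L : ℝ) (hL : HasSum l L) (y : Fin n → ℝ) (hy : Filter.Tendsto x Filter.atTop (nhds y)) :
    CPath X (x 0) y L := by
  refine ⟨hL.nonneg fun j => (hp j).1, fun a => ?_⟩
  let t : ℕ → ℝ := fun j => a + ∑ i ∈ Finset.range j, l i
  have t0 : t 0 = a := by simp [t]
  have ts : ∀ j, t (j + 1) = t j + l j := fun j => by simp [t, Finset.sum_range_succ, add_assoc]
  have tmono : Monotone t := monotone_nat_of_le_succ fun j => by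
    rw [ts]; linarith [(hp j).1]
  have tlim : Filter.Tendsto t Filter.atTop (nhds (a + L)) := hL.tendsto_sum_nat.const_add a
  have tle : ∀ j, t j ≤ a + L := fun j => tmono.ge_of_tendsto tlim j
  have ale : ∀ j, a ≤ t j := fun j => t0 ▸ tmono (Nat.zero_le j)
  have hp' := fun j => (hp j).2 (t j)
  simp_rw [← ts] at hp'
  choose γ u h1 h2 h3 h4 h5 h6 using hp'
  let J : ℝ → ℕ := fun s => sInf {j | s < t (j + 1)}
  have hJ : ∀ j, ∀ s ∈ Set.Ico (t j) (t (j + 1)), J s = j := by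
    intro j s hs
    have hmem : j ∈ {j | s < t (j + 1)} := hs.2
    refine le_antisymm (Nat.sInf_le hmem) ?_
    by_contra hlt
    push Not at hlt
    have h7 : s < t (J s + 1) := Nat.sInf_mem ⟨j, hmem⟩
    have := tmono (Nat.succ_le_of_lt hlt)
    exact absurd hs.1 (not_le.2 (h7.trans_le this))
  have hcov : ∀ s ∈ Set.Ico a (a + L), ∃ j, s ∈ Set.Ico (t j) (t (j + 1)) := by
    intro s hs
    have hne : {j | s < t (j + 1)}.Nonempty := by
      obtain ⟨j, hj⟩ := (tlim.eventually (lt_mem_nhds hs.2)).exists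
      exact ⟨j, hj.trans_le (tmono (Nat.le_succ j))⟩
    refine ⟨J s, ?_, Nat.sInf_mem hne⟩
    rcases Nat.eq_zero_or_pos (J s) with h | h
    · rw [h, t0]; exact hs.1
    · have := Nat.notMem_of_lt_sInf (s := {j | s < t (j + 1)}) (m := J s - 1)
        (Nat.sub_lt h one_pos)
      have h8 : ¬ s < t (J s - 1 + 1) := this
      rw [Nat.sub_add_cancel h] at h8
      exact not_lt.1 h8
  let v : Fin k → ℝ → ℝ := fun i s => u (J s) i s
  let w : ℝ → Fin n → ℝ := fun s => ∑ i, v i s • X i (γ (J s) s)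
  have hunion : Set.Ico a (a + L) = ⋃ j, Set.Ico (t j) (t (j + 1)) := by
    ext s
    simp only [Set.mem_iUnion]
    refine ⟨hcov s, fun ⟨j, hj⟩ => ⟨(ale j).trans hj.1, hj.2.trans_le (tle _)⟩⟩
  have hv : ∀ i, AEStronglyMeasurable (v i) (volume.restrict (Set.Icc a (a + L))) := by
    intro i
    rw [restrict_Ico_eq_restrict_Icc.symm, hunion, aestronglyMeasurable_iUnion_iff]
    intro j
    refine ((h3 j i).mono_set Set.Ico_subset_Icc_self).congr ?_
    filter_upwards [ae_restrict_mem measurableSet_Ico] with s hs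
    simp only [v, hJ j s hs]
  have hw : AEStronglyMeasurable w (volume.restrict (Set.Icc a (a + L))) := by
    rw [restrict_Ico_eq_restrict_Icc.symm, hunion, aestronglyMeasurable_iUnion_iff]
    intro j
    have : AEStronglyMeasurable (fun s => ∑ i, u j i s • X i (γ j s))
        (volume.restrict (Set.Ico (t j) (t (j + 1)))) := by
      refine Finset.aestronglyMeasurable_fun_sum _ fun i _ => ?_
      refine ((h3 j i).mono_set Set.Ico_subset_Icc_self).smul ?_
      exact (((hX i).comp_continuousOn (h5 j)).mono
        Set.Ico_subset_Icc_self).aestronglyMeasurable measurableSet_Ico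
    refine this.congr ?_
    filter_upwards [ae_restrict_mem measurableSet_Ico] with s hs
    simp only [w, v, hJ j s hs]
  have hwb : ∀ s, ‖w s‖ ≤ k * M := by
    intro s
    refine (norm_sum_le _ _).trans ?_
    refine (Finset.sum_le_card_nsmul _ _ M fun i _ => ?_).trans (by simp)
    rw [norm_smul, Real.norm_eq_abs]
    have := hM i (γ (J s) s)
    have := h4 (J s) i s
    nlinarith [norm_nonneg (X i (γ (J s) s)), abs_nonneg (v i s)]
  have hwi : IntegrableOn w (Set.Icc a (a + L)) :=
    Integrable.of_bound hw (k * M) (Filter.Eventually.of_forall hwb)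
  have hii : ∀ p q, p ∈ Set.Icc a (a + L) → q ∈ Set.Icc a (a + L) →
      IntervalIntegrable w volume p q := by
    intro p q hp hq
    refine (hwi.mono_set ?_).intervalIntegrable
    exact Set.ordConnected_Icc.uIcc_subset hp hq
  have haL : a ≤ a + L := t0 ▸ tle 0
  let Γ : ℝ → Fin n → ℝ := fun s => x 0 + ∫ r in a..s, w r
  have tmem : ∀ j, t j ∈ Set.Icc a (a + L) := fun j => ⟨ale j, tle j⟩
  have hΓstep : ∀ j, Γ (t j) = x j → ∀ s ∈ Set.Icc (t j) (t (j + 1)), Γ s = γ j s := by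
    intro j hj s hs
    have hsm : s ∈ Set.Icc a (a + L) := ⟨(ale j).trans hs.1, hs.2.trans (tle _)⟩
    have e1 : Γ s = Γ (t j) + ∫ r in (t j)..s, w r := by
      simp only [Γ]
      rw [add_assoc, intervalIntegral.integral_add_adjacent_intervals
        (hii _ _ ⟨le_rfl, haL⟩ (tmem j)) (hii _ _ (tmem j) hsm)]
    rw [e1, hj, h6 j s hs]
    congr 1
    rw [intervalIntegral.integral_of_le hs.1, intervalIntegral.integral_of_le hs.1,
      integral_Ioc_eq_integral_Ioo, integral_Ioc_eq_integral_Ioo]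
    refine setIntegral_congr_fun measurableSet_Ioo fun r hr => ?_
    have := hJ j r ⟨hr.1.le, hr.2.trans_le hs.2⟩
    simp only [w, v, this]
  have hΓt : ∀ j, Γ (t j) = x j := by
    intro j
    induction j with
    | zero => simp [Γ, t0]
    | succ j ih =>
      rw [hΓstep j ih _ ⟨tmono (Nat.le_succ j), le_rfl⟩, h2]
  have hcont : ContinuousOn Γ (Set.Icc a (a + L)) := by
    have := intervalIntegral.continuousOn_primitive_interval (μ := volume) (f := w)
      (a := a) (b := a + L) (by rwa [Set.uIcc_of_le haL])
    rw [Set.uIcc_of_le haL] at this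
    exact continuousOn_const.add this
  refine ⟨Γ, v, by simp [Γ], ?_, hv, fun i s => h4 _ i s, hcont, ?_⟩
  · have hl : Filter.Tendsto (fun j => Γ (t j)) Filter.atTop (nhds (Γ (a + L))) := by
      have := hcont (a + L) ⟨haL, le_rfl⟩
      exact this.tendsto.comp (tendsto_nhdsWithin_iff.2 ⟨tlim, Filter.Eventually.of_forall tmem⟩)
    simp_rw [hΓt] at hl
    exact tendsto_nhds_unique hl hy
  · intro s hs
    change x 0 + ∫ r in a..s, w r = _
    congr 1
    rw [intervalIntegral.integral_of_le hs.1, intervalIntegral.integral_of_le hs.1,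
      integral_Ioc_eq_integral_Ioo, integral_Ioc_eq_integral_Ioo]
    refine setIntegral_congr_fun measurableSet_Ioo fun r hr => ?_
    obtain ⟨j, hj⟩ := hcov r ⟨hr.1.le, hr.2.trans_le hs.2⟩
    have e := hJ j r hj
    have e2 := hΓstep j (hΓt j) r ⟨hj.1, hj.2.le⟩
    simp only [w]
    rw [e2, e]

theorem CPath.refl {n k : ℕ} (X : Fin k → (Fin n → ℝ) → (Fin n → ℝ)) (x : Fin n → ℝ) :
    CPath X x x 0 :=
  ⟨le_rfl, fun _ => ⟨fun _ => x, fun _ _ => 0, rfl, rfl, fun _ => aestronglyMeasurable_const,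
    by simp, continuousOn_const, by simp⟩⟩

theorem CPath.trans {n k : ℕ} (X : Fin k → (Fin n → ℝ) → (Fin n → ℝ))
    (hX : ∀ i, Continuous (X i)) (M : ℝ) (hM : ∀ i x, ‖X i x‖ ≤ M)
    {x y z : Fin n → ℝ} {l m : ℝ} (h : CPath X x y l) (h' : CPath X y z m) :
    CPath X x z (l + m) := by
  let p : ℕ → Fin n → ℝ := fun j => if j = 0 then x else if j = 1 then y else z
  let q : ℕ → ℝ := fun j => if j = 0 then l else if j = 1 then m else 0
  refine CPath.glue X hX M hM p q ?_ (l + m) ?_ z ?_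
  · intro j
    match j with
    | 0 => simpa [p, q] using h
    | 1 => simpa [p, q] using h'
    | j + 2 => simpa [p, q] using CPath.refl X z
  · have := hasSum_sum_of_ne_finset_zero (L := SummationFilter.unconditional ℕ) (f := q) (s := Finset.range 2) (by
      intro j hj
      have : 1 < j := by simpa using hj
      simp only [q]
      rw [if_neg (by omega), if_neg (by omega)])
    simpa [Finset.sum_range_succ, q] using this
  · refine tendsto_const_nhds.congr' ?_
    filter_upwards [Filter.eventually_ge_atTop 2] with j hj
    simp only [p]
    rw [if_neg (by omega), if_neg (by omega)]

theorem HasExp.mul {n k : ℕ} (X : Fin k → (Fin n → ℝ) → (Fin n → ℝ))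
    (hX : ∀ i, Continuous (X i)) (M : ℝ) (hM : ∀ i x, ‖X i x‖ ≤ M)
    {S T : PowerSeries (Module.End ℝ (SmT n))} (hS : HasExp X S) (hT : HasExp X T) :
    HasExp X (S * T) := by
  obtain ⟨P, K, hP, hPe⟩ := hS
  obtain ⟨Q, K', hQ, hQe⟩ := hT
  refine ⟨fun τ x => Q τ (P τ x), K + K', ?_, ?_⟩
  · intro τ hτ x
    obtain ⟨l, hl, h⟩ := hP τ hτ x
    obtain ⟨l', hl', h'⟩ := hQ τ hτ (P τ x)
    exact ⟨l + l', by linarith, h.trans X hX M hM h'⟩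
  · intro f m
    obtain ⟨C, hC⟩ := hQe f m
    choose D hD using fun j => hPe (PowerSeries.coeff j T f) (m - j)
    refine ⟨C + ∑ j ∈ Finset.range (m + 1), D j, fun τ hτ x => ?_⟩
    have key : ∑ l ∈ Finset.range (m + 1), τ ^ l • (PowerSeries.coeff l (S * T) f).1 x
        = ∑ j ∈ Finset.range (m + 1), τ ^ j • ∑ i ∈ Finset.range (m - j + 1),
          τ ^ i • (PowerSeries.coeff i S (PowerSeries.coeff j T f)).1 x := by
      have e1 : ∀ l, τ ^ l • (PowerSeries.coeff l (S * T) f).1 x =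
          ∑ p ∈ Finset.HasAntidiagonal.antidiagonal l,
            τ ^ (p.2 + p.1) • (PowerSeries.coeff p.1 S (PowerSeries.coeff p.2 T f)).1 x := by
        intro l
        rw [PowerSeries.coeff_mul]
        simp only [LinearMap.sum_apply, SmT_sum, Finset.smul_sum]
        refine Finset.sum_congr rfl fun p hp => ?_
        rw [← Finset.HasAntidiagonal.mem_antidiagonal.1 hp, add_comm p.1 p.2]
        rfl
      simp_rw [e1, Finset.smul_sum, smul_smul, ← pow_add]
      rw [Finset.sum_sigma', Finset.sum_sigma']
      refine Finset.sum_bij' (fun q _ => ⟨q.2.2, q.2.1⟩) (fun q _ => ⟨q.1 + q.2, (q.2, q.1)⟩)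
        ?_ ?_ ?_ ?_ ?_
      · rintro ⟨l, i, j⟩ h
        simp only [Finset.mem_sigma, Finset.mem_range,
          Finset.HasAntidiagonal.mem_antidiagonal] at h ⊢
        omega
      · rintro ⟨j, i⟩ h
        simp only [Finset.mem_sigma, Finset.mem_range,
          Finset.HasAntidiagonal.mem_antidiagonal] at h ⊢
        omega
      · rintro ⟨l, i, j⟩ h
        simp only [Finset.mem_sigma, Finset.mem_range,
          Finset.HasAntidiagonal.mem_antidiagonal] at h ⊢
        obtain ⟨_, h⟩ := h
        subst h
        rw [add_comm]
      · rintro ⟨j, i⟩ h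
        rfl
      · rintro ⟨l, i, j⟩ h
        rfl
    rw [key]
    have e2 : f.1 (Q τ (P τ x)) - ∑ j ∈ Finset.range (m + 1),
          τ ^ j • ∑ i ∈ Finset.range (m - j + 1),
          τ ^ i • (PowerSeries.coeff i S (PowerSeries.coeff j T f)).1 x
        = (f.1 (Q τ (P τ x)) - ∑ j ∈ Finset.range (m + 1),
            τ ^ j • (PowerSeries.coeff j T f).1 (P τ x))
          + ∑ j ∈ Finset.range (m + 1), τ ^ j • ((PowerSeries.coeff j T f).1 (P τ x) -
            ∑ i ∈ Finset.range (m - j + 1),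
              τ ^ i • (PowerSeries.coeff i S (PowerSeries.coeff j T f)).1 x) := by
      simp_rw [smul_sub, Finset.sum_sub_distrib]
      abel
    rw [e2, add_mul, Finset.sum_mul]
    refine (norm_add_le _ _).trans (add_le_add (hC τ hτ _) ?_)
    refine (norm_sum_le _ _).trans (Finset.sum_le_sum fun j hj => ?_)
    rw [norm_smul, Real.norm_eq_abs, abs_of_nonneg (pow_nonneg hτ.1 _)]
    have hj' : j ≤ m := by simpa [Nat.lt_succ_iff] using hj
    have e3 : D j * τ ^ (m + 1) = τ ^ j * (D j * τ ^ (m - j + 1)) := by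
      have : m + 1 = j + (m - j + 1) := by omega
      rw [this, pow_add]
      have : j + (m - j + 1) - j = m - j + 1 := by omega
      ring
    rw [e3]
    exact mul_le_mul_of_nonneg_left (hD j τ hτ x) (pow_nonneg hτ.1 _)


theorem hull_exp {n k : ℕ} (X : Fin k → (Fin n → ℝ) → (Fin n → ℝ))
    (hX : ∀ i, ContDiff ℝ (⊤ : ℕ∞) (X i)) (hc : ∀ i, HasCompactSupport (X i))
    (M : ℝ) (hM : ∀ i x, ‖X i x‖ ≤ M)
    (Z : (Fin n → ℝ) → (Fin n → ℝ)) (hZ : LieHull (Set.range X) Z) :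
    ∃ (V : SmT n) (r : ℕ) (S S' G : PowerSeries (Module.End ℝ (SmT n))),
      V.1 = Z ∧ HasExp X S ∧ HasExp X S' ∧ S * S' = 1 ∧ S' * S = 1 ∧
      S = 1 + PowerSeries.X ^ (r + 1) * G ∧ PowerSeries.constantCoeff G = Dop V := by
  have hXc := fun i => (hX i).continuous
  induction hZ with
  | base h =>
    obtain ⟨i, rfl⟩ := h
    let V : SmT n := ⟨X i, SmA_mem.2 (hX i)⟩
    obtain ⟨G, hG1, hG2⟩ := expS_shift (Dop V)
    refine ⟨V, 0, expS (Dop V), expS (Dop (-V)), G, rfl, ?_, ?_, ?_, ?_, hG1, hG2⟩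
    · exact letter_hasExp X i 1 (by simp) V (by simp [V]) (hc i)
    · refine letter_hasExp X i (-1) (by simp) (-V) (fun x => by rw [SmT_neg]; simp [V]) ?_
      exact (hc i).mono (by intro x hx h0; exact hx (by change -(X i x) = 0; rw [h0, neg_zero]))
    · rw [Dop_neg, expS_mul_neg]
    · rw [Dop_neg]; simpa using expS_mul_neg (-Dop V)
  | @br Z W _ _ ih1 ih2 =>
    obtain ⟨V1, r, S, S', G, h1, h2, h3, h4, h5, h6, h7⟩ := ih1
    obtain ⟨V2, s, T, T', H, g1, g2, g3, g4, g5, g6, g7⟩ := ih2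
    obtain ⟨F, f1, f2⟩ := ps_comm r s S S' T T' G H h4 g4 h6 g6
    obtain ⟨hb, hb2⟩ := Dop_bracket V1 V2
    refine ⟨⟨lieB V1.1 V2.1, SmA_mem.2 hb⟩, r + 1 + s, S * T * S' * T', T * S * T' * S', F,
      by rw [← h1, ← g1], ?_, ?_, ?_, ?_, f1, ?_⟩
    · exact ((h2.mul X hXc M hM g2).mul X hXc M hM h3).mul X hXc M hM g3
    · exact ((g2.mul X hXc M hM h2).mul X hXc M hM g3).mul X hXc M hM h3
    · calc S * T * S' * T' * (T * S * T' * S') = S * T * S' * (T' * T) * S * T' * S' := by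
            simp only [mul_assoc]
        _ = S * T * (S' * S) * T' * S' := by rw [g5]; simp only [mul_assoc, one_mul, mul_one]
        _ = S * (T * T') * S' := by rw [h5]; simp only [mul_assoc, one_mul, mul_one]
        _ = 1 := by rw [g4, mul_one, h4]
    · calc T * S * T' * S' * (S * T * S' * T') = T * S * T' * (S' * S) * T * S' * T' := by
            simp only [mul_assoc]
        _ = T * S * (T' * T) * S' * T' := by rw [h5]; simp only [mul_assoc, one_mul, mul_one]
        _ = T * (S * S') * T' := by rw [g5]; simp only [mul_assoc, one_mul, mul_one]
        _ = 1 := by rw [h4, mul_one, g4]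
    · rw [f2, hb2, h7, g7]

theorem step_tau {n k : ℕ} (X : Fin k → (Fin n → ℝ) → (Fin n → ℝ)) (r : ℕ)
    (S G : PowerSeries (Module.End ℝ (SmT n))) (W : SmT n) (hS : HasExp X S)
    (hG : S = 1 + PowerSeries.X ^ (r + 1) * G) (hW : PowerSeries.constantCoeff G = Dop W) :
    ∃ A : ℝ, 0 ≤ A ∧ ∀ τ ∈ Set.Icc (0 : ℝ) 1, ∀ x, ∃ y l, CPath X x y l ∧ l ≤ A * τ ∧
      ‖y - x - τ ^ (r + 1) • W.1 x‖ ≤ A * τ ^ (r + 2) := by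
  obtain ⟨P, K, h1, h2⟩ := hS
  obtain ⟨C, hC⟩ := h2 (idA n) (r + 1)
  refine ⟨max (max K C) 0, le_max_right _ _, fun τ hτ x => ?_⟩
  obtain ⟨l, hl, hp⟩ := h1 τ hτ x
  have hτ0 : 0 ≤ τ := hτ.1
  refine ⟨P τ x, l, hp, hl.trans (by gcongr; exact (le_max_left _ _).trans (le_max_left _ _)), ?_⟩
  have h := hC τ hτ x
  have e : ∑ j ∈ Finset.range (r + 1 + 1), τ ^ j • (PowerSeries.coeff j S (idA n)).1 x
      = x + τ ^ (r + 1) • W.1 x := by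
    rw [Finset.sum_range_succ, Finset.sum_range_succ']
    have z : ∀ j ∈ Finset.range r, τ ^ (j + 1) • (PowerSeries.coeff (j + 1) S (idA n)).1 x = 0 := by
      intro j hj
      have hj := Finset.mem_range.1 hj
      have : PowerSeries.coeff (j + 1) S = 0 := by
        rw [hG, map_add, PowerSeries.coeff_one, if_neg (by omega),
          PowerSeries.coeff_X_pow_mul', if_neg (by omega), add_zero]
      rw [this]
      change τ ^ (j + 1) • (0 : Fin n → ℝ) = 0
      rw [smul_zero]
    rw [Finset.sum_eq_zero z, zero_add]
    have a0 : PowerSeries.coeff 0 S = 1 := by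
      rw [hG, map_add, PowerSeries.coeff_X_pow_mul', if_neg (by omega)]; simp
    have a1 : PowerSeries.coeff (r + 1) S = Dop W := by
      rw [hG, map_add, PowerSeries.coeff_X_pow_mul', if_pos le_rfl, PowerSeries.coeff_one,
        if_neg (by omega)]
      simp [hW]
    rw [a0, a1, pow_zero, one_smul, Dop_id]
    rfl
  rw [e] at h
  rw [sub_sub]
  refine h.trans ?_
  gcongr
  exact (le_max_right _ _).trans (le_max_left _ _)

theorem step_c {n k : ℕ} (X : Fin k → (Fin n → ℝ) → (Fin n → ℝ))
    (hX : ∀ i, ContDiff ℝ (⊤ : ℕ∞) (X i)) (hc : ∀ i, HasCompactSupport (X i))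
    (M : ℝ) (hM : ∀ i x, ‖X i x‖ ≤ M)
    (Z : (Fin n → ℝ) → (Fin n → ℝ)) (hZ : LieHull (Set.range X) Z) :
    ∃ (A : ℝ) (r : ℕ), 0 ≤ A ∧ ∀ c : ℝ, |c| ≤ 1 → ∀ x, ∃ y l, CPath X x y l ∧
      l ≤ A * |c| ^ (((r : ℝ) + 1)⁻¹) ∧
      ‖y - x - c • Z x‖ ≤ A * |c| ^ (((r : ℝ) + 1)⁻¹) * |c| := by
  obtain ⟨V, r, S, S', G, hV, hS, hS', hSS, hSS', hG, hD⟩ := hull_exp X hX hc M hM Z hZ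
  obtain ⟨A, hA, h1⟩ := step_tau X r S G V hS hG hD
  have cS : PowerSeries.constantCoeff S = 1 := by rw [hG]; simp
  have cS' : PowerSeries.constantCoeff S' = 1 := by
    have := congrArg PowerSeries.constantCoeff hSS
    simpa [cS] using this
  obtain ⟨A', hA', h2⟩ := step_tau X r S' (-(G * S')) (-V) hS' (by
    rw [mul_neg, ← mul_assoc]
    have : PowerSeries.X ^ (r + 1) * G = S - 1 := by rw [hG]; abel
    rw [this, sub_mul, hSS, one_mul]; abel) (by
    rw [map_neg, map_mul, cS', mul_one, hD, Dop_neg])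
  subst hV
  refine ⟨A + A', r, by positivity, fun c hc1 x => ?_⟩
  set τ : ℝ := |c| ^ (((r : ℝ) + 1)⁻¹) with hτ
  have hτ0 : 0 ≤ τ := by positivity
  have hτ1 : τ ≤ 1 := Real.rpow_le_one (abs_nonneg c) hc1 (by positivity)
  have hτp : τ ^ (r + 1) = |c| := by
    have := Real.rpow_inv_natCast_pow (abs_nonneg c) (Nat.succ_ne_zero r)
    rw [hτ]
    simpa using this
  rcases le_total 0 c with h | h
  · obtain ⟨y, l, hp, hl, hy⟩ := h1 τ ⟨hτ0, hτ1⟩ x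
    refine ⟨y, l, hp, hl.trans (by gcongr; linarith), ?_⟩
    rw [pow_succ τ (r + 1), hτp, abs_of_nonneg h] at hy
    rw [abs_of_nonneg h]
    refine hy.trans ?_
    rw [mul_assoc, mul_comm τ c]
    gcongr; linarith
  · obtain ⟨y, l, hp, hl, hy⟩ := h2 τ ⟨hτ0, hτ1⟩ x
    refine ⟨y, l, hp, hl.trans (by gcongr; linarith), ?_⟩
    rw [pow_succ τ (r + 1), hτp, SmT_neg, smul_neg] at hy
    have : c = -|c| := by rw [abs_of_nonpos h]; ring
    have e : c • V.1 x = -(|c| • V.1 x) := by rw [← neg_smul, ← this]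
    rw [e]
    refine hy.trans ?_
    rw [mul_assoc, mul_comm τ |c|]
    gcongr; linarith

theorem step_fam {n k : ℕ} (X : Fin k → (Fin n → ℝ) → (Fin n → ℝ))
    (hX : ∀ i, ContDiff ℝ (⊤ : ℕ∞) (X i)) (hc : ∀ i, HasCompactSupport (X i))
    (M : ℝ) (hM : ∀ i x, ‖X i x‖ ≤ M) {ι : Type*} [Fintype ι]
    (Z : ι → (Fin n → ℝ) → (Fin n → ℝ)) (hZ : ∀ i, LieHull (Set.range X) (Z i)) :
    ∃ A p : ℝ, 0 ≤ A ∧ 0 < p ∧ ∀ i, ∀ c : ℝ, |c| ≤ 1 → ∀ x, ∃ y l, CPath X x y l ∧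
      l ≤ A * |c| ^ p ∧ ‖y - x - c • Z i x‖ ≤ A * |c| ^ p * |c| := by
  choose A r hA h using fun i => step_c X hX hc M hM (Z i) (hZ i)
  refine ⟨∑ i, A i, (((∑ i, r i : ℕ) : ℝ) + 1)⁻¹, Finset.sum_nonneg fun i _ => hA i,
    by positivity, fun i c hc1 x => ?_⟩
  obtain ⟨y, l, hp, hl, hy⟩ := h i c hc1 x
  have e1 : A i ≤ ∑ i, A i := Finset.single_le_sum (fun i _ => hA i) (Finset.mem_univ i)
  have e2 : (r i : ℝ) ≤ ((∑ i, r i : ℕ) : ℝ) := by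
    exact_mod_cast Finset.single_le_sum (fun i _ => Nat.zero_le (r i)) (Finset.mem_univ i)
  have e3 : |c| ^ (((r i : ℝ) + 1)⁻¹) ≤ |c| ^ ((((∑ i, r i : ℕ) : ℝ) + 1)⁻¹) := by
    refine Real.rpow_le_rpow_of_exponent_ge' (abs_nonneg c) hc1 (by positivity) ?_
    gcongr
  have e4 := mul_le_mul e1 e3 (by positivity) (Finset.sum_nonneg fun i _ => hA i)
  exact ⟨y, l, hp, hl.trans e4, hy.trans (mul_le_mul_of_nonneg_right e4 (abs_nonneg c))⟩

theorem contract {n k : ℕ} (X : Fin k → (Fin n → ℝ) → (Fin n → ℝ))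
    (hX : ∀ i, ContDiff ℝ (⊤ : ℕ∞) (X i)) (hc : ∀ i, HasCompactSupport (X i))
    (M : ℝ) (hM : ∀ i x, ‖X i x‖ ≤ M) {ι : Type*} [Fintype ι]
    (Z : ι → (Fin n → ℝ) → (Fin n → ℝ)) (hZ : ∀ i, LieHull (Set.range X) (Z i))
    (x₀ : Fin n → ℝ) (hZc : ∀ i, ContinuousAt (Z i) x₀)
    (b : Module.Basis ι ℝ (Fin n → ℝ)) (hb : ∀ i, b i = Z i x₀) :
    ∃ A p δ q : ℝ, 0 ≤ A ∧ 0 < p ∧ 0 < δ ∧ 0 < q ∧ q < 1 ∧ ∀ x y,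
      ∑ i, |b.repr (x - x₀) i| ≤ δ → ∑ i, |b.repr (y - x) i| ≤ δ →
      ∃ x' l, CPath X x x' l ∧ l ≤ A * (∑ i, |b.repr (y - x) i|) ^ p ∧
        ∑ i, |b.repr (y - x') i| ≤ q * ∑ i, |b.repr (y - x) i| := by
  classical
  obtain ⟨A, p, hA, hp, hst⟩ := step_fam X hX hc M hM Z hZ
  set N : (Fin n → ℝ) → ℝ := fun v => ∑ i, |b.repr v i| with hN
  have N0 : ∀ v, 0 ≤ N v := fun v => Finset.sum_nonneg fun i _ => abs_nonneg _
  have Nle : ∀ i v, |b.repr v i| ≤ N v := fun i v =>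
    Finset.single_le_sum (f := fun i => |b.repr v i|) (fun i _ => abs_nonneg _) (Finset.mem_univ i)
  have Nsub : ∀ v w, N (v - w) ≤ N v + N w := fun v w => by
    simp only [hN, map_sub, Finsupp.sub_apply]
    rw [← Finset.sum_add_distrib]
    exact Finset.sum_le_sum fun i _ => abs_sub _ _
  have Nsmul : ∀ (c : ℝ) v, N (c • v) = |c| * N v := fun c v => by
    simp [hN, abs_mul, Finset.mul_sum]
  have Nup : ∀ v, ‖v‖ ≤ (∑ i, ‖b i‖) * N v := fun v => by
    calc ‖v‖ = ‖∑ i, b.repr v i • b i‖ := by rw [b.sum_repr]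
      _ ≤ ∑ i, ‖b.repr v i • b i‖ := norm_sum_le _ _
      _ = ∑ i, ‖b i‖ * |b.repr v i| := by simp [norm_smul, mul_comm]
      _ ≤ ∑ i, ‖b i‖ * N v := by gcongr with i _; exact Nle i v
      _ = _ := by rw [Finset.sum_mul]
  obtain ⟨B, hB, Nlo⟩ : ∃ B, 0 ≤ B ∧ ∀ v, N v ≤ B * ‖v‖ := by
    let E : (Fin n → ℝ) →L[ℝ] (ι → ℝ) := LinearMap.toContinuousLinearMap b.equivFun.toLinearMap
    refine ⟨∑ _i : ι, ‖E‖, by positivity, fun v => ?_⟩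
    rw [Finset.sum_mul]
    refine Finset.sum_le_sum fun i _ => ?_
    have := (norm_le_pi_norm (E v) i).trans (E.le_opNorm v)
    simpa [E] using this
  have hev : ∀ᶠ δ in nhdsWithin (0 : ℝ) (Set.Ioi 0), 0 < δ ∧ δ ≤ 1 ∧ B * (A * δ ^ p) ≤ 1 / 4 ∧
      ∀ i x, N (x - x₀) ≤ δ → N (Z i x - b i) ≤ 1 / 4 := by
    have c1 : ∀ᶠ δ in nhdsWithin (0 : ℝ) (Set.Ioi 0), B * (A * δ ^ p) ≤ 1 / 4 := by
      have : ContinuousAt (fun δ : ℝ => B * (A * δ ^ p)) 0 :=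
        continuousAt_const.mul (continuousAt_const.mul
          (Real.continuousAt_rpow_const 0 p (Or.inr hp.le)))
      have h := this.tendsto.eventually_lt_const (u := 1 / 4) (by rw [Real.zero_rpow hp.ne']; norm_num)
      exact nhdsWithin_le_nhds (h.mono fun _ h => h.le)
    have c2 : ∀ i, ∀ᶠ δ in nhdsWithin (0 : ℝ) (Set.Ioi 0),
        ∀ x, N (x - x₀) ≤ δ → N (Z i x - b i) ≤ 1 / 4 := by
      intro i
      have : ContinuousAt (fun x => B * ‖Z i x - b i‖) x₀ :=
        continuousAt_const.mul ((hZc i).sub continuousAt_const).norm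
      have h := this.tendsto.eventually_lt_const (u := 1 / 4) (by simp [hb])
      obtain ⟨ρ, hρ, h⟩ := Metric.eventually_nhds_iff.1 h
      have : ContinuousAt (fun δ : ℝ => (∑ i, ‖b i‖) * δ) 0 := by fun_prop
      have h' := nhdsWithin_le_nhds (s := Set.Ioi (0 : ℝ))
        (this.tendsto.eventually_lt_const (u := ρ) (by simpa using hρ))
      filter_upwards [h'] with δ hδ x hx
      refine (Nlo _).trans (h ?_).le
      rw [dist_eq_norm]
      refine ((Nup _).trans ?_).trans_lt hδ
      have : 0 ≤ ∑ i, ‖b i‖ := by positivity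
      gcongr
    have c3 : ∀ᶠ δ in nhdsWithin (0 : ℝ) (Set.Ioi 0), δ ≤ 1 :=
      nhdsWithin_le_nhds ((gt_mem_nhds (by norm_num : (0 : ℝ) < 1)).mono fun _ h => h.le)
    filter_upwards [c1, Filter.eventually_all.2 c2, c3, self_mem_nhdsWithin] with δ h1 h2 h3 h4
    exact ⟨h4, h3, h1, h2⟩
  obtain ⟨δ, hδ0, hδ1, hδ2, hδ3⟩ := hev.exists
  set m : ℝ := (Fintype.card ι : ℝ) + 1 with hm
  have hm1 : 1 ≤ m := by simp [hm]
  refine ⟨A, p, δ, 1 - 1 / (2 * m), hA, hp, hδ0, ?_, ?_, fun x y hx hy => ?_⟩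
  · have : 1 / (2 * m) ≤ 1 / 2 := by
      rw [div_le_div_iff₀ (by positivity) (by norm_num)]; linarith
    linarith
  · have : 0 < 1 / (2 * m) := by positivity
    linarith
  change N (x - x₀) ≤ δ at hx
  change N (y - x) ≤ δ at hy
  change ∃ x' l, CPath X x x' l ∧ l ≤ A * (N (y - x)) ^ p ∧ N (y - x') ≤ _ * N (y - x)
  set d := N (y - x) with hd
  rcases (N0 (y - x)).eq_or_lt with h0 | h0
  · refine ⟨x, 0, CPath.refl X x, by positivity, ?_⟩
    rw [← hd, ← h0.trans hd.symm]; simp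
  obtain ⟨i, hi⟩ : ∃ i, d ≤ m * |b.repr (y - x) i| := by
    by_contra hcon
    push Not at hcon
    have : m * d ≤ ∑ i : ι, d := by
      rw [hd, hN]
      simp only
      rw [Finset.mul_sum]
      exact Finset.sum_le_sum fun i _ => (hcon i).le
    rw [Finset.sum_const, Finset.card_univ, nsmul_eq_mul] at this
    have h0' : 0 < d := h0
    rw [hm] at this
    nlinarith
  set c := b.repr (y - x) i with hcdef
  have hcd : |c| ≤ d := Nle i _
  obtain ⟨x', l, hpath, hl, hx'⟩ := hst i c (by linarith) x
  refine ⟨x', l, hpath, hl.trans ?_, ?_⟩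
  · gcongr
  have e1 : N (y - x - c • b i) = d - |c| := by
    rw [hd]
    simp only [hN, map_sub, map_smul, Module.Basis.repr_self]
    have : |c| = ∑ j, if j = i then |c| else 0 := by simp
    rw [this, ← Finset.sum_sub_distrib]
    refine Finset.sum_congr rfl fun j _ => ?_
    by_cases hj : j = i
    · subst hj
      simp [hcdef]
    · simp [hj, Finsupp.single_apply, Ne.symm hj]
  have e2 : y - x' = (y - x - c • b i) - c • (Z i x - b i) - (x' - x - c • Z i x) := by
    rw [smul_sub]; abel
  have e3 : N (x' - x - c • Z i x) ≤ |c| / 4 := by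
    refine (Nlo _).trans ((mul_le_mul_of_nonneg_left hx' hB).trans ?_)
    have : |c| ^ p ≤ δ ^ p := by
      have := hcd.trans hy
      gcongr
    calc B * (A * |c| ^ p * |c|) ≤ B * (A * δ ^ p * |c|) := by gcongr
      _ = B * (A * δ ^ p) * |c| := by ring
      _ ≤ 1 / 4 * |c| := by gcongr
      _ = _ := by ring
  have e4 : N (y - x') ≤ d - |c| + |c| * (1 / 4) + |c| / 4 := by
    rw [e2]
    refine (Nsub _ _).trans (add_le_add ((Nsub _ _).trans (add_le_add e1.le ?_)) e3)
    rw [Nsmul]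
    exact mul_le_mul_of_nonneg_left (hδ3 i x hx) (abs_nonneg c)
  refine e4.trans ?_
  have : 1 / (2 * m) * d ≤ |c| / 2 := by
    rw [div_mul_eq_mul_div, div_le_div_iff₀ (by positivity) (by norm_num)]
    nlinarith
  linarith

theorem reach {n k : ℕ} (X : Fin k → (Fin n → ℝ) → (Fin n → ℝ))
    (hX : ∀ i, ContDiff ℝ (⊤ : ℕ∞) (X i)) (hc : ∀ i, HasCompactSupport (X i))
    (M : ℝ) (hM : ∀ i x, ‖X i x‖ ≤ M) {ι : Type*} [Fintype ι]
    (Z : ι → (Fin n → ℝ) → (Fin n → ℝ)) (hZ : ∀ i, LieHull (Set.range X) (Z i))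
    (x₀ : Fin n → ℝ) (hZc : ∀ i, ContinuousAt (Z i) x₀)
    (b : Module.Basis ι ℝ (Fin n → ℝ)) (hb : ∀ i, b i = Z i x₀) (ε : ℝ) (hε : 0 < ε) :
    ∀ᶠ y in nhds x₀, ∃ L < ε, CPath X x₀ y L := by
  classical
  obtain ⟨A, p, δ, q, hA, hp, hδ, hq0, hq1, H⟩ := contract X hX hc M hM Z hZ x₀ hZc b hb
  set N : (Fin n → ℝ) → ℝ := fun v => ∑ i, |b.repr v i| with hN
  have N0 : ∀ v, 0 ≤ N v := fun v => Finset.sum_nonneg fun i _ => abs_nonneg _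
  have Nsub : ∀ v w, N (v - w) ≤ N v + N w := fun v w => by
    simp only [hN, map_sub, Finsupp.sub_apply]
    rw [← Finset.sum_add_distrib]
    exact Finset.sum_le_sum fun i _ => abs_sub _ _
  have Nup : ∀ v, ‖v‖ ≤ (∑ i, ‖b i‖) * N v := fun v => by
    calc ‖v‖ = ‖∑ i, b.repr v i • b i‖ := by rw [b.sum_repr]
      _ ≤ ∑ i, ‖b.repr v i • b i‖ := norm_sum_le _ _
      _ = ∑ i, ‖b i‖ * |b.repr v i| := by simp [norm_smul, mul_comm]
      _ ≤ ∑ i, ‖b i‖ * N v := by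
        gcongr with i _
        exact Finset.single_le_sum (f := fun i => |b.repr v i|) (fun i _ => abs_nonneg _)
          (Finset.mem_univ i)
      _ = _ := by rw [Finset.sum_mul]
  have Ncont : Continuous N := by
    let E : (Fin n → ℝ) →L[ℝ] (ι → ℝ) := LinearMap.toContinuousLinearMap b.equivFun.toLinearMap
    have : N = fun v => ∑ i, |E v i| := by ext v; simp [hN, E]
    rw [this]
    fun_prop
  have Ny : Continuous fun y => N (y - x₀) := Ncont.comp (continuous_id.sub continuous_const)
  have Nz : N (x₀ - x₀) = 0 := by simp [hN]
  have hqp0 : 0 < q ^ p := Real.rpow_pos_of_pos hq0 p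
  have hqp1 : q ^ p < 1 := Real.rpow_lt_one hq0.le hq1 hp
  have ev1 : ∀ᶠ y in nhds x₀, N (y - x₀) < δ / 2 :=
    Ny.continuousAt.tendsto.eventually_lt_const (by rw [Nz]; positivity)
  have ev2 : ∀ᶠ y in nhds x₀, A * N (y - x₀) ^ p * (1 - q ^ p)⁻¹ < ε := by
    have : ContinuousAt (fun y => A * N (y - x₀) ^ p * (1 - q ^ p)⁻¹) x₀ :=
      (continuousAt_const.mul (Ny.continuousAt.rpow_const (Or.inr hp.le))).mul continuousAt_const
    refine this.tendsto.eventually_lt_const ?_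
    rw [Nz, Real.zero_rpow hp.ne']; simpa using hε
  filter_upwards [ev1, ev2] with y hy1 hy2
  set d := N (y - x₀) with hd
  have hd0 : 0 ≤ d := N0 _
  have H' : ∀ x : Fin n → ℝ, ∃ x' l, N (x - x₀) ≤ δ → N (y - x) ≤ δ → CPath X x x' l ∧
      l ≤ A * N (y - x) ^ p ∧ N (y - x') ≤ q * N (y - x) := by
    intro x
    by_cases h : N (x - x₀) ≤ δ ∧ N (y - x) ≤ δ
    · obtain ⟨x', l, h'⟩ := H x y h.1 h.2
      exact ⟨x', l, fun _ _ => h'⟩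
    · exact ⟨x, 0, fun h1 h2 => absurd ⟨h1, h2⟩ h⟩
  choose F l hF using H'
  let s : ℕ → Fin n → ℝ := fun j => F^[j] x₀
  have ss : ∀ j, s (j + 1) = F (s j) := fun j => Function.iterate_succ_apply' F j x₀
  have key : ∀ j, N (y - s j) ≤ q ^ j * d → N (s j - x₀) ≤ δ ∧ N (y - s j) ≤ δ := by
    intro j hj
    have h1 : q ^ j * d ≤ d := mul_le_of_le_one_left hd0 (pow_le_one₀ hq0.le hq1.le)
    have h2 : N (s j - x₀) ≤ N (y - x₀) + N (y - s j) := by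
      have := Nsub (y - x₀) (y - s j)
      rwa [sub_sub_sub_cancel_left] at this
    constructor <;> linarith
  have inv : ∀ j, N (y - s j) ≤ q ^ j * d := by
    intro j
    induction j with
    | zero => simp [s, hd]
    | succ j ih =>
      obtain ⟨k1, k2⟩ := key j ih
      have := (hF (s j) k1 k2).2.2
      rw [ss, pow_succ']
      refine this.trans ?_
      rw [mul_assoc]
      gcongr
  have hpath : ∀ j, CPath X (s j) (s (j + 1)) (l (s j)) := fun j => by
    obtain ⟨k1, k2⟩ := key j (inv j)
    rw [ss]
    exact (hF (s j) k1 k2).1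
  have hl : ∀ j, l (s j) ≤ A * d ^ p * (q ^ p) ^ j := fun j => by
    obtain ⟨k1, k2⟩ := key j (inv j)
    refine (hF (s j) k1 k2).2.1.trans ?_
    have : N (y - s j) ^ p ≤ (q ^ j * d) ^ p := Real.rpow_le_rpow (N0 _) (inv j) hp.le
    rw [Real.mul_rpow (by positivity) hd0, ← Real.rpow_natCast q j, ← Real.rpow_mul hq0.le,
      mul_comm (j : ℝ) p, Real.rpow_mul hq0.le, Real.rpow_natCast] at this
    calc A * N (y - s j) ^ p ≤ A * ((q ^ p) ^ j * d ^ p) := by gcongr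
      _ = _ := by ring
  have hgeo : HasSum (fun j => A * d ^ p * (q ^ p) ^ j) (A * d ^ p * (1 - q ^ p)⁻¹) :=
    (hasSum_geometric_of_lt_one hqp0.le hqp1).mul_left _
  have hsum : Summable fun j => l (s j) :=
    Summable.of_nonneg_of_le (fun j => (hpath j).1) hl hgeo.summable
  refine ⟨∑' j, l (s j), (hasSum_le hl hsum.hasSum hgeo).trans_lt hy2, ?_⟩
  refine CPath.glue X (fun i => (hX i).continuous) M hM s _ hpath _ hsum.hasSum y ?_
  rw [tendsto_iff_norm_sub_tendsto_zero]
  have hlim : Filter.Tendsto (fun j : ℕ => (∑ i, ‖b i‖) * (q ^ j * d)) Filter.atTop (nhds 0) := by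
    have := ((tendsto_pow_atTop_nhds_zero_of_lt_one hq0.le hq1).mul_const d).const_mul (∑ i, ‖b i‖)
    simpa using this
  refine squeeze_zero (fun _ => norm_nonneg _) (fun j => ?_) hlim
  rw [norm_sub_rev]
  refine (Nup _).trans ?_
  have : 0 ≤ ∑ i, ‖b i‖ := by positivity
  have := inv j
  gcongr

theorem hull_cut {n k : ℕ} (X Y : Fin k → (Fin n → ℝ) → (Fin n → ℝ)) (x₀ : Fin n → ℝ)
    (hXY : ∀ i, Y i =ᶠ[nhds x₀] X i) (Z : (Fin n → ℝ) → (Fin n → ℝ))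
    (hZ : LieHull (Set.range X) Z) :
    ∃ W, LieHull (Set.range Y) W ∧ W =ᶠ[nhds x₀] Z := by
  induction hZ with
  | base h =>
    obtain ⟨i, rfl⟩ := h
    exact ⟨Y i, LieHull.base ⟨i, rfl⟩, hXY i⟩
  | br _ _ ih1 ih2 =>
    obtain ⟨W1, a1, b1⟩ := ih1
    obtain ⟨W2, a2, b2⟩ := ih2
    refine ⟨lieB W1 W2, LieHull.br a1 a2, ?_⟩
    filter_upwards [b1, b2, b1.fderiv (𝕜 := ℝ), b2.fderiv (𝕜 := ℝ)] with x h1 h2 h3 h4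
    simp only [lieB, h1, h2, h3, h4]

theorem hull_smooth {n k : ℕ} (X : Fin k → (Fin n → ℝ) → (Fin n → ℝ))
    (hX : ∀ i, ContDiff ℝ (⊤ : ℕ∞) (X i)) (Z : (Fin n → ℝ) → (Fin n → ℝ))
    (hZ : LieHull (Set.range X) Z) : ContDiff ℝ (⊤ : ℕ∞) Z := by
  induction hZ with
  | base h =>
    obtain ⟨i, rfl⟩ := h
    exact hX i
  | br _ _ ih1 ih2 => exact (smooth_deriv ih2 ih1).sub (smooth_deriv ih1 ih2)

theorem reach_bg {n k : ℕ} (X Y : Fin k → (Fin n → ℝ) → (Fin n → ℝ)) (x₀ : Fin n → ℝ)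
    (hXY : ∀ i, Y i =ᶠ[nhds x₀] X i)
    (hY : ∀ i, ContDiff ℝ (⊤ : ℕ∞) (Y i)) (hc : ∀ i, HasCompactSupport (Y i))
    (M : ℝ) (hM : ∀ i x, ‖Y i x‖ ≤ M)
    (hbg : Submodule.span ℝ {v | ∃ Z, LieHull (Set.range X) Z ∧ v = Z x₀} = ⊤)
    (ε : ℝ) (hε : 0 < ε) :
    ∀ᶠ y in nhds x₀, ∃ L < ε, CPath Y x₀ y L := by
  classical
  let b := Module.Basis.ofSpan hbg.ge
  have hb : ∀ i, ∃ Z, LieHull (Set.range X) Z ∧ b i = Z x₀ := fun i =>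
    Module.Basis.ofSpan_subset hbg.ge ⟨i, rfl⟩
  haveI := Module.Finite.finite_basis b
  haveI := Fintype.ofFinite ((Set.range b))
  choose Z hZ hbZ using hb
  choose W hW hWZ using fun i => hull_cut X Y x₀ hXY (Z i) (hZ i)
  haveI : Fintype _ := FiniteDimensional.fintypeBasisIndex b
  exact reach Y hY hc M hM W hW x₀ (fun i => (hull_smooth Y hY _ (hW i)).continuous.continuousAt) b
    (fun i => by rw [hbZ, (hWZ i).eq_of_nhds]) ε hε

theorem CPath.toHL {n k : ℕ} (U : Set (Fin n → ℝ)) (X Y : Fin k → (Fin n → ℝ) → (Fin n → ℝ))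
    (hY : ∀ i, Continuous (Y i)) (M : ℝ) (hM0 : 0 ≤ M) (hM : ∀ i x, ‖Y i x‖ ≤ M)
    (x₀ y : Fin n → ℝ) (ρ : ℝ)
    (hρ : ∀ x, ‖x - x₀‖ < ρ → x ∈ U ∧ ∀ i, Y i x = X i x) (L : ℝ) (hL : k * M * L < ρ)
    (h : CPath Y x₀ y L) : y ∈ U ∧ ∃ ℓ ∈ HorizontalLengths U X x₀ y, ℓ ≤ Real.sqrt k * L := by
  obtain ⟨hL0, h⟩ := h
  obtain ⟨γ, u, g0, g1, um, ub, gc, gi⟩ := h 0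
  rw [zero_add] at *
  have hfm : AEStronglyMeasurable (fun s => ∑ i, u i s • Y i (γ s))
      (volume.restrict (Set.Icc 0 L)) := by
    have hγ : AEStronglyMeasurable γ (volume.restrict (Set.Icc 0 L)) :=
      gc.aestronglyMeasurable measurableSet_Icc
    have := Finset.aestronglyMeasurable_sum (μ := volume.restrict (Set.Icc 0 L)) Finset.univ
      (f := fun i s => u i s • Y i (γ s))
      (fun i _ => (um i).smul ((hY i).comp_aestronglyMeasurable hγ))
    refine this.congr (Filter.Eventually.of_forall fun s => ?_)
    simp
  have hfb : ∀ s, ‖∑ i, u i s • Y i (γ s)‖ ≤ k * M := fun s => by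
    calc ‖∑ i, u i s • Y i (γ s)‖ ≤ ∑ i, ‖u i s • Y i (γ s)‖ := norm_sum_le _ _
      _ ≤ ∑ _i : Fin k, M := by
        refine Finset.sum_le_sum fun i _ => ?_
        rw [norm_smul]
        calc _ ≤ 1 * M := mul_le_mul (ub i s) (hM _ _) (norm_nonneg _) zero_le_one
          _ = M := one_mul M
      _ = k * M := by simp
  have hin : ∀ t ∈ Set.Icc 0 L, ‖γ t - x₀‖ < ρ := by
    intro t ht
    rw [gi t ht, add_sub_cancel_left]
    refine (intervalIntegral.norm_integral_le_of_norm_le_const (fun s _ => hfb s)).trans_lt ?_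
    rw [sub_zero, abs_of_nonneg ht.1]
    refine lt_of_le_of_lt ?_ hL
    have := ht.2
    gcongr
  have hmemL : L ∈ Set.Icc 0 L := ⟨hL0, le_rfl⟩
  have heq : ∀ s ∈ Set.Icc 0 L, ∑ i, u i s • Y i (γ s) = ∑ i, u i s • X i (γ s) := fun s hs =>
    Finset.sum_congr rfl fun i _ => by rw [(hρ _ (hin s hs)).2 i]
  have ui : ∀ i, IntegrableOn (u i) (Set.Icc 0 L) := fun i =>
    Integrable.of_bound (um i) 1
      (Filter.Eventually.of_forall fun s => by simpa using ub i s)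
  have fi : IntegrableOn (fun s => ∑ i, u i s • Y i (γ s)) (Set.Icc 0 L) :=
    Integrable.of_bound hfm (k * M)
      (Filter.Eventually.of_forall hfb)
  refine ⟨g1 ▸ (hρ _ (hin L hmemL)).1, srLength u 0 L, ?_, ?_⟩
  · refine ⟨1, ![0, L], γ, fun _ => u, ?_, by simpa using g0, by simpa [Fin.last] using g1, ?_, by simp⟩
    · refine Fin.monotone_iff_le_succ.2 fun i => ?_
      fin_cases i
      simpa using hL0
    · intro j
      fin_cases j
      change IsControlledOn U X γ 0 L u
      refine ⟨hL0, fun t ht => (hρ _ (hin t ht)).1, gc, ui,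
        fi.congr_fun heq measurableSet_Icc, fun t ht => ?_⟩
      rw [g0, gi t ht]
      congr 1
      refine intervalIntegral.integral_congr fun s hs => ?_
      rw [Set.uIcc_of_le ht.1] at hs
      exact heq s ⟨hs.1, hs.2.trans ht.2⟩
  · rw [srLength]
    have : ∀ s ∈ Set.uIoc 0 L, ‖Real.sqrt (∑ i, (u i s) ^ 2)‖ ≤ Real.sqrt k := fun s _ => by
      rw [Real.norm_of_nonneg (Real.sqrt_nonneg _)]
      refine Real.sqrt_le_sqrt ?_
      calc ∑ i, (u i s) ^ 2 ≤ ∑ _i : Fin k, (1 : ℝ) :=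
            Finset.sum_le_sum fun i _ => (sq_le_one_iff_abs_le_one _).2 (ub i s)
        _ = k := by simp
    have h := intervalIntegral.norm_integral_le_of_norm_le_const this
    rw [sub_zero, abs_of_nonneg hL0] at h
    exact (Real.le_norm_self _).trans h
/-- If the smooth vector fields `X₁, …, X_k` are bracket generating and pointwise linearly
independent on the open set `U ⊆ ℝⁿ`, then every subriemannian ball
`B(ε, x₀) = {y ∈ U : d(x₀,y) < ε}` with `ε > 0` is a neighbourhood of its center `x₀`. -/
theorem srBall_mem_nhds {n k : ℕ} (U : Set (Fin n → ℝ)) (hUopen : IsOpen U)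
    (X : Fin k → (Fin n → ℝ) → (Fin n → ℝ))
    (hXsmooth : ∀ i, ContDiffOn ℝ (⊤ : ℕ∞) (X i) U)
    (hli : ∀ x ∈ U, LinearIndependent ℝ fun i => X i x)
    (hbg : BracketGenerating U (Set.range X))
    (x₀ : Fin n → ℝ) (hx₀ : x₀ ∈ U) (ε : ℝ) (hε : 0 < ε) :
    {y | y ∈ U ∧ srDist U X x₀ y < ENNReal.ofReal ε} ∈ nhds x₀ := by
  obtain ⟨R, hR, hRU⟩ := Metric.isOpen_iff.1 hUopen x₀ hx₀
  let χ : ContDiffBump x₀ := ⟨R / 4, R / 2, by positivity, by linarith⟩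
  let Y : Fin k → (Fin n → ℝ) → (Fin n → ℝ) := fun i x => χ x • X i x
  have hχs : tsupport χ ⊆ U := by
    rw [χ.tsupport_eq]
    exact (Metric.closedBall_subset_ball (by change R / 2 < R; linarith)).trans hRU
  have hone : ∀ x, ‖x - x₀‖ < R / 4 → x ∈ U ∧ ∀ i, Y i x = X i x := by
    intro x hx
    have hx' : x ∈ Metric.closedBall x₀ χ.rIn := by
      rw [Metric.mem_closedBall, dist_eq_norm]; exact hx.le
    refine ⟨hRU ?_, fun i => ?_⟩
    · rw [Metric.mem_ball, dist_eq_norm]; linarith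
    · simp only [Y]
      rw [χ.one_of_mem_closedBall hx', one_smul]
  have hXY : ∀ i, Y i =ᶠ[nhds x₀] X i := fun i => by
    filter_upwards [Metric.ball_mem_nhds x₀ (by positivity : 0 < R / 4)] with x hx
    exact (hone x (by rwa [Metric.mem_ball, dist_eq_norm] at hx)).2 i
  have hYs : ∀ i, ContDiff ℝ (⊤ : ℕ∞) (Y i) := by
    intro i
    rw [contDiff_iff_contDiffAt]
    intro x
    by_cases hx : x ∈ tsupport χ
    · exact χ.contDiffAt.smul ((hXsmooth i).contDiffAt (hUopen.mem_nhds (hχs hx)))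
    · have : Y i =ᶠ[nhds x] fun _ => 0 := by
        filter_upwards [(isClosed_tsupport χ).isOpen_compl.mem_nhds hx] with z hz
        simp only [Y]
        rw [image_eq_zero_of_notMem_tsupport hz, zero_smul]
      exact contDiffAt_const.congr_of_eventuallyEq this
  have hYc : ∀ i, HasCompactSupport (Y i) := fun i => χ.hasCompactSupport.smul_right
  choose C hC using fun i => (hYc i).exists_bound_of_continuous (hYs i).continuous
  have hC0 : ∀ i, 0 ≤ C i := fun i => (norm_nonneg _).trans (hC i x₀)
  set M := ∑ i, C i with hM
  have hM0 : 0 ≤ M := Finset.sum_nonneg fun i _ => hC0 i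
  have hYM : ∀ i x, ‖Y i x‖ ≤ M := fun i x =>
    (hC i x).trans (Finset.single_le_sum (fun i _ => hC0 i) (Finset.mem_univ i))
  set η := min (R / 4 / (k * M + 1)) (ε / (Real.sqrt k + 1)) with hη
  have hη0 : 0 < η := by positivity
  filter_upwards [reach_bg X Y x₀ hXY hYs hYc M hYM (hbg x₀ hx₀) η hη0] with y hy
  obtain ⟨L, hL, hp⟩ := hy
  have hL0 := hp.1
  have h1 : L * (k * M + 1) < R / 4 := by
    rw [← lt_div_iff₀ (by positivity)]; exact hL.trans_le (min_le_left _ _)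
  have h2 : L * (Real.sqrt k + 1) < ε := by
    rw [← lt_div_iff₀ (by positivity)]; exact hL.trans_le (min_le_right _ _)
  obtain ⟨hyU, ℓ, hℓ, hℓ2⟩ := hp.toHL U X Y (fun i => (hYs i).continuous) M hM0 hYM x₀ y (R / 4)
    hone L (by nlinarith)
  refine ⟨hyU, ?_⟩
  refine lt_of_le_of_lt (sInf_le ⟨ℓ, hℓ, rfl⟩) ?_
  rw [ENNReal.ofReal_lt_ofReal_iff hε]
  nlinarith
end
end

section
/- Let U ⊆ ℝⁿ be open and let X₁,…,X_k : U → ℝⁿ be smooth bracket generating vector fields. Let r ≥ 0 and let f : U → ℝ be a function such that for each i = 1,…,k the horizontal derivative Xᵢf — defined at x ∈ U as the derivative at t = 0 of t ↦ f(αₓ(t)), where αₓ is the integral curve of Xᵢ with αₓ(0) = x — exists at every point of U and the resulting function Xᵢf : U → ℝ is of class C^r. Then f itself is of class C^r on U. -/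
noncomputable section
open MeasureTheory

open Set Filter Topology

def postc {I E F : Type} [TopologicalSpace I] [TopologicalSpace E] [TopologicalSpace F]
    (h : E → F) (hc : Continuous h) : C(I, E) → C(I, F) := fun u => (⟨h, hc⟩ : C(E, F)).comp u

def appB (I E F : Type) [TopologicalSpace I] [CompactSpace I] [NormedAddCommGroup E]
    [NormedSpace ℝ E] [NormedAddCommGroup F] [NormedSpace ℝ F] :
    C(I, E →L[ℝ] F) →L[ℝ] C(I, E) →L[ℝ] C(I, F) :=
  LinearMap.mkContinuous₂ (LinearMap.mk₂ ℝ
    (fun (A : C(I, E →L[ℝ] F)) (v : C(I, E)) =>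
      (⟨fun s => A s (v s), A.continuous.clm_apply v.continuous⟩ : C(I, F)))
    (by intros; ext; simp) (by intros; ext; simp) (by intros; ext; simp) (by intros; ext; simp)) 1
    (by
      intro A v
      rw [ContinuousMap.norm_le _ (by positivity)]
      intro s
      rw [one_mul]
      exact ((A s).le_opNorm _).trans (by gcongr <;> exact ContinuousMap.norm_coe_le_norm _ _))

theorem appB_apply {I E F : Type} [TopologicalSpace I] [CompactSpace I] [NormedAddCommGroup E]
    [NormedSpace ℝ E] [NormedAddCommGroup F] [NormedSpace ℝ F] (A : C(I, E →L[ℝ] F)) (v : C(I, E))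
    (s : I) : appB I E F A v s = A s (v s) := rfl

theorem hasFDerivAt_postc {I E F : Type} [TopologicalSpace I] [CompactSpace I]
    [NormedAddCommGroup E] [NormedSpace ℝ E] [NormedAddCommGroup F] [NormedSpace ℝ F]
    (h : E → F) (h' : E → E →L[ℝ] F) (hc : Continuous h) (hc' : Continuous h')
    (hd : ∀ x, HasFDerivAt h (h' x) x) (u : C(I, E)) :
    HasFDerivAt (postc (I := I) h hc) (appB I E F (postc h' hc' u)) u := by
  rw [hasFDerivAt_iff_isLittleO, Asymptotics.isLittleO_iff]
  intro c hcpos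
  have hcont : ContinuousAt (postc (I := I) h' hc') u :=
    (ContinuousMap.continuous_postcomp (⟨h', hc'⟩ : C(E, E →L[ℝ] F))).continuousAt
  obtain ⟨δ, hδ, hball⟩ := (Metric.continuousAt_iff (f := postc (I := I) h' hc') (a := u)).1 hcont c hcpos
  filter_upwards [Metric.ball_mem_nhds u hδ] with w hw
  rw [ContinuousMap.norm_le _ (by positivity)]
  intro s
  have key : ∀ z ∈ segment ℝ (u s) (w s), ‖h' z - h' (u s)‖ ≤ c := by
    rintro z ⟨a, b, ha, hb, hab, rfl⟩
    have hw2 : dist (a • u + b • w) u < δ := by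
      have : a • u + b • w - u = b • (w - u) := by
        rw [← sub_eq_iff_eq_add.2 hab.symm, sub_smul, one_smul, smul_sub]; abel
      rw [dist_eq_norm, this, norm_smul, Real.norm_of_nonneg hb, ← dist_eq_norm]
      have := Metric.mem_ball.1 hw
      nlinarith [dist_nonneg (x := w) (y := u)]
    have := hball hw2
    have h3 := (ContinuousMap.dist_apply_le_dist s).trans this.le
    rw [dist_eq_norm] at h3
    exact h3
  have := (convex_segment (𝕜 := ℝ) (u s) (w s)).norm_image_sub_le_of_norm_hasFDerivWithin_le'
    (fun z _ => (hd z).hasFDerivWithinAt) key (left_mem_segment ℝ _ _) (right_mem_segment ℝ _ _)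
  refine this.trans ?_
  gcongr
  exact ContinuousMap.norm_coe_le_norm (w - u) s

theorem contDiff_postc {I E : Type} [TopologicalSpace I] [CompactSpace I]
    [NormedAddCommGroup E] [NormedSpace ℝ E] (N : ℕ) : ∀ {F : Type} [NormedAddCommGroup F]
    [NormedSpace ℝ F] (h : E → F) (hh : ContDiff ℝ N h),
    ContDiff ℝ N (postc (I := I) h hh.continuous) := by
  induction N with
  | zero =>
    intro F _ _ h hh
    exact contDiff_zero.2 (ContinuousMap.continuous_postcomp (⟨h, hh.continuous⟩ : C(E, F)))
  | succ N ih =>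
    intro F _ _ h hh
    push_cast at hh
    have h1 : ContDiff ℝ N (fderiv ℝ h) := ((contDiff_succ_iff_fderiv).1 hh).2.2
    have hd : ∀ x, HasFDerivAt h (fderiv ℝ h x) x := fun x =>
      (hh.differentiable (by simp) x).hasFDerivAt
    have hB : ContDiff ℝ N (fun A => appB I E F A) := by
      apply ContinuousLinearMap.contDiff
    push_cast
    refine contDiff_succ_iff_hasFDerivAt.2 ⟨fun u => appB I E F (postc (fderiv ℝ h) h1.continuous u),
      hB.comp (ih _ h1), fun u => hasFDerivAt_postc _ _ _ _ hd u⟩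

abbrev JJ := Set.Icc (-1 : ℝ) 2
def jext {E : Type} (u : JJ → E) : ℝ → E := fun s => u (projIcc (-1) 2 (by norm_num) s)
theorem jext_cont {E : Type} [TopologicalSpace E] (u : C(JJ, E)) : Continuous (jext u) :=
  u.continuous.comp continuous_projIcc

def KK (E : Type) [NormedAddCommGroup E] [NormedSpace ℝ E] : C(JJ, E) →L[ℝ] C(JJ, E) :=
  LinearMap.mkContinuous
    { toFun := fun u => ⟨fun s => ∫ σ in (0:ℝ)..s, jext u σ, by
        have := intervalIntegral.continuous_primitive (μ := MeasureTheory.volume)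
          (f := jext u) (fun a b => (jext_cont u).intervalIntegrable a b) 0
        exact this.comp continuous_subtype_val⟩
      map_add' := by
        intro u v
        ext s
        exact intervalIntegral.integral_add ((jext_cont u).intervalIntegrable _ _)
          ((jext_cont v).intervalIntegrable _ _)
      map_smul' := by
        intro c u
        ext s
        exact intervalIntegral.integral_smul c (jext u) } 2
    (by
      intro u
      rw [ContinuousMap.norm_le _ (by positivity)]
      intro s
      have h1 : ‖∫ σ in (0:ℝ)..s, jext u σ‖ ≤ ‖u‖ * |(s:ℝ) - 0| :=
        intervalIntegral.norm_integral_le_of_norm_le_const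
          (fun x _ => ContinuousMap.norm_coe_le_norm u _)
      have h2 : |(s:ℝ) - 0| ≤ 2 := by
        rw [sub_zero, abs_le]; constructor <;> linarith [s.2.1, s.2.2]
      refine h1.trans ?_
      rw [mul_comm]; gcongr)

theorem KK_apply {E : Type} [NormedAddCommGroup E] [NormedSpace ℝ E] (u : C(JJ, E)) (s : JJ) :
    KK E u s = ∫ σ in (0:ℝ)..s, jext u σ := rfl

theorem flow1 {E : Type} [NormedAddCommGroup E] [NormedSpace ℝ E] [CompleteSpace E]
    (N : ℕ) (hN : N ≠ 0) (X : E → E) (hX : ContDiff ℝ N X) (x0 : E) :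
    ∃ ψ : ℝ × E → C(JJ, E), ContDiffAt ℝ N ψ (0, x0) ∧ ψ (0, x0) = ContinuousMap.const JJ x0 ∧
      ∀ᶠ p in 𝓝 ((0, x0) : ℝ × E),
        ψ p = ContinuousMap.const JJ p.2 + p.1 • KK E (postc X hX.continuous (ψ p)) := by
  set cst : E →L[ℝ] C(JJ, E) := ContinuousLinearMap.const ℝ JJ with hcst
  set F : (ℝ × E) × C(JJ, E) → C(JJ, E) := fun q =>
    q.2 - cst q.1.2 - q.1.1 • KK E (postc X hX.continuous q.2) with hF
  have hΩ := contDiff_postc (I := JJ) N X hX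
  have hFs : ContDiff ℝ N F := by
    have h1 : ContDiff ℝ N (fun q : (ℝ × E) × C(JJ, E) => cst q.1.2) := by fun_prop
    have h2 : ContDiff ℝ N (fun q : (ℝ × E) × C(JJ, E) => KK E (postc X hX.continuous q.2)) := by
      have h3 : ContDiff ℝ N (fun q : (ℝ × E) × C(JJ, E) => postc X hX.continuous q.2) :=
        hΩ.comp contDiff_snd
      fun_prop
    fun_prop
  have cdf : ContDiffAt ℝ N F ((0, x0), cst x0) := hFs.contDiffAt
  have pn : (N : WithTop ℕ∞) ≠ 0 := by exact_mod_cast hN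
  have hid : fderiv ℝ F ((0, x0), cst x0) ∘L .inr ℝ (ℝ × E) C(JJ, E) = .id ℝ _ := by
    have h1 : HasFDerivAt F (fderiv ℝ F ((0, x0), cst x0)) ((0, x0), cst x0) :=
      (cdf.differentiableAt pn).hasFDerivAt
    have h2 : HasFDerivAt (fun u : C(JJ, E) => (((0, x0), u) : (ℝ × E) × C(JJ, E)))
        (.inr ℝ (ℝ × E) C(JJ, E)) (cst x0) := hasFDerivAt_prodMk_right _ _
    have h3 := HasFDerivAt.comp (cst x0) h1 h2
    have h4 : HasFDerivAt (F ∘ fun u : C(JJ, E) => (((0, x0), u) : (ℝ × E) × C(JJ, E)))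
        (.id ℝ _) (cst x0) := by
      have : (F ∘ fun u : C(JJ, E) => (((0, x0), u) : (ℝ × E) × C(JJ, E))) =
          fun u => u - cst x0 := by
        funext u; simp [hF]
      rw [this]
      exact (hasFDerivAt_id _).sub_const _
    exact h3.unique h4
  have if₂ : (fderiv ℝ F ((0, x0), cst x0) ∘L .inr ℝ (ℝ × E) C(JJ, E)).IsInvertible := by
    rw [hid]; exact ⟨ContinuousLinearEquiv.refl ℝ _, rfl⟩
  have hF0 : F ((0, x0), cst x0) = 0 := by simp [hF]
  refine ⟨cdf.implicitFunction pn if₂, cdf.contDiffAt_implicitFunction pn if₂,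
    cdf.implicitFunction_apply_self pn if₂, ?_⟩
  filter_upwards [cdf.eventually_apply_implicitFunction pn if₂] with p hp
  rw [hF0] at hp
  have h5 : cdf.implicitFunction pn if₂ p - cst p.2 - p.1 • KK E (postc X hX.continuous
    (cdf.implicitFunction pn if₂ p)) = 0 := hp
  rw [sub_sub, sub_eq_zero] at h5
  exact h5

theorem flow2 {E : Type} [NormedAddCommGroup E] [NormedSpace ℝ E] [CompleteSpace E]
    (X : E → E) (hX : Continuous X) (t : ℝ) (x : E) (u : C(JJ, E))
    (hu : u = ContinuousMap.const JJ x + t • KK E (postc X hX u)) :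
    jext u 0 = x ∧ ∀ s ∈ Ioo (-1 : ℝ) 2, HasDerivAt (jext u) (t • X (jext u s)) s := by
  have key : ∀ s ∈ Icc (-1 : ℝ) 2, jext u s = x + t • ∫ σ in (0:ℝ)..s, X (jext u σ) := by
    intro s hs
    have h1 : jext u s = u ⟨s, hs⟩ := by
      rw [jext, projIcc_of_mem (by norm_num) hs]
    rw [h1]
    conv_lhs => rw [hu]
    rfl
  refine ⟨?_, ?_⟩
  · rw [key 0 (by norm_num)]; simp
  · intro s hs
    have hc : Continuous (fun σ => X (jext u σ)) := hX.comp (jext_cont u)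
    have h1 := intervalIntegral.integral_hasDerivAt_right (hc.intervalIntegrable 0 s)
      hc.stronglyMeasurable.stronglyMeasurableAtFilter hc.continuousAt
    have h2 := (h1.const_smul t).const_add x
    refine h2.congr_of_eventuallyEq ?_
    filter_upwards [Ioo_mem_nhds hs.1 hs.2] with y hy
    exact key y (Ioo_subset_Icc_self hy)

/-- Restricted data: the derivative of `f` along integral curves of `X` is `g`. -/
def HorDer {E : Type} [NormedAddCommGroup E] [NormedSpace ℝ E] (U : Set E) (X : E → E)
    (f g : E → ℝ) : Prop :=
  ∀ x ∈ U, ∃ α : ℝ → E, α 0 = x ∧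
      (∀ᶠ t in nhds (0 : ℝ), α t ∈ U ∧ HasDerivAt α (X (α t)) t) ∧
      HasDerivAt (fun t => f (α t)) (g x) 0

theorem deriv_along {E : Type} [NormedAddCommGroup E] [NormedSpace ℝ E] {U : Set E}
    (hU : IsOpen U) {X : E → E} (hX : ContDiffOn ℝ 1 X U) {f g : E → ℝ} (hd : HorDer U X f g)
    (t : ℝ) (β : ℝ → E) (s : ℝ) (hs : β s ∈ U)
    (hβ : ∀ᶠ y in 𝓝 s, HasDerivAt β (t • X (β y)) y) :
    HasDerivAt (fun y => f (β y)) (t * g (β s)) s := by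
  obtain ⟨α, h0, hα, hf⟩ := hd _ hs
  obtain ⟨K, S, hS, hK⟩ := (hX.contDiffAt (hU.mem_nhds hs)).exists_lipschitzOnWith
  set γ : ℝ → E := fun y => α (t * (y - s)) with hγ
  have hlin : ∀ y, HasDerivAt (fun y : ℝ => t * (y - s)) t y := fun y => by
    simpa using ((hasDerivAt_id y).sub_const s).const_mul t
  have htend : Tendsto (fun y : ℝ => t * (y - s)) (𝓝 s) (𝓝 0) := by
    have := (hlin s).continuousAt.tendsto
    simpa using this
  have hγd : ∀ᶠ y in 𝓝 s, HasDerivAt γ (t • X (γ y)) y := by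
    filter_upwards [htend.eventually hα] with y hy
    exact hy.2.scomp y (hlin y)
  have hγs : γ s = β s := by simp [hγ, h0]
  have hev : β =ᶠ[𝓝 s] γ := by
    refine ODE_solution_unique_of_eventually (v := fun _ y => t • X y) (s := fun _ => S)
      (K := ‖t‖₊ * K) ?_ ?_ ?_ hγs.symm
    · exact Eventually.of_forall fun _ => (lipschitzWith_smul t).comp_lipschitzOnWith hK
    · have : ∀ᶠ y in 𝓝 s, β y ∈ S := (hβ.self_of_nhds).continuousAt.eventually hS
      exact hβ.and this
    · have : ∀ᶠ y in 𝓝 s, γ y ∈ S :=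
        (hγd.self_of_nhds).continuousAt.eventually (by rw [hγs]; exact hS)
      exact hγd.and this
  have h2 : HasDerivAt (fun y => f (γ y)) (t * g (β s)) s := by
    have h3 : HasDerivAt (fun t => f (α t)) (g (β s)) (t * (s - s)) := by simpa using hf
    have := HasDerivAt.comp s h3 (hlin s)
    rw [mul_comm]
    exact this
  exact h2.congr_of_eventuallyEq (hev.fun_comp f)

theorem cutoff {E F : Type} [NormedAddCommGroup E] [NormedSpace ℝ E] [FiniteDimensional ℝ E]
    [NormedAddCommGroup F] [NormedSpace ℝ F] {U : Set E} (hU : IsOpen U) (N : ℕ) {h : E → F}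
    (hh : ContDiffOn ℝ N h U) {x0 : E} (hx : x0 ∈ U) :
    ∃ h1 : E → F, ContDiff ℝ N h1 ∧ ∀ᶠ x in 𝓝 x0, h1 x = h x := by
  obtain ⟨ε, hε, hball⟩ := Metric.nhds_basis_closedBall.mem_iff.1 (hU.mem_nhds hx)
  let χ : ContDiffBump x0 := ⟨ε / 2, ε, by positivity, by linarith⟩
  refine ⟨fun x => χ x • h x, ?_, ?_⟩
  · rw [contDiff_iff_contDiffAt]
    intro x
    by_cases hxU : x ∈ U
    · exact χ.contDiff.contDiffAt.smul (hh.contDiffAt (hU.mem_nhds hxU))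
    · have h1 : x ∉ tsupport χ := by
        rw [χ.tsupport_eq]
        exact fun hx' => hxU (hball hx')
      have h2 : (fun x => χ x • h x) =ᶠ[𝓝 x] fun _ => 0 := by
        filter_upwards [notMem_tsupport_iff_eventuallyEq.1 h1] with y hy
        simp [hy]
      exact contDiffAt_const.congr_of_eventuallyEq h2
  · filter_upwards [χ.eventuallyEq_one] with x hx
    simp [hx]

theorem flow3 {E : Type} [NormedAddCommGroup E] [NormedSpace ℝ E] [FiniteDimensional ℝ E]
    {U : Set E} (hU : IsOpen U) {X : E → E} {f g : E → ℝ} (r N : ℕ) (hN : N ≠ 0) (hrN : r ≤ N)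
    (hX : ContDiffOn ℝ N X U) (hg : ContDiffOn ℝ r g U)
    (hd : HorDer U X f g) {x0 : E} (hx0 : x0 ∈ U) :
    ∃ (φ : ℝ × E → E) (G : ℝ × E → ℝ), ContDiffAt ℝ N φ (0, x0) ∧ ContDiffAt ℝ r G (0, x0) ∧
      φ (0, x0) = x0 ∧
      HasFDerivAt φ (.snd ℝ ℝ E + (ContinuousLinearMap.fst ℝ ℝ E).smulRight (X x0)) (0, x0) ∧
      ∀ᶠ p in 𝓝 ((0, x0) : ℝ × E), φ p ∈ U ∧ f (φ p) = f p.2 + G p := by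
  have : CompleteSpace E := FiniteDimensional.complete ℝ E
  obtain ⟨X1, hX1, hXe⟩ := cutoff hU N hX hx0
  obtain ⟨g1, hg1, hge⟩ := cutoff hU r hg hx0
  obtain ⟨ψ, hψs, hψ0, hψ⟩ := flow1 N hN X1 hX1 x0
  set e1 : JJ := ⟨1, by norm_num⟩ with he1
  have hrN' : (r : WithTop ℕ∞) ≤ N := by exact_mod_cast hrN
  have hev1 : ContDiff ℝ N (fun u : C(JJ, E) => u e1) :=
    (ContinuousMap.evalCLM ℝ e1 : C(JJ, E) →L[ℝ] E).contDiff
  set m : ℝ × E → E := fun p => KK E (postc X1 hX1.continuous (ψ p)) e1 with hm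
  have hms : ContDiffAt ℝ N m (0, x0) := by
    have h1 : ContDiffAt ℝ N (fun p => postc (I := JJ) X1 hX1.continuous (ψ p)) (0, x0) :=
      (contDiff_postc (I := JJ) N X1 hX1).contDiffAt.comp _ hψs
    have h2 : ContDiffAt ℝ N (fun p => KK E (postc (I := JJ) X1 hX1.continuous (ψ p))) (0, x0) := by
      fun_prop
    exact hev1.contDiffAt.comp _ h2
  set G : ℝ × E → ℝ := fun p => p.1 * KK ℝ (postc g1 hg1.continuous (ψ p)) e1 with hG
  have hGs : ContDiffAt ℝ r G (0, x0) := by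
    have h1 : ContDiffAt ℝ r (fun p => postc (I := JJ) g1 hg1.continuous (ψ p)) (0, x0) :=
      (contDiff_postc (I := JJ) r g1 hg1).contDiffAt.comp _ (hψs.of_le hrN')
    have h2 : ContDiffAt ℝ r (fun p => KK ℝ (postc (I := JJ) g1 hg1.continuous (ψ p))) (0, x0) := by
      fun_prop
    have hev2 : ContDiff ℝ r (fun u : C(JJ, ℝ) => u e1) :=
      (ContinuousMap.evalCLM ℝ e1 : C(JJ, ℝ) →L[ℝ] ℝ).contDiff
    exact contDiffAt_fst.mul (hev2.contDiffAt.comp _ h2)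
  refine ⟨fun p => ψ p e1, G, hev1.contDiffAt.comp _ hψs, hGs, by simp [hψ0], ?_, ?_⟩
  · have h1 : (fun p => ψ p e1) =ᶠ[𝓝 ((0, x0) : ℝ × E)] fun p => p.2 + p.1 • m p := by
      filter_upwards [hψ] with p hp
      conv_lhs => rw [hp]
      rfl
    have hm0 : m (0, x0) = X x0 := by
      have : postc X1 hX1.continuous (ψ (0, x0)) = ContinuousMap.const JJ (X x0) := by
        rw [hψ0]; ext s
        exact hXe.self_of_nhds
      simp only [hm]
      rw [this, KK_apply]
      simp [jext, he1]
    have hmd : HasFDerivAt m (fderiv ℝ m (0, x0)) (0, x0) :=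
      (hms.differentiableAt (by exact_mod_cast hN)).hasFDerivAt
    have h2 : HasFDerivAt (fun p : ℝ × E => p.2 + p.1 • m p) _ (0, x0) :=
      hasFDerivAt_snd.add (hasFDerivAt_fst.smul hmd)
    refine (h2.congr_of_eventuallyEq h1).congr_fderiv ?_
    ext <;> simp [hm0]
  · -- the curve stays in a neighbourhood
    have hnb : ∀ᶠ x in 𝓝 x0, X1 x = X x ∧ g1 x = g x ∧ x ∈ U :=
      hXe.and (hge.and (hU.mem_nhds hx0))
    obtain ⟨ε, hε, hb⟩ := Metric.eventually_nhds_iff_ball.1 hnb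
    have hclose : ∀ᶠ p in 𝓝 ((0, x0) : ℝ × E), dist (ψ p) (ContinuousMap.const JJ x0) < ε := by
      have := hψs.continuousAt.tendsto
      rw [hψ0] at this
      exact this.eventually (Metric.ball_mem_nhds _ hε)
    filter_upwards [hψ, hclose] with p hp hpc
    have hin : ∀ s, jext (ψ p) s ∈ Metric.ball x0 ε := fun s =>
      (ContinuousMap.dist_apply_le_dist (g := ContinuousMap.const JJ x0) _).trans_lt hpc
    obtain ⟨h0, hder⟩ := flow2 X1 hX1.continuous p.1 p.2 (ψ p) hp
    have h1 : ψ p e1 = jext (ψ p) 1 := by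
      rw [jext, projIcc_of_mem (by norm_num) (by norm_num)]
    have hfd : ∀ s ∈ Ioo (-1 : ℝ) 2, HasDerivAt (fun y => f (jext (ψ p) y))
        (p.1 * g1 (jext (ψ p) s)) s := by
      intro s hs
      rw [(hb _ (hin s)).2.1]
      refine deriv_along hU (hX.of_le (by exact_mod_cast Nat.one_le_iff_ne_zero.2 hN)) hd _ _ _
        (hb _ (hin s)).2.2 ?_
      filter_upwards [Ioo_mem_nhds hs.1 hs.2] with y hy
      have := hder y hy
      rwa [(hb _ (hin y)).1] at this
    have hinteg : ∫ s in (0:ℝ)..1, p.1 * g1 (jext (ψ p) s) = f (jext (ψ p) 1) - f (jext (ψ p) 0) := by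
      refine intervalIntegral.integral_eq_sub_of_hasDerivAt (fun s hs => hfd s ?_) ?_
      · rw [uIcc_of_le zero_le_one] at hs
        exact ⟨by linarith [hs.1], by linarith [hs.2]⟩
      · exact (continuous_const.mul
          (hg1.continuous.comp (jext_cont (ψ p)))).intervalIntegrable _ _
    refine ⟨by rw [h1]; exact (hb _ (hin 1)).2.2, ?_⟩
    have hGp : G p = ∫ s in (0:ℝ)..1, p.1 * g1 (jext (ψ p) s) := by
      rw [intervalIntegral.integral_const_mul]
      rfl
    show f (ψ p e1) = _
    rw [hGp, hinteg, h1, h0]; ring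

theorem tangent_field {E F : Type} [NormedAddCommGroup E] [NormedSpace ℝ E]
    [FiniteDimensional ℝ E] [NormedAddCommGroup F] [NormedSpace ℝ F] [FiniteDimensional ℝ F]
    {Ψ : F → E} {s0 : F} (hΨ : ContDiffAt ℝ 2 Ψ s0)
    (hinj : Function.Injective (fderiv ℝ Ψ s0)) {X : E → E}
    (hX : DifferentiableAt ℝ X (Ψ s0))
    (hT : ∀ᶠ s in 𝓝 s0, ∃ v, fderiv ℝ Ψ s v = X (Ψ s)) :
    ∃ ξ : F → F, DifferentiableAt ℝ ξ s0 ∧ ∀ᶠ s in 𝓝 s0, X (Ψ s) = fderiv ℝ Ψ s (ξ s) := by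
  have : CompleteSpace F := FiniteDimensional.complete ℝ F
  obtain ⟨L0, hL0⟩ := LinearMap.exists_leftInverse_of_injective (fderiv ℝ Ψ s0 : F →ₗ[ℝ] E)
    (LinearMap.ker_eq_bot.2 hinj)
  set L : E →L[ℝ] F := LinearMap.toContinuousLinearMap L0 with hL
  set A : F → (F →L[ℝ] F) := fun s => L ∘L fderiv ℝ Ψ s with hA
  have hdd : DifferentiableAt ℝ (fderiv ℝ Ψ) s0 :=
    (hΨ.fderiv_right (m := 1) (by norm_num)).differentiableAt (by norm_num)
  have hAd : DifferentiableAt ℝ A s0 := by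
    have : DifferentiableAt ℝ (fun _ : F => L) s0 := differentiableAt_const _
    exact this.clm_comp hdd
  have hA0 : A s0 = 1 := by
    ext v
    exact LinearMap.congr_fun hL0 v
  have hAu : ∀ᶠ s in 𝓝 s0, IsUnit (A s) := by
    refine hAd.continuousAt.eventually (Units.isOpen.mem_nhds ?_)
    show IsUnit (A s0)
    rw [hA0]; exact isUnit_one
  have hinv : DifferentiableAt ℝ (fun s => Ring.inverse (A s)) s0 := by
    have h1 : DifferentiableAt ℝ (Ring.inverse : (F →L[ℝ] F) → _) (A s0) := by
      rw [hA0]; exact differentiableAt_inverse isUnit_one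
    exact h1.comp s0 hAd
  refine ⟨fun s => Ring.inverse (A s) (L (X (Ψ s))), ?_, ?_⟩
  · have hΨd : DifferentiableAt ℝ Ψ s0 := hΨ.differentiableAt (by norm_num)
    have h2 : DifferentiableAt ℝ (fun s => X (Ψ s)) s0 := hX.comp s0 hΨd
    exact hinv.clm_apply (L.differentiableAt.comp s0 h2)
  · filter_upwards [hAu, hT] with s hs hv
    obtain ⟨v, hv⟩ := hv
    have h3 : L (X (Ψ s)) = A s v := by rw [← hv]; rfl
    have h4 : Ring.inverse (A s) (A s v) = v := by
      have := Ring.inverse_mul_cancel _ hs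
      exact congrArg (fun T : F →L[ℝ] F => T v) this
    rw [h3, h4, hv]

theorem tangent_bracket {E F : Type} [NormedAddCommGroup E] [NormedSpace ℝ E]
    [FiniteDimensional ℝ E] [NormedAddCommGroup F] [NormedSpace ℝ F] [FiniteDimensional ℝ F]
    {Ψ : F → E} {s0 : F} (hΨ : ContDiffAt ℝ 2 Ψ s0)
    (hinj : Function.Injective (fderiv ℝ Ψ s0)) {X Y : E → E}
    (hX : DifferentiableAt ℝ X (Ψ s0)) (hY : DifferentiableAt ℝ Y (Ψ s0))
    (hTX : ∀ᶠ s in 𝓝 s0, ∃ v, fderiv ℝ Ψ s v = X (Ψ s))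
    (hTY : ∀ᶠ s in 𝓝 s0, ∃ v, fderiv ℝ Ψ s v = Y (Ψ s)) :
    ∃ v, fderiv ℝ Ψ s0 v = fderiv ℝ Y (Ψ s0) (X (Ψ s0)) - fderiv ℝ X (Ψ s0) (Y (Ψ s0)) := by
  obtain ⟨ξ, hξd, hξ⟩ := tangent_field hΨ hinj hX hTX
  obtain ⟨η, hηd, hη⟩ := tangent_field hΨ hinj hY hTY
  have hdd : DifferentiableAt ℝ (fderiv ℝ Ψ) s0 :=
    (hΨ.fderiv_right (m := 1) (by norm_num)).differentiableAt (by norm_num)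
  have hΨd : DifferentiableAt ℝ Ψ s0 := hΨ.differentiableAt (by norm_num)
  have main : ∀ (Z : E → E) (ζ : F → F), DifferentiableAt ℝ Z (Ψ s0) → DifferentiableAt ℝ ζ s0 →
      (∀ᶠ s in 𝓝 s0, Z (Ψ s) = fderiv ℝ Ψ s (ζ s)) → ∀ v,
      fderiv ℝ Z (Ψ s0) (fderiv ℝ Ψ s0 v) =
        fderiv ℝ Ψ s0 (fderiv ℝ ζ s0 v) + fderiv ℝ (fderiv ℝ Ψ) s0 v (ζ s0) := by
    intro Z ζ hZ hζ he v
    have h1 : HasFDerivAt (fun s => Z (Ψ s)) (fderiv ℝ Z (Ψ s0) ∘L fderiv ℝ Ψ s0) s0 :=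
      hZ.hasFDerivAt.comp s0 hΨd.hasFDerivAt
    have h2 := hdd.hasFDerivAt.clm_apply hζ.hasFDerivAt
    have h3 := (h1.congr_of_eventuallyEq (EventuallyEq.symm he)).unique h2
    have := congrArg (fun T : F →L[ℝ] E => T v) h3
    simpa using this
  have hsymm := (hΨ.isSymmSndFDerivAt (by simp)).eq (ξ s0) (η s0)
  have e1 := main X ξ hX hξd hξ (η s0)
  have e2 := main Y η hY hηd hη (ξ s0)
  rw [← hξ.self_of_nhds] at e2
  rw [← hη.self_of_nhds] at e1
  refine ⟨fderiv ℝ η s0 (ξ s0) - fderiv ℝ ξ s0 (η s0), ?_⟩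
  rw [e1, e2, hsymm, map_sub]; abel

theorem inj_eventually {E F : Type} [NormedAddCommGroup E] [NormedSpace ℝ E]
    [FiniteDimensional ℝ E] [NormedAddCommGroup F] [NormedSpace ℝ F] [FiniteDimensional ℝ F]
    {Ψ : F → E} {s0 : F} (hΨ : ContDiffAt ℝ 2 Ψ s0)
    (hinj : Function.Injective (fderiv ℝ Ψ s0)) :
    ∀ᶠ s in 𝓝 s0, Function.Injective (fderiv ℝ Ψ s) := by
  have hdd : ContinuousAt (fderiv ℝ Ψ) s0 :=
    (hΨ.fderiv_right (m := 1) (by norm_num)).continuousAt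
  exact hdd.eventually (ContinuousLinearMap.isOpen_injective.mem_nhds hinj)

/-- Immersed pieces of dimension `p` inside `R` along which `f` is `C^r`. -/
def Emb {E : Type} [NormedAddCommGroup E] [NormedSpace ℝ E] (R : Set E) (f : E → ℝ)
    (N r p : ℕ) : Prop :=
  ∃ (F : Type) (_ : NormedAddCommGroup F) (_ : NormedSpace ℝ F) (_ : FiniteDimensional ℝ F)
    (Ψ : F → E) (s0 : F), Module.finrank ℝ F = p ∧ ContDiffAt ℝ N Ψ s0 ∧
    ContDiffAt ℝ r (fun s => f (Ψ s)) s0 ∧ Function.Injective (fderiv ℝ Ψ s0) ∧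
    ∀ᶠ s in 𝓝 s0, Ψ s ∈ R

/-- Points of `U` from which regularity propagates to `x0`. -/
def RR {E : Type} [NormedAddCommGroup E] [NormedSpace ℝ E] (U : Set E) (f : E → ℝ) (r : ℕ)
    (x0 : E) : Set E := {y | y ∈ U ∧ (ContDiffAt ℝ r f y → ContDiffAt ℝ r f x0)}

theorem emb_extend {E F : Type} [NormedAddCommGroup E] [NormedSpace ℝ E] [FiniteDimensional ℝ E]
    [NormedAddCommGroup F] [NormedSpace ℝ F] [FiniteDimensional ℝ F]
    {U : Set E} (hU : IsOpen U) {X : E → E} {f g : E → ℝ} (r N : ℕ) (hN : N ≠ 0) (hrN : r ≤ N)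
    (hX : ContDiffOn ℝ N X U) (hg : ContDiffOn ℝ r g U)
    (hd : HorDer U X f g) (x0 : E) {Ψ : F → E} {s0 : F} (hΨ : ContDiffAt ℝ N Ψ s0)
    (hf : ContDiffAt ℝ r (fun s => f (Ψ s)) s0) (hinj : Function.Injective (fderiv ℝ Ψ s0))
    (hR : ∀ᶠ s in 𝓝 s0, Ψ s ∈ RR U f r x0)
    (hnot : ¬ ∃ v, fderiv ℝ Ψ s0 v = X (Ψ s0)) :
    Emb (RR U f r x0) f N r (Module.finrank ℝ F + 1) := by
  have hrN' : (r : WithTop ℕ∞) ≤ N := by exact_mod_cast hrN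
  have hN0 : (N : WithTop ℕ∞) ≠ 0 := by exact_mod_cast hN
  obtain ⟨φ, G, hφ, hG, hφ0, hφd, hev⟩ :=
    flow3 hU r N hN hrN hX hg hd hR.self_of_nhds.1
  have hP : ContDiffAt ℝ N (fun q : F × ℝ => (q.2, Ψ q.1)) (s0, 0) :=
    contDiffAt_snd.prodMk (ContDiffAt.comp (g := Ψ) _ hΨ contDiffAt_fst)
  have hPt : Tendsto (fun q : F × ℝ => (q.2, Ψ q.1)) (𝓝 (s0, 0)) (𝓝 (0, Ψ s0)) :=
    hP.continuousAt
  refine ⟨F × ℝ, inferInstance, inferInstance, inferInstance, fun q => φ (q.2, Ψ q.1), (s0, 0),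
    by simp, ContDiffAt.comp (g := φ) _ hφ hP, ?_, ?_, ?_⟩
  · have h1 : ContDiffAt ℝ r (fun q : F × ℝ => f (Ψ q.1) + G (q.2, Ψ q.1)) (s0, 0) :=
      (ContDiffAt.comp (g := fun s => f (Ψ s)) (f := fun q : F × ℝ => q.1) (s0, 0) hf
        contDiffAt_fst).add
        (ContDiffAt.comp (g := G) (s0, (0:ℝ)) hG (hP.of_le hrN'))
    refine h1.congr_of_eventuallyEq ?_
    filter_upwards [hPt.eventually hev] with q hq
    exact hq.2
  · have hΨd : HasFDerivAt Ψ (fderiv ℝ Ψ s0) s0 := (hΨ.differentiableAt hN0).hasFDerivAt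
    have hPd : HasFDerivAt (fun q : F × ℝ => (q.2, Ψ q.1))
        ((ContinuousLinearMap.snd ℝ F ℝ).prod (fderiv ℝ Ψ s0 ∘L .fst ℝ F ℝ)) (s0, 0) :=
      hasFDerivAt_snd.prodMk (HasFDerivAt.comp (g := Ψ) (s0, (0:ℝ)) hΨd hasFDerivAt_fst)
    have hcd := HasFDerivAt.comp (g := φ) (s0, (0:ℝ)) hφd hPd
    have hcd' : fderiv ℝ (fun q : F × ℝ => φ (q.2, Ψ q.1)) (s0, 0) = _ := hcd.fderiv
    rw [hcd', injective_iff_map_eq_zero]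
    rintro ⟨v, t⟩ hvt
    have hvt' : fderiv ℝ Ψ s0 v + t • X (Ψ s0) = 0 := by simpa using hvt
    have ht : t = 0 := by
      by_contra ht
      refine hnot ⟨-(t⁻¹ • v), ?_⟩
      rw [map_neg, map_smul, eq_neg_of_add_eq_zero_left hvt', smul_neg, neg_neg, smul_smul,
        inv_mul_cancel₀ ht, one_smul]
    subst ht
    have : v = 0 := (injective_iff_map_eq_zero _).1 hinj v (by simpa using hvt')
    rw [this]; rfl
  · have hc : ∀ᶠ p in 𝓝 ((0, Ψ s0) : ℝ × E), p.2 ∈ RR U f r x0 → φ p ∈ RR U f r x0 := by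
      filter_upwards [hφ.eventually (by simp), hG.eventually (by simp),
        hev.eventually_nhds] with p h1 h2 h3 h4
      refine ⟨h3.self_of_nhds.1, fun h5 => h4.2 ?_⟩
      have hQ : ContDiffAt ℝ N (fun y : E => (p.1, y)) p.2 := contDiffAt_const.prodMk contDiffAt_id
      have h6 : ContDiffAt ℝ r (fun y => f (φ (p.1, y)) - G (p.1, y)) p.2 := by
        have a1 : ContDiffAt ℝ r (fun y => φ (p.1, y)) p.2 :=
          (ContDiffAt.comp (g := φ) p.2 h1 hQ).of_le hrN'
        have a2 : ContDiffAt ℝ r (fun y => G (p.1, y)) p.2 :=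
          ContDiffAt.comp (g := G) p.2 h2 (hQ.of_le hrN')
        have a3 : ContDiffAt ℝ r (fun y => f (φ (p.1, y))) p.2 :=
          ContDiffAt.comp (g := f) p.2 h5 a1
        exact a3.sub a2
      refine h6.congr_of_eventuallyEq ?_
      have : Tendsto (fun y : E => (p.1, y)) (𝓝 p.2) (𝓝 p) := hQ.continuousAt
      filter_upwards [this.eventually h3] with y hy
      rw [hy.2]; simp
    have hfst : Tendsto (fun q : F × ℝ => q.1) (𝓝 (s0, 0)) (𝓝 s0) := continuous_fst.continuousAt
    filter_upwards [hPt.eventually hc, hfst.eventually hR] with q h1 h2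
    exact h1 h2

theorem lieHull_smooth {n k : ℕ} (U : Set (Fin n → ℝ)) (hUopen : IsOpen U)
    (X : Fin k → (Fin n → ℝ) → (Fin n → ℝ))
    (hXsmooth : ∀ i, ContDiffOn ℝ (⊤ : ℕ∞) (X i) U) (Z : (Fin n → ℝ) → (Fin n → ℝ))
    (hZ : LieHull (Set.range X) Z) : ContDiffOn ℝ (⊤ : ℕ∞) Z U := by
  induction hZ with
  | base h => obtain ⟨i, rfl⟩ := h; exact hXsmooth i
  | br _ _ h1 h2 =>
    exact ((h2.fderiv_of_isOpen hUopen (by simp)).clm_apply h1).sub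
      ((h1.fderiv_of_isOpen hUopen (by simp)).clm_apply h2)

theorem emb_all {n k : ℕ} (U : Set (Fin n → ℝ)) (hUopen : IsOpen U)
    (X : Fin k → (Fin n → ℝ) → (Fin n → ℝ))
    (hXsmooth : ∀ i, ContDiffOn ℝ (⊤ : ℕ∞) (X i) U)
    (hbg : BracketGenerating U (Set.range X))
    (r N : ℕ) (hN : 2 ≤ N) (hrN : r ≤ N) (f : (Fin n → ℝ) → ℝ) (g : Fin k → (Fin n → ℝ) → ℝ)
    (hgC : ∀ i, ContDiffOn ℝ r (g i) U)
    (hder : ∀ i, HorDer U (X i) f (g i)) (x0 : Fin n → ℝ) (hx0 : x0 ∈ U) (p : ℕ) (hp : p ≤ n) :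
    Emb (RR U f r x0) f N r p := by
  induction p with
  | zero =>
    refine ⟨Fin 0 → ℝ, inferInstance, inferInstance, inferInstance, fun _ => x0, 0, by simp,
      contDiffAt_const, contDiffAt_const, Function.injective_of_subsingleton _, ?_⟩
    exact Eventually.of_forall fun _ => ⟨hx0, id⟩
  | succ p ih =>
    obtain ⟨F, i1, i2, i3, Ψ, s0, hdim, hΨ, hf, hinj, hR⟩ := ih (by omega)
    by_contra hno
    have hN2 : (2 : WithTop ℕ∞) ≤ N := by exact_mod_cast hN
    have hΨ2 := hΨ.of_le hN2
    have hinjE := inj_eventually hΨ2 hinj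
    have hΨE := hΨ2.eventually (by simp)
    have hT : ∀ Z, LieHull (Set.range X) Z → ∀ᶠ s in 𝓝 s0, ∃ v, fderiv ℝ Ψ s v = Z (Ψ s) := by
      intro Z hZ
      induction hZ with
      | base h =>
        obtain ⟨i, rfl⟩ := h
        filter_upwards [hΨ.eventually (by simp), hf.eventually (by simp), hinjE,
          hR.eventually_nhds] with s a1 a2 a3 a4
        by_contra hnot
        apply hno
        rw [← hdim]
        exact emb_extend hUopen r N (by omega) hrN
          ((hXsmooth i).of_le (by exact_mod_cast le_top)) (hgC i) (hder i) x0 a1 a2 a3 a4 hnot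
      | @br Z1 Z2 hz1 hz2 h1 h2 =>
        filter_upwards [hΨE, hinjE, hR, h1.eventually_nhds, h2.eventually_nhds]
          with s a1 a2 a3 a4 a5
        have d1 := ((lieHull_smooth U hUopen X hXsmooth Z1 hz1).contDiffAt
          (hUopen.mem_nhds a3.1)).differentiableAt (by simp)
        have d2 := ((lieHull_smooth U hUopen X hXsmooth Z2 hz2).contDiffAt
          (hUopen.mem_nhds a3.1)).differentiableAt (by simp)
        exact tangent_bracket a1 a2 d1 d2 a4 a5
    have hspan := hbg (Ψ s0) hR.self_of_nhds.1
    have hle : (⊤ : Submodule ℝ (Fin n → ℝ)) ≤ LinearMap.range (fderiv ℝ Ψ s0 : F →ₗ[ℝ] _) := by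
      rw [← hspan, Submodule.span_le]
      rintro v ⟨Z, hZ, rfl⟩
      exact (hT Z hZ).self_of_nhds
    have h1 := LinearMap.finrank_range_le (fderiv ℝ Ψ s0 : F →ₗ[ℝ] (Fin n → ℝ))
    rw [top_le_iff.1 hle, finrank_top, hdim] at h1
    simp at h1
    omega

/-- **Regularity form of the Poincaré Lemma in subriemannian geometry.**
Let `X₁, …, X_k` be smooth bracket generating vector fields on the open set `U ⊆ ℝⁿ`.
Suppose that for each `i` the horizontal derivative `Xᵢ f` exists at every point of `U` —
i.e. there is a function `g i` such that, for every `x ∈ U`, along the integral curve `α`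
of `Xᵢ` with `α 0 = x`, the map `t ↦ f (α t)` has derivative `g i x` at `t = 0` — and that
each `g i = Xᵢ f` is of class `C^r`.  Then `f` is of class `C^r` on `U`. -/
theorem poincare_regularity {n k : ℕ} (U : Set (Fin n → ℝ)) (hUopen : IsOpen U)
    (X : Fin k → (Fin n → ℝ) → (Fin n → ℝ))
    (hXsmooth : ∀ i, ContDiffOn ℝ (⊤ : ℕ∞) (X i) U)
    (hbg : BracketGenerating U (Set.range X))
    (r : ℕ) (f : (Fin n → ℝ) → ℝ) (g : Fin k → (Fin n → ℝ) → ℝ)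
    (hgC : ∀ i, ContDiffOn ℝ (r : ℕ∞) (g i) U)
    (hder : ∀ i, ∀ x ∈ U, ∃ α : ℝ → Fin n → ℝ, α 0 = x ∧
      (∀ᶠ t in nhds (0 : ℝ), α t ∈ U ∧ HasDerivAt α (X i (α t)) t) ∧
      HasDerivAt (fun t => f (α t)) (g i x) 0) :
    ContDiffOn ℝ (r : ℕ∞) f U := by
  intro x0 hx0
  refine ContDiffAt.contDiffWithinAt ?_
  have hN2 : (r + 2 : ℕ) ≠ 0 := by omega
  obtain ⟨F, i1, i2, i3, Ψ, s0, hdim, hΨ, hf, hinj, hR⟩ :=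
    emb_all U hUopen X hXsmooth hbg r (r + 2) (by omega) (by omega) f g hgC hder x0 hx0 n le_rfl
  refine hR.self_of_nhds.2 ?_
  have : CompleteSpace F := FiniteDimensional.complete ℝ F
  have hN0 : ((r + 2 : ℕ) : WithTop ℕ∞) ≠ 0 := by exact_mod_cast hN2
  let e0 : F ≃ₗ[ℝ] (Fin n → ℝ) := LinearEquiv.ofInjectiveOfFinrankEq
    (fderiv ℝ Ψ s0 : F →ₗ[ℝ] (Fin n → ℝ)) hinj (by simp [hdim])
  let e : F ≃L[ℝ] (Fin n → ℝ) := e0.toContinuousLinearEquiv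
  have hΨd : HasFDerivAt Ψ (e : F →L[ℝ] (Fin n → ℝ)) s0 := by
    have h1 : HasFDerivAt Ψ (fderiv ℝ Ψ s0) s0 := (hΨ.differentiableAt hN0).hasFDerivAt
    have h2 : (e : F →L[ℝ] (Fin n → ℝ)) = fderiv ℝ Ψ s0 := by ext v; rfl
    rw [h2]; exact h1
  have hσ := hΨ.to_localInverse hΨd hN0
  set σ := hΨ.localInverse hΨd hN0 with hσdef
  have hstr : HasStrictFDerivAt Ψ (e : F →L[ℝ] (Fin n → ℝ)) s0 := hΨ.hasStrictFDerivAt' hΨd hN0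
  have hright : ∀ᶠ y in 𝓝 (Ψ s0), Ψ (σ y) = y := hstr.eventually_right_inverse
  have hσ0 : σ (Ψ s0) = s0 := hstr.localInverse_apply_image
  have hle : (r : WithTop ℕ∞) ≤ ((r + 2 : ℕ) : WithTop ℕ∞) := by
    exact_mod_cast (by omega : r ≤ r + 2)
  have hcomp : ContDiffAt ℝ r (fun y => f (Ψ (σ y))) (Ψ s0) :=
    ContDiffAt.comp (g := fun s => f (Ψ s)) (Ψ s0) (by rw [hσ0]; exact hf) (hσ.of_le hle)
  refine hcomp.congr_of_eventuallyEq ?_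
  filter_upwards [hright] with y hy
  rw [hy]
end
end
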